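/- arXiv:2305.05409 — 2 statements merged into one kernel-verified Lean document; each statement's English description precedes it below -/
import Mathlib

section
/- Let h : ℂ → ℝ be a smooth (C^∞) map and let E_h := { x + iy ∈ ℂ : h(x,y) = 0 } with dh ≠ 0 at every point of E_h. Let K be a connected, simply-coconnected compact subset of M := E_h × ℂ ⊂ ℂ² such that for each c ∈ ℂ the fiber K_c := { w ∈ ℂ : (c,w) ∈ K } is polynomially convex. Then K is polynomially convex. -/
noncomputable section

/-- The polynomial (convex) hull of a set `K ⊆ ℂⁿ`:
`K̂ = { z : |p(z)| ≤ sup_K |p| for every holomorphic polynomial p }`. -/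
def polyHull (n : ℕ) (K : Set (Fin n → ℂ)) : Set (Fin n → ℂ) :=
  {z | ∀ p : MvPolynomial (Fin n) ℂ,
    ‖MvPolynomial.eval z p‖ ≤ sSup ((fun w => ‖MvPolynomial.eval w p‖) '' K)}

/-- A set `K ⊆ ℂⁿ` is polynomially convex if it equals its polynomial hull. -/
def PolyConvex (n : ℕ) (K : Set (Fin n → ℂ)) : Prop := polyHull n K = K

/-- A Runge domain in `ℂⁿ`: a domain on which every holomorphic function can be
approximated uniformly on compact subsets by holomorphic polynomials. -/
def RungeDomain (n : ℕ) (Ω : Set (Fin n → ℂ)) : Prop :=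
  IsOpen Ω ∧ IsConnected Ω ∧
  ∀ f : (Fin n → ℂ) → ℂ, DifferentiableOn ℂ f Ω →
    ∀ K : Set (Fin n → ℂ), K ⊆ Ω → IsCompact K → ∀ ε : ℝ, 0 < ε →
      ∃ p : MvPolynomial (Fin n) ℂ, ∀ z ∈ K, ‖f z - MvPolynomial.eval z p‖ ≤ ε

/-- `K ⊆ ℂⁿ` is a totally real `C²`-smooth disc: the image of the closed unit
disc in `ℝ²` under a `C²` embedding `φ` (defined on an open neighborhood `U` of
the closed disc) whose image is a totally real submanifold, i.e. at each point
the tangent plane `W = range (dφ)` satisfies `W ∩ i·W = {0}`. -/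
def TotallyRealDisc (n : ℕ) (K : Set (Fin n → ℂ)) : Prop :=
  ∃ (U : Set (ℝ × ℝ)) (φ : ℝ × ℝ → (Fin n → ℂ)),
    IsOpen U ∧ Metric.closedBall (0 : ℝ × ℝ) 1 ⊆ U ∧
    ContDiffOn ℝ 2 φ U ∧ Set.InjOn φ U ∧
    (∀ x ∈ U, Function.Injective (fderiv ℝ φ x)) ∧
    (∀ x ∈ U, ∀ v w : ℝ × ℝ,
      fderiv ℝ φ x v = Complex.I • fderiv ℝ φ x w → fderiv ℝ φ x v = 0) ∧
    K = φ '' Metric.closedBall (0 : ℝ × ℝ) 1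

/-- A compact set `K ⊆ ℂⁿ` is simply-coconnected if every continuous nowhere
vanishing `f : K → ℂ ∖ {0}` has a continuous logarithm on `K`. -/
def SimplyCoconnected (n : ℕ) (K : Set (Fin n → ℂ)) : Prop :=
  ∀ f : (Fin n → ℂ) → ℂ, ContinuousOn f K → (∀ x ∈ K, f x ≠ 0) →
    ∃ ψ : (Fin n → ℂ) → ℂ, ContinuousOn ψ K ∧ ∀ x ∈ K, f x = Complex.exp (ψ x)

/-- The polynomial hull of a subset of `ℂ` (one variable). -/
def polyHull1 (K : Set ℂ) : Set ℂ :=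
  {z | ∀ p : Polynomial ℂ, ‖p.eval z‖ ≤ sSup ((fun w => ‖p.eval w‖) '' K)}

/-- A subset of `ℂ` is polynomially convex if it equals its polynomial hull. -/
def PolyConvex1 (K : Set ℂ) : Prop := polyHull1 K = K

section PolynomialHulls

open MeasureTheory Set Filter Topology

/-- Twice the Cauchy–Riemann operator `∂/∂z̄`. -/
def dbar (χ : ℂ → ℂ) (u : ℂ) : ℂ := fderiv ℝ χ u 1 + Complex.I * fderiv ℝ χ u Complex.I

theorem dbar_eq_zero_of_eventuallyEq_const {χ : ℂ → ℂ} {u c : ℂ} (h : χ =ᶠ[𝓝 u] fun _ => c) :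
    dbar χ u = 0 := by
  simp [dbar, h.fderiv_eq]

theorem dbar_sub {χ₁ χ₂ : ℂ → ℂ} (h₁ : ContDiff ℝ 1 χ₁) (h₂ : ContDiff ℝ 1 χ₂) (u : ℂ) :
    dbar (fun v => χ₁ v - χ₂ v) u = dbar χ₁ u - dbar χ₂ u := by
  have e₁ := (h₁.differentiable one_ne_zero) u
  have e₂ := (h₂.differentiable one_ne_zero) u
  simp only [dbar, fderiv_fun_sub e₁ e₂, sub_apply]
  ring

theorem continuous_dbar {χ : ℂ → ℂ} (h : ContDiff ℝ 1 χ) : Continuous (dbar χ) := by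
  have := h.continuous_fderiv one_ne_zero
  unfold dbar
  fun_prop

theorem support_dbar_subset (χ : ℂ → ℂ) : Function.support (dbar χ) ⊆ tsupport χ := by
  intro u hu
  by_contra h
  exact hu (dbar_eq_zero_of_eventuallyEq_const (notMem_tsupport_iff_eventuallyEq.mp h))

theorem hasCompactSupport_dbar {χ : ℂ → ℂ} (h : HasCompactSupport χ) :
    HasCompactSupport (dbar χ) :=
  HasCompactSupport.intro h fun _ hu => by
    by_contra hne
    exact hu (support_dbar_subset χ hne)

theorem integral_dbar_mul_eq_zero {χ g : ℂ → ℂ} (hχ : ContDiff ℝ 1 χ) (hc : HasCompactSupport χ)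
    (hg : ∀ u ∈ tsupport χ, AnalyticAt ℂ g u) : ∫ u, dbar χ u * g u = 0 := by
  have hgR (u) (hu : u ∈ tsupport χ) : AnalyticAt ℝ g u := (hg u hu).restrictScalars
  have hχ' := hχ.continuous_fderiv one_ne_zero
  have int1 (v : ℂ) : Integrable fun u => fderiv ℝ χ u v * g u := by
    refine Continuous.integrable_of_hasCompactSupport (continuous_of_tsupport fun u hu => ?_) ?_
    · have hu' : u ∈ tsupport χ :=
        tsupport_fderiv_subset ℝ (closure_mono (fun x hx => by
          intro h0; exact hx (by simp [h0])) hu)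
      exact ((hχ'.clm_apply continuous_const).continuousAt).mul (hgR u hu').continuousAt
    · exact (hc.fderiv_apply ℝ v).mul_right
  have int2 : Integrable fun u => χ u * g u := by
    refine Continuous.integrable_of_hasCompactSupport (continuous_of_tsupport fun u hu => ?_) ?_
    · exact hχ.continuous.continuousAt.mul (hgR u (tsupport_mul_subset_left hu)).continuousAt
    · exact hc.mul_right
  have int3 (v : ℂ) : Integrable fun u => χ u * fderiv ℝ g u v := by
    refine Continuous.integrable_of_hasCompactSupport (continuous_of_tsupport fun u hu => ?_) ?_
    · exact hχ.continuous.continuousAt.mul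
        ((hgR u (tsupport_mul_subset_left hu)).fderiv.continuousAt.clm_apply continuousAt_const)
    · exact hc.mul_right
  have key (v : ℂ) : ∫ u, fderiv ℝ χ u v * g u = - ∫ u, χ u * fderiv ℝ g u v := by
    rw [integral_mul_fderiv_eq_neg_fderiv_mul_of_integrable (int1 v) (int3 v) int2
      (fun u _ => hχ.differentiable one_ne_zero u) (fun u hu => (hgR u hu).differentiableAt),
      neg_neg]
  have hCR (u : ℂ) : χ u * fderiv ℝ g u Complex.I = Complex.I * (χ u * fderiv ℝ g u 1) := by
    by_cases hu : u ∈ tsupport χ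
    · rw [(hg u hu).differentiableAt.fderiv_restrictScalars ℝ]
      have : fderiv ℂ g u Complex.I = Complex.I * fderiv ℂ g u 1 := by
        rw [← smul_eq_mul, ← map_smul]; simp
      simp only [ContinuousLinearMap.coe_restrictScalars', this]
      ring
    · simp [image_eq_zero_of_notMem_tsupport hu]
  have e (u : ℂ) : dbar χ u * g u
      = fderiv ℝ χ u 1 * g u + Complex.I * (fderiv ℝ χ u Complex.I * g u) := by
    simp only [dbar]; ring
  simp_rw [e]
  rw [integral_add (int1 1) ((int1 Complex.I).const_mul _), integral_const_mul, key, key]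
  simp_rw [hCR]
  rw [integral_const_mul]
  linear_combination (-∫ u, χ u * fderiv ℝ g u 1) * Complex.I_mul_I

/-- A radial cutoff around `w`. -/
theorem exists_radial_cutoff (w : ℂ) : ∃ χ : ℂ → ℂ, ContDiff ℝ 1 χ ∧ HasCompactSupport χ ∧
    (∀ᶠ u in 𝓝 w, χ u = 1) ∧ ∫ u, dbar χ u * (w - u)⁻¹ ≠ 0 := by
  set φ : ℝ → ℝ := fun t => Real.smoothTransition (2 - t) with hφ
  have hφs : ContDiff ℝ 1 φ := Real.smoothTransition.contDiff.comp (by fun_prop)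
  set q : ℂ → ℝ := fun u => Complex.normSq (u - w) with hq
  have hqe : q = fun u => (u - w).re * (u - w).re + (u - w).im * (u - w).im := by
    ext u; simp [hq, Complex.normSq_apply]
  have hqd (u : ℂ) : HasFDerivAt q
      ((2 * (u - w).re) • Complex.reCLM + (2 * (u - w).im) • Complex.imCLM) u := by
    have h1 : HasFDerivAt (fun u : ℂ => (u - w).re) Complex.reCLM u :=
      Complex.reCLM.hasFDerivAt.comp u ((hasFDerivAt_id u).sub_const w)
    have h2 : HasFDerivAt (fun u : ℂ => (u - w).im) Complex.imCLM u :=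
      Complex.imCLM.hasFDerivAt.comp u ((hasFDerivAt_id u).sub_const w)
    rw [hqe]
    refine ((h1.mul h1).add (h2.mul h2)).congr_fderiv ?_
    ext v
    simp
    ring
  have hqs : ContDiff ℝ 1 q := by
    rw [hqe]
    have h1 : ContDiff ℝ 1 (fun u : ℂ => (u - w).re) :=
      Complex.reCLM.contDiff.comp (contDiff_id.sub contDiff_const)
    have h2 : ContDiff ℝ 1 (fun u : ℂ => (u - w).im) :=
      Complex.imCLM.contDiff.comp (contDiff_id.sub contDiff_const)
    exact (h1.mul h1).add (h2.mul h2)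
  set χ : ℂ → ℂ := fun u => ((φ (q u) : ℝ) : ℂ) with hχ
  have hχs : ContDiff ℝ 1 χ := Complex.ofRealCLM.contDiff.comp (hφs.comp hqs)
  have hχc : HasCompactSupport χ := by
    refine HasCompactSupport.intro (isCompact_closedBall w 2) fun u hu => ?_
    have : 2 < ‖u - w‖ := by simpa [dist_eq_norm] using hu
    have h4 : 2 - q u ≤ 0 := by
      simp only [hq, Complex.normSq_eq_norm_sq]; nlinarith
    simp [hχ, hφ, Real.smoothTransition.zero_of_nonpos h4]
  have hdb (u : ℂ) : dbar χ u = ((2 * deriv φ (q u) : ℝ) : ℂ) * (u - w) := by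
    have hd : HasFDerivAt χ (Complex.ofRealCLM.comp (deriv φ (q u) •
        ((2 * (u - w).re) • Complex.reCLM + (2 * (u - w).im) • Complex.imCLM))) u :=
      Complex.ofRealCLM.hasFDerivAt.comp u
        (((hφs.differentiable one_ne_zero (q u)).hasDerivAt).comp_hasFDerivAt u (hqd u))
    rw [dbar, hd.fderiv]
    apply Complex.ext <;> simp <;> ring
  have hanti : Antitone φ := fun s t hst => Real.smoothTransition.monotone (by linarith)
  refine ⟨χ, hχs, hχc, ?_, ?_⟩
  · have : ∀ᶠ u in 𝓝 w, q u < 1 :=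
      hqs.continuous.continuousAt.eventually (gt_mem_nhds (by simp [hq]))
    filter_upwards [this] with u hu
    simp [hχ, hφ, Real.smoothTransition.one_of_one_le (show 1 ≤ 2 - q u by linarith)]
  · have hcont : Continuous fun u => -(2 * deriv φ (q u)) :=
      ((hφs.continuous_deriv_one.comp hqs.continuous).const_mul 2).neg
    have hae : (fun u => dbar χ u * (w - u)⁻¹) =ᵐ[volume]
        fun u => ((-(2 * deriv φ (q u)) : ℝ) : ℂ) := by
      have : ∀ᵐ u : ℂ, u ≠ w := by simp [ae_iff, measure_singleton]
      filter_upwards [this] with u hu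
      rw [hdb]
      have : w - u ≠ 0 := sub_ne_zero.mpr hu.symm
      push_cast
      field_simp
      ring
    have hre : ∫ u, ((-(2 * deriv φ (q u)) : ℝ) : ℂ) = ((∫ u, -(2 * deriv φ (q u)) : ℝ) : ℂ) :=
      integral_ofReal
    rw [integral_congr_ae hae, hre]
    have hnn : ∀ u, 0 ≤ -(2 * deriv φ (q u)) := fun u => by
      have := hanti.deriv_nonpos (x := q u); linarith
    have hcs : HasCompactSupport fun u => -(2 * deriv φ (q u)) := by
      refine HasCompactSupport.intro (isCompact_closedBall w 2) fun u hu => ?_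
      have : 2 < ‖u - w‖ := by simpa [dist_eq_norm] using hu
      have h4 : 2 < q u := by
        simp only [hq, Complex.normSq_eq_norm_sq]; nlinarith
      have : φ =ᶠ[𝓝 (q u)] fun _ => 0 := by
        filter_upwards [lt_mem_nhds h4] with t ht
        exact Real.smoothTransition.zero_of_nonpos (by linarith)
      simp [this.deriv_eq]
    intro h0
    have h0' : ∫ u, -(2 * deriv φ (q u)) = 0 := by exact_mod_cast h0
    rw [integral_eq_zero_iff_of_nonneg hnn (hcont.integrable_of_hasCompactSupport hcs),
      Continuous.ae_eq_iff_eq _ hcont continuous_zero] at h0'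
    obtain ⟨t, ht, hte⟩ := exists_deriv_eq_slope φ (show (0 : ℝ) < 4 by norm_num)
      hφs.continuous.continuousOn (hφs.differentiable one_ne_zero).differentiableOn
    have h1 := congrFun h0' (w + Real.sqrt t)
    have h2 : q (w + Real.sqrt t) = t := by
      simp [hq, Complex.normSq_ofReal, Real.mul_self_sqrt ht.1.le]
    simp only [h2, Pi.zero_apply] at h1
    rw [show deriv φ t = 0 by linarith] at hte
    simp only [hφ] at hte
    rw [Real.smoothTransition.zero_of_nonpos (by norm_num),
      Real.smoothTransition.one_of_one_le (by norm_num)] at hte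
    norm_num at hte

theorem integral_dbar_mul_inv_ne_zero {χ : ℂ → ℂ} (hχ : ContDiff ℝ 1 χ) (hc : HasCompactSupport χ)
    {w : ℂ} (h1 : ∀ᶠ u in 𝓝 w, χ u = 1) : ∫ u, dbar χ u * (w - u)⁻¹ ≠ 0 := by
  obtain ⟨χ₀, hs, hc₀, h1', hne⟩ := exists_radial_cutoff w
  have int {η : ℂ → ℂ} (hη : ContDiff ℝ 1 η) (hcη : HasCompactSupport η)
      (hη1 : ∀ᶠ u in 𝓝 w, η u = 1) : Integrable fun u => dbar η u * (w - u)⁻¹ := by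
    refine Continuous.integrable_of_hasCompactSupport (continuous_iff_continuousAt.mpr fun u => ?_)
      (hasCompactSupport_dbar hcη).mul_right
    by_cases hu : u = w
    · subst hu
      have : (fun v => dbar η v * (u - v)⁻¹) =ᶠ[𝓝 u] fun _ => 0 := by
        filter_upwards [hη1.eventually_nhds] with v hv
        rw [dbar_eq_zero_of_eventuallyEq_const hv, zero_mul]
      exact continuousAt_const.congr this.symm
    · exact (continuous_dbar hη).continuousAt.mul
        ((continuousAt_const.sub continuousAt_id).inv₀ (sub_ne_zero.mpr (Ne.symm hu)))
  have hdiff : ∫ u, dbar (fun v => χ v - χ₀ v) u * (w - u)⁻¹ = 0 := by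
    refine integral_dbar_mul_eq_zero (hχ.sub hs) (hc.sub hc₀) fun u hu => ?_
    have hne : u ≠ w := by
      rintro rfl
      refine (notMem_tsupport_iff_eventuallyEq.mpr ?_) hu
      filter_upwards [h1, h1'] with v a b
      simp [a, b]
    exact (analyticAt_const.sub analyticAt_id).inv (sub_ne_zero.mpr (Ne.symm hne))
  simp_rw [dbar_sub hχ hs, sub_mul] at hdiff
  rw [integral_sub (int hχ hc h1) (int hs hc₀ h1'), sub_eq_zero] at hdiff
  rwa [hdiff]

theorem differentiableOn_integral_mul {R : ℂ × ℂ → ℂ} {W : Set (ℂ × ℂ)} {θ : ℂ → ℂ} {U Q : Set ℂ}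
    (hW : IsOpen W) (hR : ContDiffOn ℂ 1 R W) (hU : IsOpen U) (hθ : Continuous θ)
    (hQ : IsCompact Q) (hθQ : ∀ u ∉ Q, θ u = 0) (hUQ : U ×ˢ Q ⊆ W) :
    DifferentiableOn ℂ (fun z => ∫ u, θ u * R (z, u)) U := by
  intro z₀ hz₀
  obtain ⟨ε, hε, hεU⟩ := Metric.nhds_basis_closedBall.mem_iff.mp (hU.mem_nhds hz₀)
  have hset (z : ℂ) : ∫ u, θ u * R (z, u) = ∫ u in Q, θ u * R (z, u) :=
    (setIntegral_eq_integral_of_forall_compl_eq_zero fun u hu => by simp [hθQ u hu]).symm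
  simp_rw [hset]
  set F' : ℂ → ℂ → ℂ := fun z u => θ u * fderiv ℂ R (z, u) (1, 0) with hF'
  have hR' : ContinuousOn (fderiv ℂ R) W := hR.continuousOn_fderiv_of_isOpen hW le_rfl
  have hcont (z : ℂ) (hz : z ∈ U) : ContinuousOn (fun u => θ u * R (z, u)) Q :=
    hθ.continuousOn.mul (hR.continuousOn.comp (by fun_prop) fun u hu => hUQ ⟨hz, hu⟩)
  have hjoint : ContinuousOn (fun p : ℂ × ℂ => F' p.1 p.2) (Metric.closedBall z₀ ε ×ˢ Q) :=
    (hθ.comp continuous_snd).continuousOn.mul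
      ((hR'.mono fun p hp => hUQ ⟨hεU hp.1, hp.2⟩).clm_apply continuousOn_const)
  obtain ⟨C, hC⟩ := ((isCompact_closedBall z₀ ε).prod hQ).exists_bound_of_continuousOn hjoint
  have hmeas := hQ.measurableSet
  have hfin : volume Q ≠ ⊤ := hQ.measure_lt_top.ne
  refine DifferentiableAt.differentiableWithinAt (HasDerivAt.differentiableAt
    (hasDerivAt_integral_of_dominated_loc_of_deriv_le (F' := F') (bound := fun _ => C)
      (Metric.ball_mem_nhds z₀ hε) ?_ ?_ ?_ ?_ ?_ ?_).2)
  · filter_upwards [hU.mem_nhds hz₀] with z hz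
    exact (hcont z hz).aestronglyMeasurable hmeas
  · exact (hcont z₀ hz₀).integrableOn_compact hQ
  · exact ((hjoint.comp (by fun_prop : ContinuousOn (fun u => (z₀, u)) Q)
      fun u hu => ⟨Metric.mem_closedBall_self hε.le, hu⟩)).aestronglyMeasurable hmeas
  · filter_upwards [ae_restrict_mem hmeas] with u hu z hz
    exact hC (z, u) ⟨Metric.ball_subset_closedBall hz, hu⟩
  · exact integrableOn_const hfin
  · filter_upwards [ae_restrict_mem hmeas] with u hu z hz
    have hd : HasFDerivAt R (fderiv ℂ R (z, u)) (z, u) :=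
      ((hR.contDiffAt (hW.mem_nhds (hUQ ⟨hεU (Metric.ball_subset_closedBall hz), hu⟩))).differentiableAt
        one_ne_zero).hasFDerivAt
    exact (hd.comp_hasDerivAt z ((hasDerivAt_id z).prodMk (hasDerivAt_const z u))).const_mul (θ u)

/-- The joint spectrum of two elements of a complex algebra, as the set of joint values of
characters. -/
def jointSpectrum {A : Type*} [CommRing A] [Algebra ℂ A] (x w : A) : Set (ℂ × ℂ) :=
  {q | ∃ φ : A →ₐ[ℂ] ℂ, φ x = q.1 ∧ φ w = q.2}

section Banach
variable {A : Type*} [NormedCommRing A] [NormedAlgebra ℂ A] [CompleteSpace A]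

theorem exists_bezout_of_notMem_jointSpectrum {x w : A} {z u : ℂ}
    (h : (z, u) ∉ jointSpectrum x w) :
    ∃ a b : A, a * (x - algebraMap ℂ A z) + b * (w - algebraMap ℂ A u) = 1 := by
  by_contra hne
  have hI : Ideal.span {x - algebraMap ℂ A z, w - algebraMap ℂ A u} ≠ ⊤ := by
    rw [Ne, Ideal.eq_top_iff_one, Ideal.mem_span_pair]
    rintro ⟨a, b, hab⟩
    exact hne ⟨a, b, hab⟩
  obtain ⟨J, hJ, hIJ⟩ := Ideal.exists_le_maximal _ hI
  have hx := J.toCharacterSpace_apply_eq_zero_of_mem (hIJ (Ideal.subset_span (by simp)) :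
    x - algebraMap ℂ A z ∈ J)
  have hw := J.toCharacterSpace_apply_eq_zero_of_mem (hIJ (Ideal.subset_span (by simp)) :
    w - algebraMap ℂ A u ∈ J)
  refine h ⟨WeakDual.CharacterSpace.toAlgHom J.toCharacterSpace, ?_, ?_⟩
  · have : J.toCharacterSpace x - z = 0 := by
      simpa [map_sub, AlgHomClass.commutes] using hx
    simpa [sub_eq_zero] using this
  · have : J.toCharacterSpace w - u = 0 := by
      simpa [map_sub, AlgHomClass.commutes] using hw
    simpa [sub_eq_zero] using this

theorem isUnit_of_forall_character_ne_zero {x : A} (h : ∀ φ : A →ₐ[ℂ] ℂ, φ x ≠ 0) : IsUnit x := by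
  have : ((0 : ℂ), (0 : ℂ)) ∉ jointSpectrum x 0 := by
    rintro ⟨φ, hφ, -⟩
    exact h φ hφ
  obtain ⟨a, b, hab⟩ := exists_bezout_of_notMem_jointSpectrum this
  exact IsUnit.of_mul_eq_one_right a (by simpa using hab)

theorem isCompact_jointSpectrum (x w : A) : IsCompact (jointSpectrum x w) := by
  have : jointSpectrum x w = (fun φ : WeakDual.characterSpace ℂ A => (φ x, φ w)) '' univ := by
    ext q
    constructor
    · rintro ⟨φ, h1, h2⟩
      exact ⟨WeakDual.CharacterSpace.equivAlgHom.symm φ, trivial, Prod.ext h1 h2⟩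
    · rintro ⟨φ, -, rfl⟩
      exact ⟨WeakDual.CharacterSpace.equivAlgHom φ, rfl, rfl⟩
  rw [this]
  refine isCompact_univ.image ?_
  exact ((WeakDual.eval_continuous x).comp continuous_subtype_val).prodMk
    ((WeakDual.eval_continuous w).comp continuous_subtype_val)

end Banach

/-- A holomorphic kernel near the fibre of the joint spectrum over `φ₀ x`, when `x - z` is
invertible in the larger algebra `B`. -/
theorem exists_resolvent_kernel {B : Type*} [NormedCommRing B] [NormedAlgebra ℂ B] [CompleteSpace B]
    (A : Subalgebra ℂ B) (hA : IsClosed (A : Set B)) (x w : A) {U : Set ℂ}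
    (hU : ∀ z ∈ U, IsUnit ((x : B) - algebraMap ℂ B z)) (φ₀ : A →ₐ[ℂ] ℂ) :
    ∃ R : ℂ × ℂ → ℂ, ContDiffOn ℂ 1 R ((U ×ˢ univ) \ jointSpectrum x w) ∧
      ∀ u, (φ₀ x, u) ∉ jointSpectrum x w → R (φ₀ x, u) = (φ₀ w - u)⁻¹ := by
  have : CompleteSpace A := hA.completeSpace_coe
  set z₀ := φ₀ x with hz₀
  obtain ⟨μ, hμ, -⟩ := exists_extension_norm_eq (𝕜 := ℂ) (E := B) (Subalgebra.toSubmodule A)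
    (AlgHom.toContinuousLinearMap (A := A) φ₀)
  replace hμ (c : A) : μ (c : B) = φ₀ c := hμ c
  set M : ℂ → A → ℂ := fun z F =>
    φ₀ F + (z - z₀) * μ ((F : B) * Ring.inverse ((x : B) - algebraMap ℂ B z)) with hM
  have hM0 (z : ℂ) (hz : z ∈ U) (c : A) : M z (c * (x - algebraMap ℂ A z)) = 0 := by
    have e : ((c * (x - algebraMap ℂ A z) : A) : B) * Ring.inverse ((x : B) - algebraMap ℂ B z)
        = (c : B) := by
      have : ((c * (x - algebraMap ℂ A z) : A) : B) = (c : B) * ((x : B) - algebraMap ℂ B z) := rfl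
      rw [this, mul_assoc, Ring.mul_inverse_cancel _ (hU z hz), mul_one]
    simp only [hM, e, hμ, map_mul, map_sub, AlgHomClass.commutes, ← hz₀, Algebra.algebraMap_self,
      RingHom.id_apply]
    ring
  have hMsub (z : ℂ) (F G : A) : M z (F - G) = M z F - M z G := by
    simp only [hM, map_sub, AddSubgroupClass.coe_sub, sub_mul]
    ring
  have hind {z u : ℂ} (hz : z ∈ U) {a b a' b' : A}
      (h : a * (x - algebraMap ℂ A z) + b * (w - algebraMap ℂ A u) = 1)
      (h' : a' * (x - algebraMap ℂ A z) + b' * (w - algebraMap ℂ A u) = 1) : M z b = M z b' := by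
    rw [← sub_eq_zero, ← hMsub]
    have : b - b' = (b * a' - b' * a) * (x - algebraMap ℂ A z) := by
      linear_combination b' * h - b * h'
    rw [this, hM0 z hz]
  choose! a b hab using fun q : ℂ × ℂ => fun hq : (q.1, q.2) ∉ jointSpectrum x w =>
    exists_bezout_of_notMem_jointSpectrum hq
  refine ⟨fun q => M q.1 (b q), ?_, fun u hu => ?_⟩
  · rintro ⟨z₁, u₁⟩ ⟨hz₁, hq₁⟩
    set a₁ := a (z₁, u₁)
    set b₁ := b (z₁, u₁)
    have h₁ : a₁ * (x - algebraMap ℂ A z₁) + b₁ * (w - algebraMap ℂ A u₁) = 1 := hab _ hq₁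
    set v : ℂ × ℂ → A := fun q => a₁ * (x - algebraMap ℂ A q.1) + b₁ * (w - algebraMap ℂ A q.2)
    have hv1 : v (z₁, u₁) = 1 := h₁
    have hvd : ContDiff ℂ 1 v := by
      have e : v = fun q : ℂ × ℂ => a₁ * (x - q.1 • (1 : A)) + b₁ * (w - q.2 • (1 : A)) := by
        ext q; simp [v, Algebra.algebraMap_eq_smul_one]
      rw [e]
      fun_prop
    have hvi : ContDiffAt ℂ 1 (fun q => Ring.inverse (v q)) (z₁, u₁) := by
      have : ContDiffAt ℂ 1 (Ring.inverse : A → A) (v (z₁, u₁)) := by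
        rw [hv1]; exact contDiffAt_ringInverse ℂ (1 : Aˣ)
      exact this.comp _ hvd.contDiffAt
    have hxi : ContDiffAt ℂ 1 (fun q : ℂ × ℂ => Ring.inverse ((x : B) - algebraMap ℂ B q.1))
        (z₁, u₁) := by
      have h1 : ContDiffAt ℂ 1 (Ring.inverse : B → B) ((x : B) - algebraMap ℂ B z₁) := by
        obtain ⟨y, hy⟩ := hU z₁ hz₁.1
        rw [← hy]; exact contDiffAt_ringInverse ℂ y
      have h2 : ContDiff ℂ 1 (fun q : ℂ × ℂ => (x : B) - algebraMap ℂ B q.1) := by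
        simp only [Algebra.algebraMap_eq_smul_one]
        fun_prop
      exact ContDiffAt.comp (z₁, u₁) (g := Ring.inverse) h1 h2.contDiffAt
    have hF : ContDiffAt ℂ 1 (fun q : ℂ × ℂ => b₁ * Ring.inverse (v q)) (z₁, u₁) :=
      contDiffAt_const.mul hvi
    have hloc : ContDiffAt ℂ 1 (fun q : ℂ × ℂ => M q.1 (b₁ * Ring.inverse (v q))) (z₁, u₁) := by
      have hφ : ContDiffAt ℂ 1 (fun q => φ₀ (b₁ * Ring.inverse (v q))) (z₁, u₁) :=
        (AlgHom.toContinuousLinearMap (A := A) φ₀).contDiff.contDiffAt.comp _ hF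
      have hFB : ContDiffAt ℂ 1 (fun q => ((b₁ * Ring.inverse (v q) : A) : B)) (z₁, u₁) :=
        ((Subalgebra.toSubmodule A).subtypeL).contDiff.contDiffAt.comp _ hF
      exact hφ.add ((contDiffAt_fst.sub contDiffAt_const).mul
        (μ.contDiff.contDiffAt.comp _ (hFB.mul hxi)))
    refine hloc.contDiffWithinAt.congr_of_eventuallyEq_of_mem ?_ ⟨hz₁, hq₁⟩
    have hun : ∀ᶠ q in 𝓝 (z₁, u₁), IsUnit (v q) := by
      refine hvd.continuous.continuousAt.eventually ?_
      rw [hv1]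
      exact Units.isOpen.mem_nhds isUnit_one
    filter_upwards [self_mem_nhdsWithin, hun.filter_mono nhdsWithin_le_nhds] with q hq hqu
    refine hind hq.1.1 (hab q hq.2) (a' := a₁ * Ring.inverse (v q)) ?_
    calc _ = v q * Ring.inverse (v q) := by simp only [v]; ring
      _ = 1 := Ring.mul_inverse_cancel _ hqu
  · have := congrArg φ₀ (hab (z₀, u) hu)
    simp only [map_add, map_mul, map_sub, AlgHomClass.commutes, ← hz₀, Algebra.algebraMap_self,
      RingHom.id_apply, sub_self, mul_zero, zero_add, map_one] at this
    simp only [hM, sub_self, zero_mul, add_zero]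
    exact eq_inv_of_mul_eq_one_left this

/-- A smooth cutoff equal to one near a compact set and supported off a disjoint closed set. -/
theorem exists_cutoff {S T : Set ℂ} (hS : IsCompact S) (hT : IsClosed T) (hST : Disjoint S T) :
    ∃ χ : ℂ → ℂ, ContDiff ℝ 1 χ ∧ HasCompactSupport χ ∧ (∀ s ∈ S, ∀ᶠ u in 𝓝 s, χ u = 1) ∧
      Disjoint (tsupport χ) T := by
  obtain ⟨V, hV, hSV, hVT, hVc⟩ := exists_open_between_and_isCompact_closure hS hT.isOpen_compl
    (subset_compl_iff_disjoint_right.mpr hST)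
  obtain ⟨f, hf1, hf0, -⟩ := exists_contMDiffMap_one_nhds_of_subset_interior (n := 1)
    (modelWithCornersSelf ℝ ℂ) hS.isClosed (hSV.trans hV.interior_eq.ge)
  have hsub : tsupport (fun u => ((f u : ℝ) : ℂ)) ⊆ closure V := by
    refine closure_mono fun u hu => ?_
    by_contra h
    exact hu (by simp [hf0 u h])
  refine ⟨fun u => ((f u : ℝ) : ℂ), Complex.ofRealCLM.contDiff.comp f.contMDiff.contDiff,
    hVc.of_isClosed_subset (isClosed_tsupport _) hsub, fun s hs => ?_,
    disjoint_left.mpr fun u hu => hVT (hsub hu)⟩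
  have := hf1.filter_mono (nhds_le_nhdsSet hs)
  filter_upwards [this] with u hu
  simp [hu]

theorem forall_exists_mem_of_kernel {X : Set (ℂ × ℂ)} (hX : IsCompact X) {U : Set ℂ}
    (hU : IsOpen U) (hUc : IsPreconnected U)
    (hR : ∀ q ∈ X, q.1 ∈ U → ∃ R : ℂ × ℂ → ℂ, ContDiffOn ℂ 1 R ((U ×ˢ univ) \ X) ∧
      ∀ u, (q.1, u) ∉ X → R (q.1, u) = (q.2 - u)⁻¹)
    {O₁ O₂ : Set (ℂ × ℂ)} (hO₁ : IsOpen O₁) (hO₂ : IsOpen O₂) (hd : Disjoint O₁ O₂)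
    (hcov : ∀ q ∈ X, q.1 ∈ U → q ∈ O₁ ∪ O₂) {q₀ : ℂ × ℂ} (hq₀ : q₀ ∈ X) (hq₀U : q₀.1 ∈ U)
    (hq₀O : q₀ ∈ O₁) : ∀ z ∈ U, ∃ u, (z, u) ∈ X ∧ (z, u) ∈ O₁ := by
  set P : Set ℂ := Prod.fst '' (X \ O₂) with hP
  have hPc : IsCompact P := (hX.diff hO₂).image continuous_fst
  have hPiff (z : ℂ) (hz : z ∈ U) : z ∈ P ↔ ∃ u, (z, u) ∈ X ∧ (z, u) ∈ O₁ := by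
    constructor
    · rintro ⟨⟨z', u⟩, ⟨h1, h2⟩, rfl⟩
      exact ⟨u, h1, (hcov _ h1 hz).resolve_right h2⟩
    · rintro ⟨u, h1, h2⟩
      exact ⟨(z, u), ⟨h1, disjoint_left.mp hd h2⟩, rfl⟩
  have key : ∀ z₀ ∈ U, z₀ ∈ P → P ∈ 𝓝 z₀ := by
    intro z₀ hz₀ hz₀P
    obtain ⟨w₀, hw₀X, hw₀O⟩ := (hPiff z₀ hz₀).mp hz₀P
    set S : Set ℂ := {u | (z₀, u) ∈ X \ O₂}
    set T : Set ℂ := {u | (z₀, u) ∈ X \ O₁}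
    have hcompact {C : Set (ℂ × ℂ)} (hC : IsCompact C) : IsCompact {u | (z₀, u) ∈ C} :=
      (hC.image continuous_snd).of_isClosed_subset (hC.isClosed.preimage (by fun_prop))
        fun u hu => ⟨(z₀, u), hu, rfl⟩
    have hST : Disjoint S T := disjoint_left.mpr fun u hu hu' =>
      (hcov _ hu.1 hz₀).elim hu'.2 hu.2
    obtain ⟨χ, hχ, hχc, hχ1, hχT⟩ := exists_cutoff (hcompact (hX.diff hO₂))
      (hcompact (hX.diff hO₁)).isClosed hST
    set Q := tsupport (dbar χ)
    have hQχ : Q ⊆ tsupport χ :=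
      closure_minimal (support_dbar_subset χ) (isClosed_tsupport χ)
    have hQS : ∀ u ∈ Q, u ∉ S := fun u hu huS => by
      refine notMem_tsupport_iff_eventuallyEq.mpr ?_ hu
      filter_upwards [(hχ1 u huS).eventually_nhds] with v hv
      exact dbar_eq_zero_of_eventuallyEq_const hv
    have hQc : IsCompact Q := hasCompactSupport_dbar hχc
    have t1 : {z₀} ×ˢ Q ⊆ Xᶜ := by
      rintro ⟨z, u⟩ ⟨rfl : z = z₀, hu⟩ hX'
      have h2 : (z, u) ∈ O₂ := by
        by_contra h2
        exact hQS u hu ⟨hX', h2⟩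
      exact disjoint_left.mp hχT (hQχ hu) ⟨hX', disjoint_right.mp hd h2⟩
    have t2 : {z₀} ×ˢ tsupport χ ⊆ (X \ O₁)ᶜ := by
      rintro ⟨z, u⟩ ⟨rfl : z = z₀, hu⟩ hX'
      exact disjoint_left.mp hχT hu hX'
    obtain ⟨V₁, W₁, hV₁, -, hzV₁, hQW₁, hVW₁⟩ :=
      generalized_tube_lemma isCompact_singleton hQc hX.isClosed.isOpen_compl t1
    obtain ⟨V₂, W₂, hV₂, -, hzV₂, hQW₂, hVW₂⟩ :=
      generalized_tube_lemma isCompact_singleton hχc (hX.diff hO₁).isClosed.isOpen_compl t2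
    obtain ⟨ε, hε, hεV⟩ := Metric.isOpen_iff.mp ((hV₁.inter hV₂).inter hU) z₀
      ⟨⟨hzV₁ rfl, hzV₂ rfl⟩, hz₀⟩
    set D := Metric.ball z₀ ε
    obtain ⟨R, hRd, hR0⟩ := hR (z₀, w₀) hw₀X hz₀
    have hE : DifferentiableOn ℂ (fun z => ∫ u, dbar χ u * R (z, u)) D := by
      refine differentiableOn_integral_mul ((hU.prod isOpen_univ).sdiff hX.isClosed) hRd
        Metric.isOpen_ball (continuous_dbar hχ) hQc
        (fun u hu => image_eq_zero_of_notMem_tsupport hu) ?_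
      rintro ⟨z, u⟩ ⟨hz, hu⟩
      exact ⟨⟨(hεV hz).2, trivial⟩, hVW₁ ⟨(hεV hz).1.1, hQW₁ hu⟩⟩
    refine mem_of_superset (Metric.ball_mem_nhds z₀ hε) fun z₁ hz₁ => ?_
    by_contra hz₁P
    have hzero : (fun z => ∫ u, dbar χ u * R (z, u)) =ᶠ[𝓝 z₁] 0 := by
      filter_upwards [hPc.isClosed.isOpen_compl.mem_nhds hz₁P, Metric.isOpen_ball.mem_nhds hz₁]
        with z hzP hzD
      have hzU : z ∈ U := (hεV hzD).2
      refine integral_dbar_mul_eq_zero hχ hχc fun u hu => ?_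
      have hmiss : ∀ v ∈ tsupport χ, (z, v) ∉ X := fun v hv hvX => by
        have : (z, v) ∈ O₁ := by
          by_contra h1
          exact hVW₂ (show (z, v) ∈ V₂ ×ˢ W₂ from ⟨(hεV hzD).1.2, hQW₂ hv⟩) ⟨hvX, h1⟩
        exact hzP ((hPiff z hzU).mpr ⟨v, hvX, this⟩)
      have hopen : IsOpen {v | (z, v) ∉ X} := hX.isClosed.isOpen_compl.preimage (by fun_prop)
      have hdiff : DifferentiableOn ℂ (fun v => R (z, v)) {v | (z, v) ∉ X} :=
        (hRd.differentiableOn one_ne_zero).comp (by fun_prop) fun v hv => ⟨⟨hzU, trivial⟩, hv⟩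
      exact hdiff.analyticAt (hopen.mem_nhds (hmiss u hu))
    have h0 := (hE.analyticOnNhd Metric.isOpen_ball).eqOn_zero_of_preconnected_of_eventuallyEq_zero
      (convex_ball z₀ ε).isPreconnected hz₁ hzero (Metric.mem_ball_self hε)
    refine integral_dbar_mul_inv_ne_zero hχ hχc
      (hχ1 w₀ ⟨hw₀X, disjoint_left.mp hd hw₀O⟩) ?_
    rw [← show (∫ u, dbar χ u * R (z₀, u)) = 0 from h0]
    congr 1
    ext u
    by_cases hu : u ∈ Q
    · rw [hR0 u (t1 ⟨rfl, hu⟩)]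
    · simp [image_eq_zero_of_notMem_tsupport hu]
  intro z hz
  rw [← hPiff z hz]
  have hN : IsOpen (U ∩ P) := isOpen_iff_mem_nhds.mpr fun z₀ h =>
    inter_mem (hU.mem_nhds h.1) (key z₀ h.1 h.2)
  have := hUc.subset_left_of_subset_union hN hPc.isClosed.isOpen_compl
    (disjoint_left.mpr fun v hv hv' => hv' hv.2)
    (fun v hv => (em (v ∈ P)).imp (fun h => ⟨hv, h⟩) id)
    ⟨q₀.1, hq₀U, hq₀U, (hPiff _ hq₀U).mpr ⟨q₀.2, hq₀, hq₀O⟩⟩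
  exact (this hz).2

theorem exists_continuous_extension {Y : Type*} [TopologicalSpace Y] [NormalSpace Y] {S : Set Y}
    (hS : IsClosed S) {f : Y → ℂ} (hf : ContinuousOn f S) :
    ∃ g : Y → ℂ, Continuous g ∧ EqOn g f S := by
  obtain ⟨g, hg⟩ := ContinuousMap.exists_restrict_eq hS ⟨S.domRestrict f, hf.domRestrict⟩
  exact ⟨g, g.continuous, fun y hy => DFunLike.congr_fun hg ⟨y, hy⟩⟩

/-- The function `z - a` has no continuous logarithm on a compact set enclosing `a`. -/
theorem not_exists_log_of_enclosing {Γ σ : Set ℂ} (hΓ : IsCompact Γ) (hσ : IsCompact σ)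
    (hopen : IsOpen (σ \ Γ)) {a : ℂ} (ha : a ∈ σ \ Γ) {L : ℂ → ℂ} (hL : ContinuousOn L Γ)
    (hexp : ∀ z ∈ Γ, Complex.exp (L z) = z - a) : False := by
  classical
  obtain ⟨L', hL', hLL'⟩ := exists_continuous_extension hΓ.isClosed hL
  set f : ℂ → ℂ := fun z => if z ∈ σ then Complex.exp (L' z) else z - a with hf
  have hfr : ∀ z ∈ frontier σ, Complex.exp (L' z) = z - a := fun z hz => by
    have hzΓ : z ∈ Γ := by
      by_contra hzΓ
      exact hz.2 (interior_maximal sdiff_subset hopen ⟨hσ.isClosed.frontier_subset hz, hzΓ⟩)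
    rw [hLL' hzΓ, hexp z hzΓ]
  have hfc : Continuous f := Continuous.if hfr (by fun_prop) (by fun_prop)
  have hf0 (z : ℂ) : f z ≠ 0 := by
    by_cases hz : z ∈ σ
    · simp [hf, hz]
    · simp only [hf, hz, if_false]
      rintro h0
      rw [sub_eq_zero] at h0
      exact hz (h0 ▸ ha.1)
  obtain ⟨g, hg, -⟩ := Complex.isCoveringMap_exp.existsUnique_continuousMap_lifts
    (⟨fun z => ⟨f z, hf0 z⟩, by fun_prop⟩ : C(ℂ, {z : ℂ // z ≠ 0})) 0 (Complex.log (f 0))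
    (Subtype.ext (Complex.exp_log (hf0 0)))
  have hg' (z : ℂ) : Complex.exp (g z) = f z := congrArg Subtype.val (congrFun hg.2 z)
  obtain ⟨R, hR⟩ := hσ.isBounded.subset_ball a
  have hR0 : 0 < R := by
    have := hR ha.1
    simpa using this
  have hcirc (t : ℝ) : f (a + R * Complex.exp (t * Complex.I)) = R * Complex.exp (t * Complex.I) := by
    have : a + R * Complex.exp (t * Complex.I) ∉ σ := fun h => by
      have := hR h
      simp [Complex.norm_exp_ofReal_mul_I, abs_of_pos hR0] at this
    simp [hf, this]
  have hlift : (fun t : ℝ => g (a + R * Complex.exp (t * Complex.I)))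
      = fun t : ℝ => t * Complex.I + g (a + R) := by
    refine Complex.isCoveringMap_exp.eq_of_comp_eq (by fun_prop) (by fun_prop) ?_ 0 (by simp)
    ext t
    have h0 := hcirc 0
    simp only [Complex.ofReal_zero, zero_mul, Complex.exp_zero, mul_one] at h0
    simp only [Function.comp_apply, hg', hcirc, Complex.exp_add, h0]
    ring
  have := congrFun hlift (2 * Real.pi)
  simp [Complex.exp_two_pi_mul_I, Real.pi_ne_zero] at this

/-- A family of circles tangent to `Γ` along a unit normal field `n`, meeting `Γ` only at the
point of tangency. -/
structure TangentBalls (Γ : Set ℂ) (n : ℂ → ℂ) (r : ℝ) : Prop where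
  pos : 0 < r
  norm_eq : ∀ c ∈ Γ, ‖n c‖ = 1
  cont : ContinuousOn n Γ
  inter_subset : ∀ c ∈ Γ, ∀ ρ ∈ Ioc 0 r, ∀ s : ℝ, s = 1 ∨ s = -1 →
    Γ ∩ Metric.closedBall (c + (s * ρ : ℝ) * n c) ρ ⊆ {c}

section TangentBalls
variable {Γ : Set ℂ} {n : ℂ → ℂ} {r : ℝ}

theorem TangentBalls.dist_center (h : TangentBalls Γ n r) {c : ℂ} (hc : c ∈ Γ) {ρ : ℝ}
    (hρ : 0 ≤ ρ) {s : ℝ} (hs : s = 1 ∨ s = -1) : dist c (c + (s * ρ : ℝ) * n c) = ρ := by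
  rw [dist_self_add_right, norm_mul, h.norm_eq c hc, Complex.norm_real, mul_one, norm_mul]
  rcases hs with rfl | rfl <;> simp [abs_of_nonneg hρ]

theorem TangentBalls.disjoint_ball (h : TangentBalls Γ n r) {c : ℂ} (hc : c ∈ Γ) {ρ : ℝ}
    (hρ : ρ ∈ Ioc 0 r) {s : ℝ} (hs : s = 1 ∨ s = -1) :
    Disjoint (Metric.ball (c + (s * ρ : ℝ) * n c) ρ) Γ := by
  rw [disjoint_left]
  intro z hz hzΓ
  have : z = c := h.inter_subset c hc ρ hρ s hs ⟨hzΓ, Metric.ball_subset_closedBall hz⟩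
  subst this
  rw [Metric.mem_ball, h.dist_center hc hρ.1.le hs] at hz
  exact lt_irrefl _ hz

theorem TangentBalls.center_notMem (h : TangentBalls Γ n r) {c : ℂ} (hc : c ∈ Γ) {ρ : ℝ}
    (hρ : ρ ∈ Ioc 0 r) {s : ℝ} (hs : s = 1 ∨ s = -1) : c + (s * ρ : ℝ) * n c ∉ Γ :=
  disjoint_left.mp (h.disjoint_ball hc hρ hs) (Metric.mem_ball_self hρ.1)

/-- `σ` is filled off `Γ`: connected open sets off `Γ` meeting `σ` lie in `σ`. -/
def FilledOff (Γ σ : Set ℂ) : Prop :=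
  ∀ U : Set ℂ, IsOpen U → IsPreconnected U → Disjoint U Γ → (U ∩ σ).Nonempty → U ⊆ σ

theorem FilledOff.isOpen_diff {σ : Set ℂ} (hf : FilledOff Γ σ) (hΓ : IsClosed Γ) :
    IsOpen (σ \ Γ) := by
  rw [Metric.isOpen_iff]
  rintro z ⟨hz, hzΓ⟩
  obtain ⟨ε, hε, hεΓ⟩ := Metric.isOpen_iff.mp hΓ.isOpen_compl z hzΓ
  refine ⟨ε, hε, fun v hv => ⟨hf _ Metric.isOpen_ball (convex_ball z ε).isPreconnected
    (disjoint_left.mpr hεΓ) ⟨z, Metric.mem_ball_self hε, hz⟩ hv, hεΓ hv⟩⟩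

theorem TangentBalls.centers_dichotomy (h : TangentBalls Γ n r) (hΓ : IsClosed Γ)
    (hΓc : IsPreconnected Γ) {σ : Set ℂ} (hσ : IsClosed σ) (hf : FilledOff Γ σ) {ρ : ℝ}
    (hρ : ρ ∈ Ioc 0 r) {s : ℝ} (hs : s = 1 ∨ s = -1) {c₀ : ℂ} (hc₀ : c₀ ∈ Γ)
    (h₀ : c₀ + (s * ρ : ℝ) * n c₀ ∈ σ) : ∀ c ∈ Γ, c + (s * ρ : ℝ) * n c ∈ σ := by
  have hcont : ContinuousOn (fun c => c + (s * ρ : ℝ) * n c) Γ :=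
    continuousOn_id.add (continuousOn_const.mul h.cont)
  have hsub : (fun c => c + (s * ρ : ℝ) * n c) '' Γ ⊆ σ \ Γ ∪ σᶜ := by
    rintro _ ⟨c, hc, rfl⟩
    by_cases hm : c + (s * ρ : ℝ) * n c ∈ σ
    · exact Or.inl ⟨hm, h.center_notMem hc hρ hs⟩
    · exact Or.inr hm
  have := (hΓc.image _ hcont).subset_left_of_subset_union (hf.isOpen_diff hΓ) hσ.isOpen_compl
    (disjoint_left.mpr fun v hv hv' => hv' hv.1) hsub
    ⟨_, ⟨c₀, hc₀, rfl⟩, h₀, h.center_notMem hc₀ hρ hs⟩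
  exact fun c hc => (this ⟨c, hc, rfl⟩).1

theorem TangentBalls.exists_exterior_side (h : TangentBalls Γ n r) (hΓ : IsClosed Γ)
    (hΓc : IsPreconnected Γ) {σ : Set ℂ} (hσ : IsCompact σ) (hσn : σ.Nonempty)
    (hf : FilledOff Γ σ) :
    ∃ s : ℝ, (s = 1 ∨ s = -1) ∧ ∀ c ∈ Γ, c + (s * r : ℝ) * n c ∉ σ := by
  by_contra! hcon
  have hr : r ∈ Ioc 0 r := ⟨h.pos, le_rfl⟩
  have hall {s : ℝ} (hs : s = 1 ∨ s = -1) {c : ℂ} (hc : c ∈ Γ) :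
      Metric.ball (c + (s * r : ℝ) * n c) r ⊆ σ := by
    obtain ⟨c₀, hc₀, h₀⟩ := hcon s hs
    have := h.centers_dichotomy hΓ hΓc hσ.isClosed hf hr hs hc₀ h₀ c hc
    exact hf _ Metric.isOpen_ball (convex_ball _ _).isPreconnected (h.disjoint_ball hc hr hs)
      ⟨_, Metric.mem_ball_self h.pos, this⟩
  obtain ⟨p, hp, hmax⟩ := hσ.exists_isMaxOn hσn Complex.continuous_re.continuousOn
  have hpΓ : p ∈ Γ := by
    by_contra hpΓ
    obtain ⟨ε, hε, hεσ⟩ := Metric.isOpen_iff.mp (hf.isOpen_diff hΓ) p ⟨hp, hpΓ⟩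
    have : p + (ε / 2 : ℝ) ∈ Metric.ball p ε := by
      simp [dist_eq_norm, abs_of_pos hε, -Complex.ofReal_div]; linarith
    have := hmax (hεσ this).1
    simp at this
    linarith
  have hre {s : ℝ} (hs : s = 1 ∨ s = -1) : s * r * (n p).re + r / 2 ≤ 0 := by
    have : p + (s * r : ℝ) * n p + (r / 2 : ℝ) ∈ Metric.ball (p + (s * r : ℝ) * n p) r := by
      have := h.pos
      rw [Metric.mem_ball, dist_self_add_left, Complex.norm_real, Real.norm_eq_abs,
        abs_of_pos (by linarith)]
      linarith
    have := hmax (hall hs hpΓ this)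
    simp only [mem_ofPred_eq, Complex.add_re, Complex.re_ofReal_mul, Complex.ofReal_re] at this
    linarith
  have h1 := hre (Or.inl rfl)
  have h2 := hre (Or.inr rfl)
  have := h.pos
  linarith

theorem TangentBalls.exists_interior_side (h : TangentBalls Γ n r) (hΓ : IsCompact Γ)
    (hΓn : Γ.Nonempty) (hΓc : IsPreconnected Γ) {σ : Set ℂ} (hσ : IsClosed σ)
    (hf : FilledOff Γ σ) {a : ℂ} (ha : a ∈ σ \ Γ) :
    ∃ s : ℝ, (s = 1 ∨ s = -1) ∧ ∀ c ∈ Γ, ∀ ρ ∈ Ioc 0 r, c + (s * ρ : ℝ) * n c ∈ σ := by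
  obtain ⟨c₀, hc₀, hmin⟩ := hΓ.exists_isMinOn hΓn
    (continuous_id.dist (continuous_const (y := a))).continuousOn
  set d := dist c₀ a with hd
  have hd0 : 0 < d := dist_pos.mpr fun e => ha.2 (e ▸ hc₀)
  have hball : Metric.ball a d ⊆ σ := by
    refine hf _ Metric.isOpen_ball (convex_ball _ _).isPreconnected ?_
      ⟨a, Metric.mem_ball_self hd0, ha.1⟩
    exact disjoint_left.mpr fun z hz hzΓ => not_lt.mpr (show d ≤ dist z a from hmin hzΓ) hz
  have hn := h.norm_eq c₀ hc₀
  obtain ⟨s, hs, hsign⟩ : ∃ s : ℝ, (s = 1 ∨ s = -1) ∧ 0 ≤ s * inner ℝ (n c₀) (a - c₀) := by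
    rcases le_total 0 (inner ℝ (n c₀) (a - c₀) : ℝ) with h0 | h0
    · exact ⟨1, Or.inl rfl, by simpa using h0⟩
    · exact ⟨-1, Or.inr rfl, by linarith⟩
  refine ⟨s, hs, fun c hc ρ hρ => h.centers_dichotomy hΓ.isClosed hΓc hσ hf hρ hs hc₀ ?_ c hc⟩
  have hρ0 := hρ.1
  have hs2 : s * s = 1 := by rcases hs with rfl | rfl <;> norm_num
  set τ : ℝ := min d ρ / 2 with hτ
  have hτ0 : 0 < τ := by positivity
  have hτd : τ < d := by have := min_le_left d ρ; linarith
  have hτρ : τ < ρ := by have := min_le_right d ρ; linarith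
  set v : ℂ := s • n c₀ with hv
  set u : ℂ := d⁻¹ • (a - c₀) with hu
  have hnv : inner ℝ v v = (1 : ℝ) := by
    rw [real_inner_self_eq_norm_sq, hv, norm_smul, hn]
    rcases hs with rfl | rfl <;> simp
  have hnu : inner ℝ u u = (1 : ℝ) := by
    rw [real_inner_self_eq_norm_sq, hu, norm_smul, ← dist_eq_norm, dist_comm, ← hd, norm_inv,
      Real.norm_eq_abs, abs_of_pos hd0, inv_mul_cancel₀ hd0.ne', one_pow]
  set k : ℝ := inner ℝ u v with hk
  have hk0 : 0 ≤ k := by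
    rw [hk, hu, hv, real_inner_smul_left, real_inner_smul_right, real_inner_comm]
    positivity
  have hkvu : inner ℝ v u = k := real_inner_comm _ _
  set m : ℂ := c₀ + τ • (u + v) with hm
  have e1 : m - a = τ • (u + v) - d • u := by
    rw [hm, hu, smul_smul, mul_inv_cancel₀ hd0.ne', one_smul]; ring
  have e2 : m - (c₀ + (s * ρ : ℝ) * n c₀) = τ • (u + v) - ρ • v := by
    rw [hm, hv, smul_smul, mul_comm ρ s]; simp
  have hma : m ∈ Metric.ball a d := by
    rw [Metric.mem_ball, dist_eq_norm, e1]
    refine lt_of_pow_lt_pow_left₀ 2 hd0.le ?_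
    rw [← real_inner_self_eq_norm_sq]
    simp only [inner_sub_left, inner_sub_right, inner_add_left, inner_add_right,
      real_inner_smul_left, real_inner_smul_right, hnu, hnv, hkvu, ← hk]
    nlinarith [mul_pos hτ0 (sub_pos.mpr hτd), mul_nonneg (mul_pos hτ0 (sub_pos.mpr hτd)).le hk0]
  have hmρ : m ∈ Metric.ball (c₀ + (s * ρ : ℝ) * n c₀) ρ := by
    rw [Metric.mem_ball, dist_eq_norm, e2]
    refine lt_of_pow_lt_pow_left₀ 2 hρ0.le ?_
    rw [← real_inner_self_eq_norm_sq]
    simp only [inner_sub_left, inner_sub_right, inner_add_left, inner_add_right,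
      real_inner_smul_left, real_inner_smul_right, hnu, hnv, hkvu, ← hk]
    nlinarith [mul_pos hτ0 (sub_pos.mpr hτρ), mul_nonneg (mul_pos hτ0 (sub_pos.mpr hτρ)).le hk0]
  exact hf _ Metric.isOpen_ball (convex_ball _ _).isPreconnected (h.disjoint_ball hc₀ hρ hs)
    ⟨m, hmρ, hball hma⟩ (Metric.mem_ball_self hρ0)

end TangentBalls

theorem Complex.eq_or_one_lt_norm_sub_of_exp_eq {x y : ℂ} (h : Complex.exp x = Complex.exp y) :
    x = y ∨ 1 < ‖x - y‖ := by
  obtain ⟨k, hk⟩ := Complex.exp_eq_exp_iff_exists_int.mp h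
  rcases eq_or_ne k 0 with rfl | hk0
  · left; simpa using hk
  · right
    have h1 : (1 : ℝ) ≤ |(k : ℝ)| := by exact_mod_cast Int.one_le_abs hk0
    rw [hk, add_sub_cancel_left]
    simp only [norm_mul, Complex.norm_intCast, Complex.norm_I, Complex.norm_real, mul_one,
      Complex.norm_two, Real.norm_eq_abs, abs_of_pos Real.pi_pos]
    nlinarith [Real.pi_gt_three]

/-- A compact connected set which is relatively open in a set invariant under translation by
periods of `exp` contains at most one logarithm of each number. -/
theorem injOn_exp_of_relatively_open {J G : Set ℂ} (hJ : IsCompact J) (hJc : IsPreconnected J)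
    (hJG : J ⊆ G) (hG : ∀ p q, Complex.exp p = Complex.exp q → p ∈ G → q ∈ G)
    (hopen : ∀ p ∈ J, J ∈ 𝓝[G] p) : InjOn Complex.exp J := by
  intro p hp q hq hpq
  by_contra hne
  set v := q - p with hv
  have hv0 : v ≠ 0 := sub_ne_zero.mpr (Ne.symm hne)
  have hexp (x : ℂ) : Complex.exp (x - v) = Complex.exp x := by
    rw [hv, Complex.exp_sub, Complex.exp_sub, hpq, div_self (Complex.exp_ne_zero _), div_one]
  have hcont : Continuous fun x : ℂ => x - v := by fun_prop
  have hstep : ∀ x ∈ J, x - v ∈ J := by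
    have hsub : J ⊆ (fun x => x - v) ⁻¹' J := by
      rw [isPreconnected_iff_subset_of_disjoint] at hJc
      obtain ⟨O, hO, hOeq⟩ : ∃ O, IsOpen O ∧ J ∩ O = J ∩ (fun x => x - v) ⁻¹' J := by
        refine ⟨interior ({x | x ∈ G → x - v ∈ J}), isOpen_interior, ?_⟩
        ext x
        refine and_congr_right fun hx => ⟨fun h => interior_subset h (hJG hx), fun h => ?_⟩
        rw [mem_interior_iff_mem_nhds]
        have := hcont.continuousAt.eventually (mem_nhdsWithin_iff_eventually.mp (hopen _ h))
        filter_upwards [this] with y hy hyG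
        exact hy (hG y _ (hexp y).symm hyG)
      have hcl : IsOpen ((fun x => x - v) ⁻¹' Jᶜ) := hJ.isClosed.isOpen_compl.preimage hcont
      have hcov : J ⊆ O ∪ (fun x => x - v) ⁻¹' Jᶜ := fun x hx => by
        by_cases hxJ : x - v ∈ J
        · exact Or.inl (hOeq.superset ⟨hx, hxJ⟩).2
        · exact Or.inr hxJ
      have hemp : J ∩ (O ∩ (fun x => x - v) ⁻¹' Jᶜ) = ∅ := by
        rw [← inter_assoc, hOeq, inter_assoc, ← preimage_inter, inter_compl_self, preimage_empty,
          inter_empty]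
      rcases hJc O _ hO hcl hcov hemp with h | h
      · exact fun x hx => (hOeq.subset ⟨hx, h hx⟩).2
      · exact absurd (show q - v ∈ J by simpa [hv] using hp) (h hq)
    exact hsub
  have hiter (m : ℕ) : p - m * v ∈ J := by
    induction m with
    | zero => simpa using hp
    | succ m ih =>
      have := hstep _ ih
      convert this using 1
      push_cast; ring
  obtain ⟨C, hC⟩ := hJ.isBounded.exists_norm_le
  obtain ⟨m, hm⟩ := exists_nat_gt ((C + C) / ‖v‖)
  rw [div_lt_iff₀ (norm_pos_iff.mpr hv0)] at hm
  have h1 : ‖(m : ℂ) * v‖ ≤ C + C := by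
    calc ‖(m : ℂ) * v‖ = ‖p - (p - m * v)‖ := by congr 1; ring
      _ ≤ ‖p‖ + ‖p - m * v‖ := norm_sub_le _ _
      _ ≤ C + C := add_le_add (hC _ hp) (hC _ (hiter m))
  rw [norm_mul, Complex.norm_natCast] at h1
  linarith

theorem exists_continuousOn_leftInverse {J S : Set ℂ} {e : ℂ → ℂ} (hJ : IsCompact J)
    (he : ContinuousOn e J) (hinj : InjOn e J) (himg : e '' J = S) :
    ∃ L : ℂ → ℂ, ContinuousOn L S ∧ ∀ z ∈ S, e (L z) = z := by
  have hS : ∀ z ∈ S, ∃ p ∈ J, e p = z := fun z hz => by rwa [← himg] at hz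
  choose! L hLJ hL using hS
  refine ⟨L, continuousOn_iff_isClosed.mpr fun t ht => ⟨e '' (J ∩ t),
    ((hJ.inter_right ht).image_of_continuousOn (he.mono inter_subset_left)).isClosed, ?_⟩, hL⟩
  ext z
  constructor
  · rintro ⟨hz, hzS⟩
    exact ⟨⟨L z, ⟨hLJ z hzS, hz⟩, hL z hzS⟩, hzS⟩
  · rintro ⟨⟨p, ⟨hpJ, hpt⟩, rfl⟩, hzS⟩
    have : L (e p) = p := hinj (hLJ _ hzS) hpJ (hL _ hzS)
    exact ⟨by rw [mem_preimage, this]; exact hpt, hzS⟩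

/-- `X` propagates off `Γ × ℂ`: over a connected open set off `Γ`, a clopen piece of `X` that is
nonempty over one point is nonempty over every point. -/
def PropagatesOff (Γ : Set ℂ) (X : Set (ℂ × ℂ)) : Prop :=
  ∀ U : Set ℂ, IsOpen U → IsPreconnected U → Disjoint U Γ → ∀ O₁ O₂ : Set (ℂ × ℂ), IsOpen O₁ →
    IsOpen O₂ → Disjoint O₁ O₂ → (∀ q ∈ X, q.1 ∈ U → q ∈ O₁ ∪ O₂) →
    ∀ q₀ ∈ X, q₀.1 ∈ U → q₀ ∈ O₁ → ∀ z ∈ U, ∃ u, (z, u) ∈ X ∧ (z, u) ∈ O₁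

theorem PropagatesOff.filledOff {Γ : Set ℂ} {X : Set (ℂ × ℂ)} (h : PropagatesOff Γ X) :
    FilledOff Γ (Prod.fst '' X) := by
  rintro U hU hUc hd ⟨_, hqU, ⟨q, hq, rfl⟩⟩ z hz
  obtain ⟨u, hu, -⟩ := h U hU hUc hd univ ∅ isOpen_univ isOpen_empty (by simp) (by simp) q hq hqU
    trivial z hz
  exact ⟨(z, u), hu, rfl⟩

/-- A continuous logarithm of `z - a` on `K` extends to a neighbourhood of `K`. -/
theorem exists_log_extension {K : Set (ℂ × ℂ)} (hK : IsCompact K) {a : ℂ}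
    (haK : ∀ q ∈ K, q.1 ≠ a) {ψ : ℂ × ℂ → ℂ} (hψ : ContinuousOn ψ K)
    (hexp : ∀ q ∈ K, Complex.exp (ψ q) = q.1 - a) :
    ∃ (N : Set (ℂ × ℂ)) (Λ : ℂ × ℂ → ℂ), IsOpen N ∧ K ⊆ N ∧ ContinuousOn Λ N ∧
      (∀ q ∈ N, Complex.exp (Λ q) = q.1 - a) ∧ EqOn Λ ψ K := by
  obtain ⟨Ψ, hΨ, hΨψ⟩ := exists_continuous_extension hK.isClosed hψ
  set N : Set (ℂ × ℂ) := {q | ‖Complex.exp (Ψ q) - (q.1 - a)‖ < ‖q.1 - a‖} with hN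
  have hne : ∀ q ∈ N, q.1 - a ≠ 0 := fun q hq h0 => by
    simp only [hN, mem_ofPred_eq, h0, norm_zero] at hq
    exact absurd hq (not_lt.mpr (norm_nonneg _))
  refine ⟨N, fun q => Ψ q - Complex.log (Complex.exp (Ψ q) / (q.1 - a)),
    isOpen_lt (by fun_prop) (by fun_prop), fun q hq => ?_, ?_, fun q hq => ?_, fun q hq => ?_⟩
  · simp only [hN, mem_ofPred_eq, hΨψ hq, hexp q hq, sub_self, norm_zero, norm_pos_iff]
    exact sub_ne_zero.mpr (haK q hq)
  · refine hΨ.continuousOn.sub (ContinuousOn.clog (ContinuousOn.div (by fun_prop) (by fun_prop)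
      hne) fun q hq => ?_)
    have : Complex.exp (Ψ q) / (q.1 - a) = 1 + (Complex.exp (Ψ q) - (q.1 - a)) / (q.1 - a) := by
      have := hne q hq
      field_simp
      ring
    rw [this]
    refine Complex.mem_slitPlane_of_norm_lt_one ?_
    rw [norm_div, div_lt_one (norm_pos_iff.mpr (hne q hq))]
    exact hq
  · have := hne q hq
    rw [Complex.exp_sub, Complex.exp_log (div_ne_zero (Complex.exp_ne_zero _) this)]
    have := Complex.exp_ne_zero (Ψ q)
    field_simp
  · simp only
    rw [hΨψ hq, hexp q hq, div_self (sub_ne_zero.mpr (haK q hq)), Complex.log_one, sub_zero]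

theorem PropagatesOff.image_log_mem_nhds {Γ : Set ℂ} {X : Set (ℂ × ℂ)} (hprop : PropagatesOff Γ X)
    {N : Set (ℂ × ℂ)} (hN : IsOpen N) {Λ : ℂ × ℂ → ℂ} (hΛ : ContinuousOn Λ N) {a : ℂ}
    (hexp : ∀ q ∈ N, Complex.exp (Λ q) = q.1 - a) {W : Set ℂ} (hW : IsOpen W) (hWΓ : Disjoint W Γ)
    (hWN : ∀ q ∈ X, q.1 ∈ W → q ∈ N) {y : ℂ × ℂ} (hy : y ∈ X) (hyW : y.1 ∈ W) :
    Λ '' {q ∈ X | q.1 ∈ W} ∈ 𝓝 (Λ y) := by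
  have hyN := hWN y hy hyW
  have hz0 : y.1 - a ≠ 0 := hexp y hyN ▸ Complex.exp_ne_zero _
  obtain ⟨ε₀, hε₀, hεW⟩ := Metric.isOpen_iff.mp hW y.1 hyW
  set ε := min ε₀ ‖y.1 - a‖
  have hε : 0 < ε := lt_min hε₀ (norm_pos_iff.mpr hz0)
  set U := Metric.ball y.1 ε
  have hUW : U ⊆ W := (Metric.ball_subset_ball (min_le_left _ _)).trans hεW
  set ℓ : ℂ → ℂ := fun z => Λ y + Complex.log ((z - a) / (y.1 - a)) with hℓ
  have hslit : ∀ z ∈ U, (z - a) / (y.1 - a) ∈ Complex.slitPlane := fun z hz => by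
    have : (z - a) / (y.1 - a) = 1 + (z - y.1) / (y.1 - a) := by field_simp; ring
    rw [this]
    refine Complex.mem_slitPlane_of_norm_lt_one ?_
    rw [norm_div, div_lt_one (norm_pos_iff.mpr hz0), ← dist_eq_norm]
    exact lt_of_lt_of_le hz (min_le_right _ _)
  have hℓc : ContinuousOn ℓ U :=
    continuousOn_const.add (ContinuousOn.clog (by fun_prop) hslit)
  have hℓexp : ∀ z ∈ U, Complex.exp (ℓ z) = z - a := fun z hz => by
    rw [hℓ, Complex.exp_add, hexp y hyN, Complex.exp_log (Complex.slitPlane_ne_zero (hslit z hz))]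
    field_simp
  have hℓy : ℓ y.1 = Λ y := by simp [hℓ, div_self hz0]
  set D : Set (ℂ × ℂ) := N ∩ Prod.fst ⁻¹' U
  have hD : IsOpen D := hN.inter (Metric.isOpen_ball.preimage continuous_fst)
  have hcont : ContinuousOn (fun q : ℂ × ℂ => ‖Λ q - ℓ q.1‖) D :=
    ((hΛ.mono inter_subset_left).sub (hℓc.comp continuous_fst.continuousOn fun q hq => hq.2)).norm
  have hcase : ∀ q ∈ X, q.1 ∈ U → Λ q = ℓ q.1 ∨ 1 < ‖Λ q - ℓ q.1‖ := fun q hq hqU =>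
    Complex.eq_or_one_lt_norm_sub_of_exp_eq (by rw [hexp q (hWN q hq (hUW hqU)), hℓexp _ hqU])
  have hall := hprop U Metric.isOpen_ball (convex_ball _ _).isPreconnected (hWΓ.mono_left hUW)
    (D ∩ (fun q : ℂ × ℂ => ‖Λ q - ℓ q.1‖) ⁻¹' Iio 1) (D ∩ (fun q : ℂ × ℂ => ‖Λ q - ℓ q.1‖) ⁻¹' Ioi 1)
    (hcont.isOpen_inter_preimage hD isOpen_Iio) (hcont.isOpen_inter_preimage hD isOpen_Ioi)
    (disjoint_left.mpr fun q h1 h2 => lt_asymm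
      (show ‖Λ q - ℓ q.1‖ < 1 from h1.2) (show 1 < ‖Λ q - ℓ q.1‖ from h2.2))
    (fun q hq hqU => (hcase q hq hqU).imp
      (fun h => ⟨⟨hWN q hq (hUW hqU), hqU⟩, by simp [h]⟩)
      (fun h => ⟨⟨hWN q hq (hUW hqU), hqU⟩, h⟩))
    y hy (Metric.mem_ball_self hε)
    ⟨⟨hyN, Metric.mem_ball_self hε⟩, by simp [hℓy]⟩
  have hE : ContinuousAt (fun p : ℂ => a + Complex.exp p) (Λ y) := by fun_prop
  have hEy : a + Complex.exp (Λ y) = y.1 := by rw [hexp y hyN]; ring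
  have h1 : ∀ᶠ p in 𝓝 (Λ y), a + Complex.exp p ∈ U :=
    hE (by
      change U ∈ 𝓝 (a + Complex.exp (Λ y))
      rw [hEy]
      exact Metric.ball_mem_nhds _ hε)
  have h2 : ∀ᶠ p in 𝓝 (Λ y), ‖ℓ (a + Complex.exp p) - p‖ < 1 := by
    have hc : ContinuousAt (fun p : ℂ => ‖ℓ (a + Complex.exp p) - p‖) (Λ y) := by
      refine ContinuousAt.norm (ContinuousAt.sub ?_ continuousAt_id)
      refine ContinuousAt.comp (g := ℓ) ?_ hE
      rw [hEy]
      exact hℓc.continuousAt (Metric.ball_mem_nhds _ hε)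
    refine hc.eventually (gt_mem_nhds ?_)
    change ‖ℓ (a + Complex.exp (Λ y)) - Λ y‖ < 1
    rw [hEy, hℓy, sub_self, norm_zero]
    exact one_pos
  filter_upwards [h1, h2] with p hp1 hp2
  obtain ⟨u, huX, -, hu1⟩ := hall _ hp1
  have e1 : Λ (a + Complex.exp p, u) = ℓ (a + Complex.exp p) :=
    (hcase _ huX hp1).resolve_right (not_lt.mpr (le_of_lt hu1))
  have e2 : ℓ (a + Complex.exp p) = p :=
    (Complex.eq_or_one_lt_norm_sub_of_exp_eq (by rw [hℓexp _ hp1]; ring)).resolve_right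
      (not_lt.mpr hp2.le)
  exact ⟨_, ⟨huX, hUW hp1⟩, e1.trans e2⟩

theorem PropagatesOff.fst_image_subset {Γ : Set ℂ} {n : ℂ → ℂ} {r₀ : ℝ} (h : TangentBalls Γ n r₀)
    (hΓ : IsCompact Γ) (hΓc : IsPreconnected Γ) {X K : Set (ℂ × ℂ)} (hX : IsCompact X)
    (hprop : PropagatesOff Γ X) (hK : IsCompact K) (hKn : K.Nonempty) (hKc : IsPreconnected K)
    (hKΓ : Prod.fst '' K = Γ) (hXK : ∀ q ∈ X, q.1 ∈ Γ → q ∈ K)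
    (hlog : ∀ a ∉ Γ, ∃ ψ : ℂ × ℂ → ℂ, ContinuousOn ψ K ∧
      ∀ q ∈ K, Complex.exp (ψ q) = q.1 - a) : Prod.fst '' X ⊆ Γ := by
  intro a haσ
  by_contra haΓ
  have hσ : IsCompact (Prod.fst '' X) := hX.image continuous_fst
  have hf := hprop.filledOff
  have hΓn : Γ.Nonempty := hKΓ ▸ hKn.image _
  have hKΓ' : ∀ q ∈ K, q.1 ∈ Γ := fun q hq => hKΓ ▸ mem_image_of_mem _ hq
  obtain ⟨s, hs, hside⟩ := h.exists_interior_side hΓ hΓn hΓc hσ.isClosed hf ⟨haσ, haΓ⟩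
  obtain ⟨ψ, hψ, hψexp⟩ := hlog a haΓ
  obtain ⟨N, Λ, hN, hKN, hΛ, hΛexp, hΛψ⟩ := exists_log_extension hK
    (fun q hq (e : q.1 = a) => haΓ (e ▸ hKΓ' q hq)) hψ hψexp
  have hP : IsCompact (Prod.fst '' (X \ N)) := (hX.diff hN).image continuous_fst
  obtain ⟨δ, hδ, hδP⟩ := hΓ.exists_cthickening_subset_open hP.isClosed.isOpen_compl
    (fun z hz => by
      rintro ⟨q, hq, rfl⟩
      exact hq.2 (hKN (hXK q hq.1 hz)))
  have hCN : ∀ q ∈ X, q.1 ∈ Metric.cthickening δ Γ → q ∈ N := fun q hq hqC => by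
    by_contra hqN
    exact hδP hqC ⟨q, ⟨hq, hqN⟩, rfl⟩
  obtain ⟨d, hd, hdΓ⟩ := Metric.isOpen_iff.mp hΓ.isClosed.isOpen_compl a haΓ
  have hdist : ∀ c ∈ Γ, d ≤ ‖c - a‖ := fun c hc => by
    by_contra hlt
    exact hdΓ (by rw [Metric.mem_ball, dist_eq_norm]; exact not_le.mp hlt) hc
  set r := min r₀ (min (δ / 2) (d / 2)) with hr
  have hr0 : 0 < r := lt_min h.pos (lt_min (by linarith) (by linarith))
  have hrr : r ≤ r₀ := min_le_left _ _
  have hrδ : r < δ := by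
    have : r ≤ δ / 2 := (min_le_right _ _).trans (min_le_left _ _)
    linarith
  have hrd : r < d := by
    have : r ≤ d / 2 := (min_le_right _ _).trans (min_le_right _ _)
    linarith
  set W : Set ℂ := Metric.thickening δ Γ \ Γ with hWdef
  have hW : IsOpen W := Metric.isOpen_thickening.sdiff hΓ.isClosed
  have hWC : W ⊆ Metric.cthickening δ Γ := fun z hz => Metric.thickening_subset_cthickening _ _ hz.1
  set T : Set ℂ := Λ '' {q ∈ X | q.1 ∈ Metric.cthickening δ Γ} with hT
  have hTc : IsCompact T := by
    refine IsCompact.image_of_continuousOn ?_ (hΛ.mono fun q hq => hCN q hq.1 hq.2)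
    exact hX.inter_right (Metric.isClosed_cthickening.preimage continuous_fst)
  have hTexp : ∀ q ∈ X, q.1 ∈ Metric.cthickening δ Γ → a + Complex.exp (Λ q) = q.1 :=
    fun q hq hqC => by rw [hΛexp q (hCN q hq hqC)]; ring
  have hTopen : ∀ p ∈ T, a + Complex.exp p ∈ W → T ∈ 𝓝 p := by
    rintro _ ⟨q, ⟨hq, hqC⟩, rfl⟩ hpW
    rw [hTexp q hq hqC] at hpW
    refine mem_of_superset (hprop.image_log_mem_nhds hN hΛ hΛexp hW disjoint_sdiff_left
      (fun q hq hqW => hCN q hq (hWC hqW)) hq hpW) (image_mono fun q hq => ⟨hq.1, hWC hq.2⟩)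
  set G : Set ℂ := {p | a + Complex.exp p ∈ Γ} with hG
  set J : Set ℂ := ψ '' K with hJ
  have hJc : IsCompact J := hK.image_of_continuousOn hψ
  have hJp : IsPreconnected J := hKc.image _ hψ
  have hJexp : ∀ q ∈ K, a + Complex.exp (ψ q) = q.1 := fun q hq => by rw [hψexp q hq]; ring
  have hJG : J ⊆ G := by
    rintro _ ⟨q, hq, rfl⟩
    rw [hG, mem_ofPred_eq, hJexp q hq]
    exact hKΓ' q hq
  have hTJ : ∀ p ∈ T, p ∈ G → p ∈ J := by
    rintro _ ⟨q, ⟨hq, hqC⟩, rfl⟩ hpG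
    rw [hG, mem_ofPred_eq, hTexp q hq hqC] at hpG
    have := hXK q hq hpG
    exact ⟨q, this, (hΛψ this).symm⟩
  set F : ℂ × ℝ → ℂ := fun x =>
    x.1 + Complex.log (1 + (s * x.2 : ℝ) * n (a + Complex.exp x.1) / Complex.exp x.1) with hF
  have hslit : ∀ p ∈ G, ∀ ρ ∈ Icc 0 r,
      1 + (s * ρ : ℝ) * n (a + Complex.exp p) / Complex.exp p ∈ Complex.slitPlane := by
    intro p hp ρ hρ
    refine Complex.mem_slitPlane_of_norm_lt_one ?_
    have h1 := hdist _ hp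
    rw [add_sub_cancel_left] at h1
    have h2 : |s| = 1 := by rcases hs with rfl | rfl <;> simp
    rw [norm_div, norm_mul, h.norm_eq _ hp, mul_one, Complex.norm_real, norm_mul,
      Real.norm_eq_abs, h2, one_mul, Real.norm_eq_abs, abs_of_nonneg hρ.1,
      div_lt_one (norm_pos_iff.mpr (Complex.exp_ne_zero _))]
    linarith [hρ.2]
  have hFc : ContinuousOn F (G ×ˢ Icc 0 r) := by
    refine continuous_fst.continuousOn.add (ContinuousOn.clog ?_ fun x hx => hslit _ hx.1 _ hx.2)
    refine continuousOn_const.add (ContinuousOn.div (ContinuousOn.mul (by fun_prop) ?_)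
      (by fun_prop) fun x _ => Complex.exp_ne_zero _)
    exact h.cont.comp (by fun_prop) fun x hx => hx.1
  have hF0 (p : ℂ) : F (p, 0) = p := by simp [hF]
  have hFexp : ∀ p ∈ G, ∀ ρ ∈ Icc 0 r, a + Complex.exp (F (p, ρ)) =
      (a + Complex.exp p) + (s * ρ : ℝ) * n (a + Complex.exp p) := by
    intro p hp ρ hρ
    rw [hF, Complex.exp_add, Complex.exp_log (Complex.slitPlane_ne_zero (hslit p hp ρ hρ))]
    have := Complex.exp_ne_zero p
    field_simp
    ring
  have hFW : ∀ p ∈ G, ∀ ρ ∈ Ioc 0 r, a + Complex.exp (F (p, ρ)) ∈ W := by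
    intro p hp ρ hρ
    rw [hFexp p hp ρ (Ioc_subset_Icc_self hρ)]
    refine ⟨Metric.mem_thickening_iff.mpr ⟨_, hp, ?_⟩,
      h.center_notMem hp ⟨hρ.1, hρ.2.trans hrr⟩ hs⟩
    rw [dist_comm, h.dist_center hp hρ.1.le hs]
    exact hρ.2.trans_lt hrδ
  have hrI : r ∈ Ioc 0 r := ⟨hr0, le_rfl⟩
  have hTV : IsOpen (T ∩ {p | a + Complex.exp p ∈ W}) := by
    refine isOpen_iff_mem_nhds.mpr fun p hp => inter_mem (hTopen p hp.1 hp.2) ?_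
    exact (hW.preimage (by fun_prop : Continuous fun p : ℂ => a + Complex.exp p)).mem_nhds hp.2
  have hclopen {S : Set (ℂ × ℝ)} (hS : IsPreconnected S) (hSG : S ⊆ G ×ˢ Ioc 0 r) {x : ℂ × ℝ}
      (hx : x ∈ S) (hxT : F x ∈ T) : ∀ y ∈ S, F y ∈ T := by
    have hcont : ContinuousOn F S :=
      hFc.mono (hSG.trans (prod_mono_right Ioc_subset_Icc_self))
    have hcov : F '' S ⊆ (T ∩ {p | a + Complex.exp p ∈ W}) ∪ Tᶜ := by
      rintro _ ⟨y, hy, rfl⟩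
      by_cases hyT : F y ∈ T
      · exact Or.inl ⟨hyT, hFW _ (hSG hy).1 _ (hSG hy).2⟩
      · exact Or.inr hyT
    have := (hS.image _ hcont).subset_left_of_subset_union hTV hTc.isClosed.isOpen_compl
      (disjoint_left.mpr fun v hv hv' => hv' hv.1) hcov
      ⟨_, ⟨x, hx, rfl⟩, hxT, hFW _ (hSG hx).1 _ (hSG hx).2⟩
    exact fun y hy => (this ⟨y, hy, rfl⟩).1
  have hdown : ∀ p ∈ G, F (p, r) ∈ T → p ∈ J := by
    intro p hp hpT
    refine hTJ p ?_ hp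
    have hall := hclopen (S := {p} ×ˢ Ioc 0 r) (isPreconnected_singleton.prod isPreconnected_Ioc)
      (prod_mono_left (singleton_subset_iff.mpr hp)) (x := (p, r)) ⟨rfl, hrI⟩ hpT
    have hlim : Tendsto (fun ρ : ℝ => F (p, ρ)) (𝓝[Ioc 0 r] 0) (𝓝 p) := by
      have := (hFc (p, 0) ⟨hp, ⟨le_rfl, hr0.le⟩⟩).tendsto
      rw [hF0] at this
      refine this.comp (tendsto_nhdsWithin_of_tendsto_nhds_of_eventually_within _ ?_ ?_)
      · exact (Continuous.tendsto' (by fun_prop) _ _ rfl).mono_left nhdsWithin_le_nhds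
      · filter_upwards [self_mem_nhdsWithin] with ρ hρ
        exact ⟨hp, Ioc_subset_Icc_self hρ⟩
    have hne : (𝓝[Ioc 0 r] (0 : ℝ)).NeBot := by
      rw [nhdsWithin_Ioc_eq_nhdsGT hr0]
      infer_instance
    refine hTc.isClosed.mem_of_tendsto hlim ?_
    filter_upwards [self_mem_nhdsWithin] with ρ hρ
    exact hall (p, ρ) ⟨rfl, hρ⟩
  obtain ⟨p₀, hp₀, hp₀T⟩ : ∃ p₀ ∈ G, F (p₀, r) ∈ T := by
    obtain ⟨c, hc⟩ := hΓn
    obtain ⟨q, hq, hqc⟩ := hside c hc r ⟨hr0, hrr⟩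
    have hca : c - a ≠ 0 := sub_ne_zero.mpr fun e => haΓ (e ▸ hc)
    have hqC : q.1 ∈ Metric.cthickening δ Γ := by
      rw [hqc]
      refine Metric.mem_cthickening_of_dist_le _ c δ Γ hc ?_
      rw [dist_comm, h.dist_center hc hr0.le hs]
      exact hrδ.le
    have hsl := hslit (Complex.log (c - a))
      (by rw [hG, mem_ofPred_eq, Complex.exp_log hca, add_sub_cancel]; exact hc) r ⟨hr0.le, le_rfl⟩
    rw [Complex.exp_log hca, add_sub_cancel] at hsl
    have hsl0 := Complex.slitPlane_ne_zero hsl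
    set p₀ := Λ q - Complex.log (1 + (s * r : ℝ) * n c / (c - a)) with hp₀
    have hep : Complex.exp p₀ = c - a := by
      rw [hp₀, Complex.exp_sub, Complex.exp_log hsl0, hΛexp q (hCN q hq hqC), hqc,
        div_eq_iff hsl0]
      field_simp
      ring
    refine ⟨p₀, ?_, ?_⟩
    · rw [hG, mem_ofPred_eq, hep, add_sub_cancel]; exact hc
    · have : F (p₀, r) = Λ q := by
        change p₀ + Complex.log (1 + (s * r : ℝ) * n (a + Complex.exp p₀) / Complex.exp p₀) = Λ q
        rw [hep, add_sub_cancel, hp₀, sub_add_cancel]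
      rw [this]
      exact ⟨q, ⟨hq, hqC⟩, rfl⟩
  have hJT : ∀ p ∈ J, F (p, r) ∈ T := fun p hp =>
    hclopen (S := J ×ˢ {r}) (hJp.prod isPreconnected_singleton)
      (prod_mono hJG (singleton_subset_iff.mpr hrI)) (x := (p₀, r)) ⟨hdown p₀ hp₀ hp₀T, rfl⟩ hp₀T
      (p, r) ⟨hp, rfl⟩
  have hJopen : ∀ p ∈ J, J ∈ 𝓝[G] p := by
    intro p hp
    have hcont : ContinuousWithinAt (fun p => F (p, r)) G p :=
      (hFc (p, r) ⟨hJG hp, hr0.le, le_rfl⟩).comp (f := fun p => (p, r)) (by fun_prop)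
        fun p' hp' => ⟨hp', hr0.le, le_rfl⟩
    filter_upwards [hcont (hTopen _ (hJT p hp) (hFW p (hJG hp) r hrI)), self_mem_nhdsWithin]
      with p' hp'T hp'G
    exact hdown p' hp'G hp'T
  have hinj : InjOn Complex.exp J := injOn_exp_of_relatively_open hJc hJp hJG
    (fun p q hpq hp => by rw [hG, mem_ofPred_eq, ← hpq]; exact hp) hJopen
  obtain ⟨L, hL, hLexp⟩ := exists_continuousOn_leftInverse (S := Γ)
    (e := fun p => a + Complex.exp p) hJc (by fun_prop)
    (fun p hp q hq hpq => hinj hp hq (add_left_cancel hpq)) (by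
      rw [hJ, image_image, ← hKΓ]
      exact image_congr hJexp)
  exact not_exists_log_of_enclosing hΓ hσ (hf.isOpen_diff hΓ.isClosed) ⟨haσ, haΓ⟩ hL
    fun z hz => eq_sub_of_add_eq' (hLexp z hz)

theorem exists_norm_fderiv_le_of_eq_zero {h : ℂ → ℝ} (hh : ContDiff ℝ 2 h) {Γ : Set ℂ}
    (hΓ : IsCompact Γ) (h0 : ∀ c ∈ Γ, h c = 0) :
    ∃ C > 0, ∀ c ∈ Γ, ∀ z ∈ Γ, ‖fderiv ℝ h c (z - c)‖ ≤ C * ‖z - c‖ ^ 2 := by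
  obtain ⟨R, hR⟩ := hΓ.isBounded.subset_closedBall 0
  have hdiff : Differentiable ℝ h := hh.differentiable (by norm_num)
  have hd : ContDiff ℝ 1 (fderiv ℝ h) := hh.fderiv_right (by norm_num)
  obtain ⟨C, hC⟩ := hd.contDiffOn.exists_lipschitzOnWith (one_ne_zero)
    (convex_closedBall (0 : ℂ) R) (isCompact_closedBall (0 : ℂ) R)
  refine ⟨C + 1, by positivity, fun c hc z hz => ?_⟩
  have key := (convex_segment c z).norm_image_sub_le_of_norm_hasFDerivWithin_le'
    (f := h) (f' := fderiv ℝ h) (φ := fderiv ℝ h c) (C := C * ‖z - c‖)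
    (fun x _ => (hdiff x).hasFDerivAt.hasFDerivWithinAt) (fun x hx => by
      have hxB := (convex_closedBall (0 : ℂ) R).segment_subset (hR hc) (hR hz) hx
      refine (hC.norm_sub_le hxB (hR hc)).trans ?_
      gcongr
      obtain ⟨t, ht, rfl⟩ := segment_eq_image' ℝ c z ▸ hx
      simp only [add_sub_cancel_left, norm_smul, Real.norm_eq_abs, abs_of_nonneg ht.1]
      exact mul_le_of_le_one_left (norm_nonneg _) ht.2)
    (left_mem_segment ℝ c z) (right_mem_segment ℝ c z)
  rw [h0 c hc, h0 z hz, sub_self, zero_sub, norm_neg] at key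
  nlinarith [sq_nonneg ‖z - c‖]

/-- The real gradient of a function `ℂ → ℝ`, as a complex number. -/
def complexGradient (h : ℂ → ℝ) (c : ℂ) : ℂ := ⟨fderiv ℝ h c 1, fderiv ℝ h c Complex.I⟩

theorem fderiv_apply_eq_complexGradient (h : ℂ → ℝ) (c v : ℂ) :
    fderiv ℝ h c v = (complexGradient h c).re * v.re + (complexGradient h c).im * v.im := by
  conv_lhs => rw [← Complex.re_add_im v]
  have h1 : (v.re : ℂ) + v.im * Complex.I = v.re • (1 : ℂ) + v.im • Complex.I := by simp
  rw [h1, map_add, map_smul, map_smul]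
  simp [complexGradient, mul_comm]

theorem exists_tangentBalls {h : ℂ → ℝ} (hh : ContDiff ℝ 2 h) {Γ : Set ℂ}
    (hΓ : IsCompact Γ) (h0 : ∀ c ∈ Γ, h c = 0) (hd : ∀ c ∈ Γ, fderiv ℝ h c ≠ 0) :
    ∃ n r, TangentBalls Γ n r := by
  obtain ⟨C, hC, hCb⟩ := exists_norm_fderiv_le_of_eq_zero hh hΓ h0
  have hdc : Continuous (fderiv ℝ h) := hh.continuous_fderiv (by norm_num)
  have hgc : Continuous (complexGradient h) := by
    have : complexGradient h = fun c => (fderiv ℝ h c 1 : ℂ) + fderiv ℝ h c Complex.I * Complex.I := by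
      ext c
      apply Complex.ext <;> simp [complexGradient]
    rw [this]
    fun_prop
  have hg0 : ∀ c ∈ Γ, 0 < ‖complexGradient h c‖ := fun c hc => norm_pos_iff.mpr fun e =>
    hd c hc (by ext; simp [fderiv_apply_eq_complexGradient, e])
  obtain ⟨κ, hκ, hκb⟩ : ∃ κ > 0, ∀ c ∈ Γ, κ ≤ ‖complexGradient h c‖ :=
    hΓ.exists_forall_le' hgc.norm.continuousOn hg0
  refine ⟨fun c => complexGradient h c / ‖complexGradient h c‖, κ / (4 * C),
    { pos := by positivity, norm_eq := ?_, cont := ?_, inter_subset := ?_ }⟩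
  · intro c hc
    have := hg0 c hc
    simp [this.ne']
  · exact hgc.continuousOn.div (by fun_prop) fun c hc => by simpa using (hg0 c hc).ne'
  · rintro c hc ρ ⟨hρ0, hρ⟩ s hs z ⟨hz, hzb⟩
    by_contra hzc
    have hv : 0 < ‖z - c‖ := norm_pos_iff.mpr (sub_ne_zero.mpr hzc)
    have hg := hg0 c hc
    have h1 := hCb c hc z hz
    have h2 := hκb c hc
    have h3 : 4 * C * ρ ≤ κ := by
      rw [le_div_iff₀ (by positivity)] at hρ
      linarith
    rw [Metric.mem_closedBall, dist_eq_norm, ← sub_sub] at hzb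
    set v := z - c
    set g := complexGradient h c
    have h4 : ‖v‖ ^ 2 * ‖g‖ ≤ 2 * (s * ρ) * fderiv ℝ h c v := by
      have h5 : ‖v - (s * ρ : ℝ) * (g / ‖g‖)‖ ^ 2 ≤ ρ ^ 2 := by gcongr
      have h6 : (s * ρ) ^ 2 = ρ ^ 2 := by rcases hs with rfl | rfl <;> ring
      have h7 : ‖g‖ ^ 2 = g.re ^ 2 + g.im ^ 2 := by
        rw [← Complex.normSq_eq_norm_sq, Complex.normSq_apply]; ring
      have h8 : (s * ρ : ℝ) * (g / ‖g‖) = (((s * ρ) / ‖g‖ : ℝ) : ℂ) * g := by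
        push_cast; ring
      rw [h8, ← Complex.normSq_eq_norm_sq, Complex.normSq_apply, Complex.sub_re, Complex.sub_im,
        Complex.re_ofReal_mul, Complex.im_ofReal_mul] at h5
      rw [fderiv_apply_eq_complexGradient, ← Complex.normSq_eq_norm_sq, Complex.normSq_apply]
      change _ ≤ 2 * (s * ρ) * (g.re * v.re + g.im * v.im)
      set t := (s * ρ) / ‖g‖ with ht
      have h9 : s * ρ = t * ‖g‖ := by rw [ht]; field_simp
      rw [h9] at h6 ⊢
      have h10 : t ^ 2 * (g.re ^ 2 + g.im ^ 2) = ρ ^ 2 := by rw [← h7, ← h6]; ring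
      have h11 : v.re * v.re + v.im * v.im ≤ 2 * t * (g.re * v.re + g.im * v.im) := by nlinarith
      nlinarith
    have h5 : 2 * (s * ρ) * fderiv ℝ h c v ≤ 2 * ρ * (C * ‖v‖ ^ 2) := by
      refine (le_abs_self _).trans ?_
      have : |s| = 1 := by rcases hs with rfl | rfl <;> simp
      rw [abs_mul, abs_mul, abs_mul, this, abs_two, abs_of_pos hρ0, one_mul]
      gcongr
      exact h1
    have h6 : ‖v‖ ^ 2 * ‖g‖ ≤ ‖v‖ ^ 2 * (κ / 2) := by nlinarith [sq_nonneg ‖v‖]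
    have := le_of_mul_le_mul_left h6 (by positivity)
    linarith

theorem AlgHom.exists_extension_topologicalClosure_range {P B : Type*} [CommRing P] [Algebra ℂ P]
    [NormedCommRing B] [NormedAlgebra ℂ B] (g : P →ₐ[ℂ] B) (e : P →ₐ[ℂ] ℂ)
    (h : ∀ p, ‖e p‖ ≤ ‖g p‖) : ∃ φ : g.range.topologicalClosure →ₐ[ℂ] ℂ,
      ∀ p (a : g.range.topologicalClosure), (a : B) = g p → φ a = e p := by
  set A := g.range.topologicalClosure
  set g' : P →ₐ[ℂ] A := g.codRestrict A fun p => subset_closure ⟨p, rfl⟩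
  have hdense : DenseRange g' := by
    intro a
    rw [closure_subtype]
    refine closure_mono ?_ a.2
    rintro _ ⟨p, rfl⟩
    exact ⟨g' p, ⟨p, rfl⟩, rfl⟩
  set f : A →L[ℂ] ℂ := e.toLinearMap.extendOfNorm g'.toLinearMap
  have hf (p : P) : f (g' p) = e p :=
    LinearMap.extendOfNorm_eq (f := e.toLinearMap) (e := g'.toLinearMap) hdense
      ⟨1, fun p => (h p).trans (one_mul ‖g p‖).ge⟩ p
  have hmul (a b : A) : f (a * b) = f a * f b := by
    refine hdense.induction_on₂ (p := fun a b => f (a * b) = f a * f b)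
      (isClosed_eq (by fun_prop) (by fun_prop)) (fun p q => ?_) a b
    rw [← map_mul, hf, hf, hf, map_mul]
  refine ⟨AlgHom.ofLinearMap (f : A →ₗ[ℂ] ℂ) ?_ hmul, fun p a hpa => ?_⟩
  · have := hf 1
    simpa using this
  · obtain rfl : a = g' p := Subtype.ext hpa
    exact hf p

theorem Subalgebra.norm_character_apply_le {Y : Type*} [TopologicalSpace Y] [CompactSpace Y]
    [Nonempty Y] {A : Subalgebra ℂ C(Y, ℂ)} (hA : IsClosed (A : Set C(Y, ℂ))) (φ : A →ₐ[ℂ] ℂ)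
    (a : A) : ‖φ a‖ ≤ ‖a‖ := by
  have : CompleteSpace A := hA.completeSpace_coe
  have h1 : ‖(1 : A)‖ = 1 := norm_one (α := C(Y, ℂ))
  have h2 := AlgHom.norm_apply_le_self_mul_norm_one φ a
  rwa [h1, mul_one] at h2

theorem character_mem_polyHull1_of_peak {Y : Type*} [TopologicalSpace Y] [CompactSpace Y] [Nonempty Y]
    {A : Subalgebra ℂ C(Y, ℂ)} (hA : IsClosed (A : Set C(Y, ℂ))) {x w : A} (φ : A →ₐ[ℂ] ℂ) {o : ℂ}
    (ho : IsUnit (x - algebraMap ℂ A o))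
    (hpeak : ∀ y, (x : C(Y, ℂ)) y ≠ φ x → ‖φ x - o‖ < ‖(x : C(Y, ℂ)) y - o‖) :
    φ w ∈ polyHull1 {u | ∃ y, (x : C(Y, ℂ)) y = φ x ∧ (w : C(Y, ℂ)) y = u} := by
  intro p
  let ev (y : Y) : A →ₐ[ℂ] ℂ := (ContinuousMap.evalAlgHom ℂ ℂ y).comp A.val
  have hev (y : Y) (a : A) : ev y a = (a : C(Y, ℂ)) y := rfl
  set F : A := Polynomial.aeval w p with hF
  have hFy (ψ : A →ₐ[ℂ] ℂ) : ψ F = p.eval (ψ w) := by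
    rw [hF, ← Polynomial.aeval_algHom_apply, Polynomial.coe_aeval_eq_eval]
  obtain ⟨H, hH⟩ := ho.exists_right_inv
  set S : Set ℂ := {u | ∃ y, (x : C(Y, ℂ)) y = φ x ∧ (w : C(Y, ℂ)) y = u}
  set M : ℝ := sSup ((fun u => ‖p.eval u‖) '' S) with hM
  have hM0 : 0 ≤ M := Real.sSup_nonneg (by rintro _ ⟨u, -, rfl⟩; exact norm_nonneg _)
  have hMy (y : Y) (hy : (x : C(Y, ℂ)) y = φ x) : ‖(F : C(Y, ℂ)) y‖ ≤ M := by
    rw [← hev, hFy]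
    refine le_csSup ⟨‖F‖, ?_⟩ ⟨_, ⟨y, hy, rfl⟩, rfl⟩
    rintro _ ⟨_, ⟨y', -, rfl⟩, rfl⟩
    dsimp only
    rw [← hev, ← hFy]
    exact (F : C(Y, ℂ)).norm_coe_le_norm y'
  set G : A := algebraMap ℂ A (φ x - o) * H with hG
  have hφH : (φ x - o) * φ H = 1 := by
    have := congrArg φ hH
    rwa [map_mul, map_sub, φ.commutes, map_one] at this
  have hne : φ x - o ≠ 0 := left_ne_zero_of_mul_eq_one hφH
  have hφG : φ G = 1 := by
    rw [hG, map_mul, φ.commutes]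
    exact hφH
  have hGy (y : Y) : ((x : C(Y, ℂ)) y - o) * (G : C(Y, ℂ)) y = φ x - o := by
    have := congrArg (fun a : A => (a : C(Y, ℂ)) y) hH
    change ((x : C(Y, ℂ)) y - o) * (H : C(Y, ℂ)) y = 1 at this
    change ((x : C(Y, ℂ)) y - o) * ((φ x - o) * (H : C(Y, ℂ)) y) = φ x - o
    linear_combination (φ x - o) * this
  have hG1 (y : Y) (hy : (x : C(Y, ℂ)) y ≠ φ x) : ‖(G : C(Y, ℂ)) y‖ < 1 := by
    have h1 := hpeak y hy
    rw [← hGy y, norm_mul] at h1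
    exact lt_of_mul_lt_mul_left (h1.trans_eq (mul_one _).symm) (norm_nonneg _)
  have hGle (y : Y) : ‖(G : C(Y, ℂ)) y‖ ≤ 1 := by
    by_cases hy : (x : C(Y, ℂ)) y = φ x
    · have := hGy y
      rw [hy, mul_eq_left₀ hne] at this
      simp [this]
    · exact (hG1 y hy).le
  rw [← hFy]
  refine le_of_forall_pos_le_add fun ε hε => ?_
  have hVc : IsCompact {y | M + ε ≤ ‖(F : C(Y, ℂ)) y‖} :=
    (isClosed_le continuous_const (by fun_prop)).isCompact
  obtain ⟨η, hη0, hη1, hη⟩ : ∃ η : ℝ, 0 ≤ η ∧ η < 1 ∧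
      ∀ y, M + ε ≤ ‖(F : C(Y, ℂ)) y‖ → ‖(G : C(Y, ℂ)) y‖ ≤ η := by
    rcases Set.eq_empty_or_nonempty {y | M + ε ≤ ‖(F : C(Y, ℂ)) y‖} with he | hn
    · exact ⟨0, le_rfl, one_pos, fun y hy => (he.subset hy).elim⟩
    · obtain ⟨y₀, hy₀, hmax⟩ := hVc.exists_isMaxOn hn
        (f := fun y => ‖(G : C(Y, ℂ)) y‖) (by fun_prop)
      refine ⟨_, norm_nonneg ((G : C(Y, ℂ)) y₀), hG1 y₀ fun e => ?_, fun y hy => hmax hy⟩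
      have h1 := hMy y₀ e
      have h2 : M + ε ≤ ‖(F : C(Y, ℂ)) y₀‖ := hy₀
      linarith
  obtain ⟨m, hm⟩ : ∃ m : ℕ, ‖F‖ * η ^ m < M + ε :=
    (((tendsto_pow_atTop_nhds_zero_of_lt_one hη0 hη1).const_mul ‖F‖).eventually_lt_const
      (by rw [mul_zero]; linarith)).exists
  have hFG : φ F = φ (F * G ^ m) := by rw [map_mul, map_pow, hφG, one_pow, mul_one]
  rw [hFG]
  refine (Subalgebra.norm_character_apply_le hA φ _).trans ?_
  refine (ContinuousMap.norm_le _ (by linarith)).mpr fun y => ?_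
  change ‖(F : C(Y, ℂ)) y * (G : C(Y, ℂ)) y ^ m‖ ≤ M + ε
  rw [norm_mul, norm_pow]
  rcases le_total (M + ε) ‖(F : C(Y, ℂ)) y‖ with h1 | h1
  · refine le_trans ?_ hm.le
    gcongr
    · exact (F : C(Y, ℂ)).norm_coe_le_norm y
    · exact hη y h1
  · exact (mul_le_of_le_one_right (norm_nonneg _) (pow_le_one₀ (norm_nonneg _) (hGle y))).trans h1

/-- The uniform closure of the polynomials in the continuous functions on `K`. -/
abbrev polyClosure {n : ℕ} (K : Set (Fin n → ℂ)) [CompactSpace K] : Subalgebra ℂ C(K, ℂ) :=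
  (MvPolynomial.aeval fun i => (⟨fun z => z.1 i, (continuous_apply i).comp continuous_subtype_val⟩ :
    C(K, ℂ))).range.topologicalClosure

/-- The coordinate functions, as elements of `polyClosure K`. -/
def polyClosure.coord {n : ℕ} (K : Set (Fin n → ℂ)) [CompactSpace K] (i : Fin n) :
    polyClosure K :=
  ⟨⟨fun z => z.1 i, (continuous_apply i).comp continuous_subtype_val⟩,
    subset_closure ⟨MvPolynomial.X i, MvPolynomial.aeval_X _ i⟩⟩

theorem exists_character_of_mem_polyHull {n : ℕ} {K : Set (Fin n → ℂ)} [CompactSpace K]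
    {z : Fin n → ℂ} (hz : z ∈ polyHull n K) :
    ∃ φ : polyClosure K →ₐ[ℂ] ℂ, ∀ i, φ (polyClosure.coord K i) = z i := by
  set g : MvPolynomial (Fin n) ℂ →ₐ[ℂ] C(K, ℂ) := MvPolynomial.aeval fun i =>
    (⟨fun z => z.1 i, (continuous_apply i).comp continuous_subtype_val⟩ : C(K, ℂ)) with hg
  have hgy (y : K) (p : MvPolynomial (Fin n) ℂ) : g p y = MvPolynomial.eval y.1 p := by
    have : (ContinuousMap.evalAlgHom ℂ ℂ y).comp g = MvPolynomial.aeval y.1 := by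
      ext i
      simp [hg]
    exact DFunLike.congr_fun this p
  obtain ⟨φ, hφ⟩ := AlgHom.exists_extension_topologicalClosure_range g (MvPolynomial.aeval z)
    fun p => by
      refine (hz p).trans (Real.sSup_le ?_ (norm_nonneg _))
      rintro _ ⟨y, hy, rfl⟩
      have := (g p).norm_coe_le_norm ⟨y, hy⟩
      rwa [hgy] at this
  refine ⟨φ, fun i => ?_⟩
  have hgX : g (MvPolynomial.X i) = _ := MvPolynomial.aeval_X _ i
  rw [hφ (MvPolynomial.X i) _ (by rw [hgX]; rfl), MvPolynomial.aeval_X]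

theorem subset_polyHull {n : ℕ} {K : Set (Fin n → ℂ)} (hK : IsCompact K) : K ⊆ polyHull n K :=
  fun z hz p => le_csSup (hK.image_of_continuousOn
    (MvPolynomial.continuous_eval p).norm.continuousOn).bddAbove ⟨z, hz, rfl⟩

theorem propagatesOff_jointSpectrum {Y : Type*} [TopologicalSpace Y] [CompactSpace Y]
    {A : Subalgebra ℂ C(Y, ℂ)} (hA : IsClosed (A : Set C(Y, ℂ))) (x w : A) :
    PropagatesOff (range (x : C(Y, ℂ))) (jointSpectrum x w) := by
  intro U hU hUc hUΓ O₁ O₂ hO₁ hO₂ hd hcov q₀ hq₀ hq₀U hq₀O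
  have : CompleteSpace A := hA.completeSpace_coe
  refine forall_exists_mem_of_kernel (isCompact_jointSpectrum x w) hU hUc ?_ hO₁ hO₂ hd hcov
    hq₀ hq₀U hq₀O
  rintro q ⟨φ, h1, h2⟩ -
  have hu : ∀ z ∈ U, IsUnit ((x : C(Y, ℂ)) - algebraMap ℂ C(Y, ℂ) z) := fun z hz =>
    (ContinuousMap.isUnit_iff_forall_ne_zero _).mpr fun y hy =>
      disjoint_left.mp hUΓ hz ⟨y, sub_eq_zero.mp hy⟩
  obtain ⟨R, hR, hRu⟩ := exists_resolvent_kernel A hA x w hu φ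
  rw [h1, h2] at hRu
  exact ⟨R, hR, hRu⟩

theorem mem_polyHull1_fiber_of_mem_jointSpectrum {Y : Type*} [TopologicalSpace Y] [CompactSpace Y]
    [Nonempty Y] {A : Subalgebra ℂ C(Y, ℂ)} (hA : IsClosed (A : Set C(Y, ℂ))) {x w : A}
    {n : ℂ → ℂ} {r : ℝ} (h : TangentBalls (range (x : C(Y, ℂ))) n r)
    (hc : IsPreconnected (range (x : C(Y, ℂ)))) {q : ℂ × ℂ} (hq : q ∈ jointSpectrum x w)
    (hqΓ : q.1 ∈ range (x : C(Y, ℂ))) :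
    q.2 ∈ polyHull1 {u | ∃ y, (x : C(Y, ℂ)) y = q.1 ∧ (w : C(Y, ℂ)) y = u} := by
  have : CompleteSpace A := hA.completeSpace_coe
  obtain ⟨s, hs, hside⟩ := h.exists_exterior_side
    (isCompact_range (x : C(Y, ℂ)).continuous).isClosed hc
    ((isCompact_jointSpectrum x w).image continuous_fst) ⟨q.1, q, hq, rfl⟩
    (propagatesOff_jointSpectrum hA x w).filledOff
  obtain ⟨φ, h1, h2⟩ := hq
  rw [← h1, ← h2]
  have hball := h.inter_subset q.1 hqΓ r ⟨h.pos, le_rfl⟩ s hs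
  have hdist := h.dist_center hqΓ h.pos.le hs
  refine character_mem_polyHull1_of_peak hA φ (o := q.1 + (s * r : ℝ) * n q.1)
    (isUnit_of_forall_character_ne_zero fun ψ hψ => hside _ hqΓ ⟨(ψ x, ψ w), ⟨ψ, rfl, rfl⟩, ?_⟩)
    fun y hy => ?_
  · rw [map_sub, ψ.commutes] at hψ
    exact sub_eq_zero.mp hψ
  · rw [h1] at hy ⊢
    rw [← dist_eq_norm, ← dist_eq_norm, hdist]
    by_contra! hle
    exact hy (hball ⟨⟨y, rfl⟩, hle⟩)

theorem polyConvex_of_tangentBalls {K : Set (Fin 2 → ℂ)} (hK : IsCompact K) (hKc : IsConnected K)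
    (hsc : SimplyCoconnected 2 K) (hfib : ∀ c : ℂ, PolyConvex1 {w : ℂ | ![c, w] ∈ K})
    {n : ℂ → ℂ} {r : ℝ} (h : TangentBalls ((fun z => z 0) '' K) n r) : PolyConvex 2 K := by
  refine (subset_polyHull hK).antisymm' fun z hz => ?_
  have : CompactSpace K := isCompact_iff_compactSpace.mp hK
  have : Nonempty K := hKc.nonempty.to_subtype
  have hA : IsClosed (polyClosure K : Set C(K, ℂ)) := Subalgebra.isClosed_topologicalClosure _
  have : CompleteSpace (polyClosure K) := hA.completeSpace_coe
  set x := polyClosure.coord K 0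
  set w := polyClosure.coord K 1
  have hvec (z : Fin 2 → ℂ) : ![z 0, z 1] = z := by ext i; fin_cases i <;> rfl
  have hΓ : range (x : C(K, ℂ)) = (fun z => z 0) '' K := by
    rw [image_eq_range]
    rfl
  rw [← hΓ] at h
  have hΓc : IsPreconnected (range (x : C(K, ℂ))) :=
    hΓ ▸ hKc.isPreconnected.image _ (continuous_apply 0).continuousOn
  have hXK : ∀ q ∈ jointSpectrum x w, q.1 ∈ range (x : C(K, ℂ)) → ![q.1, q.2] ∈ K := by
    intro q hq hqΓ
    have := mem_polyHull1_fiber_of_mem_jointSpectrum hA h hΓc hq hqΓ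
    have hS : {u | ∃ y, (x : C(K, ℂ)) y = q.1 ∧ (w : C(K, ℂ)) y = u} =
        {u | ![q.1, u] ∈ K} := by
      ext u
      constructor
      · rintro ⟨y, h1, rfl⟩
        rw [← h1]
        change ![y.1 0, y.1 1] ∈ K
        rw [hvec]
        exact y.2
      · exact fun hu => ⟨⟨_, hu⟩, rfl, rfl⟩
    rw [hS, hfib q.1] at this
    exact this
  set e : (Fin 2 → ℂ) → ℂ × ℂ := fun z => (z 0, z 1)
  have he : Continuous e := by fun_prop
  set i : ℂ × ℂ → (Fin 2 → ℂ) := fun q => ![q.1, q.2]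
  have hi : Continuous i := by fun_prop
  have hiK : MapsTo i (e '' K) K := by
    rintro _ ⟨z, hz, rfl⟩
    exact (hvec z).symm ▸ hz
  have hzX : e z ∈ jointSpectrum x w := by
    obtain ⟨φ, hφ⟩ := exists_character_of_mem_polyHull hz
    exact ⟨φ, hφ 0, hφ 1⟩
  have key := (propagatesOff_jointSpectrum hA x w).fst_image_subset h
    (isCompact_range (x : C(K, ℂ)).continuous) hΓc (isCompact_jointSpectrum x w)
    (hK.image he) (hKc.nonempty.image e) (hKc.isPreconnected.image e he.continuousOn)
    (by rw [hΓ, image_image]) (fun q hq hqΓ => ⟨i q, hXK q hq hqΓ, rfl⟩) (fun a ha => by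
      obtain ⟨ψ, hψ, hψe⟩ := hsc (fun z => z 0 - a) (by fun_prop)
        (fun z hz h0 => ha (hΓ ▸ ⟨z, hz, sub_eq_zero.mp h0⟩))
      refine ⟨ψ ∘ i, hψ.comp hi.continuousOn hiK, fun q hq => (hψe _ (hiK hq)).symm⟩)
  have := hXK _ hzX (key ⟨_, hzX, rfl⟩)
  exact hvec z ▸ this

end PolynomialHulls

/-- Let `h : ℂ → ℝ` be smooth, `E_h := {h = 0}` with `dh ≠ 0`
on `E_h`, and let `K ⊆ E_h × ℂ` be a connected, simply-coconnected compact set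
all of whose fibers `K_c = {w : (c,w) ∈ K}` are polynomially convex. Then `K`
is polynomially convex. -/
theorem compact_in_curve_cross_C_fibers_polyConvex
    (h : ℂ → ℝ) (hsm : ContDiff ℝ (⊤ : ℕ∞) h)
    (Eh : Set ℂ) (hEh : Eh = {z : ℂ | h z = 0})
    (hdh : ∀ z ∈ Eh, fderiv ℝ h z ≠ 0)
    (M : Set (Fin 2 → ℂ)) (hM : M = {z : Fin 2 → ℂ | z 0 ∈ Eh})
    (K : Set (Fin 2 → ℂ)) (hKM : K ⊆ M) (hKcpt : IsCompact K)
    (hKconn : IsConnected K) (hsc : SimplyCoconnected 2 K)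
    (hfib : ∀ c : ℂ, PolyConvex1 {w : ℂ | ![c, w] ∈ K}) :
    PolyConvex 2 K := by
  have hpre : ∀ c ∈ (fun z : Fin 2 → ℂ => z 0) '' K, c ∈ Eh := by
    rintro _ ⟨z, hz, rfl⟩
    have := hKM hz
    rwa [hM] at this
  obtain ⟨n, r, hnr⟩ := exists_tangentBalls (contDiff_infty.mp hsm 2)
    (hKcpt.image (continuous_apply 0)) (fun c hc => by simpa [hEh] using hpre c hc)
    fun c hc => hdh c (hpre c hc)
  exact polyConvex_of_tangentBalls hKcpt hKconn hsc hfib hnr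
end
end

section
/- Fix integers m, n ≥ 2 and let M := { (z₁,z₂) ∈ ℂ² : Re(z₁^m + z₂^n) = 0 }, a singular Levi-flat hypersurface whose singular set is {(0,0)}. A totally real C²-smooth disc K contained in M ∖ {(0,0)} is polynomially convex if and only if (0,0) ∉ K̂. -/
noncomputable section

section

open Set Filter Topology Metric

/-- The hull of `X`, described by bounds instead of suprema. -/
def boundHull {n : ℕ} (X : Set (Fin n → ℂ)) : Set (Fin n → ℂ) :=
  {z | ∀ (p : MvPolynomial (Fin n) ℂ) (C : ℝ),
    (∀ w ∈ X, ‖MvPolynomial.eval w p‖ ≤ C) → ‖MvPolynomial.eval z p‖ ≤ C}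

theorem continuous_norm_eval {n : ℕ} (p : MvPolynomial (Fin n) ℂ) :
    Continuous fun w : Fin n → ℂ ↦ ‖MvPolynomial.eval w p‖ :=
  (MvPolynomial.continuous_eval p).norm

theorem subset_boundHull {n : ℕ} (X : Set (Fin n → ℂ)) : X ⊆ boundHull X :=
  fun z hz _ _ h ↦ h z hz

theorem boundHull_mono {n : ℕ} {X Y : Set (Fin n → ℂ)} (h : X ⊆ Y) : boundHull X ⊆ boundHull Y :=
  fun _ hz p C hC ↦ hz p C fun w hw ↦ hC w (h hw)

theorem isClosed_boundHull {n : ℕ} (X : Set (Fin n → ℂ)) : IsClosed (boundHull X) := by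
  simp only [boundHull, ofPred_forall]
  exact isClosed_iInter fun p ↦ isClosed_iInter fun C ↦ isClosed_iInter fun _ ↦
    isClosed_le (continuous_norm_eval p) continuous_const

theorem isCompact_boundHull {n : ℕ} {X : Set (Fin n → ℂ)} (hX : IsCompact X) :
    IsCompact (boundHull X) := by
  obtain ⟨C, hC⟩ := hX.isBounded.exists_norm_le
  refine isCompact_of_isClosed_isBounded (isClosed_boundHull X)
    (isBounded_iff_forall_norm_le.2 ⟨|C|, fun z hz ↦ ?_⟩)
  refine (pi_norm_le_iff_of_nonneg (abs_nonneg C)).2 fun i ↦ ?_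
  simpa using hz (MvPolynomial.X i) |C| fun w hw ↦ by
    simpa using (norm_le_pi_norm w i).trans ((hC w hw).trans (le_abs_self C))

theorem polyHull_eq_boundHull {n : ℕ} {K : Set (Fin n → ℂ)} (hK : IsCompact K) (hne : K.Nonempty) :
    polyHull n K = boundHull K := by
  ext z
  refine ⟨fun hz p C hC ↦ (hz p).trans (csSup_le (hne.image _) ?_), fun hz p ↦ hz p _ fun w hw ↦ ?_⟩
  · rintro _ ⟨w, hw, rfl⟩
    exact hC w hw
  · exact le_csSup (hK.image (continuous_norm_eval p)).bddAbove (mem_image_of_mem _ hw)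

theorem eval_eq_of_mem_boundHull {n : ℕ} {X : Set (Fin n → ℂ)} {z : Fin n → ℂ}
    {p : MvPolynomial (Fin n) ℂ} {c : ℂ} (hX : ∀ w ∈ X, MvPolynomial.eval w p = c)
    (hz : z ∈ boundHull X) : MvPolynomial.eval z p = c := by
  have := hz (p - MvPolynomial.C c) 0 fun w hw ↦ by simp [hX w hw]
  simpa [sub_eq_zero] using this

theorem re_eval_eq_zero_of_mem_boundHull {n : ℕ} {K : Set (Fin n → ℂ)} (hK : IsCompact K)
    {p : MvPolynomial (Fin n) ℂ} (hp : ∀ w ∈ K, (MvPolynomial.eval w p).re = 0)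
    {z : Fin n → ℂ} (hz : z ∈ boundHull K) : (MvPolynomial.eval z p).re = 0 := by
  set a := (MvPolynomial.eval z p).re with ha
  set b := (MvPolynomial.eval z p).im with hb
  obtain ⟨A, hA⟩ := hK.exists_bound_of_continuousOn
    (f := fun w ↦ (MvPolynomial.eval w p).im - b)
    (Complex.continuous_im.comp (MvPolynomial.continuous_eval p) |>.sub
      continuous_const).continuousOn
  have key : ∀ R : ℝ, a ^ 2 + 2 * a * R ≤ A ^ 2 := fun R ↦ by
    have h := hz (p + MvPolynomial.C (⟨R, -b⟩ : ℂ)) (√(A ^ 2 + R ^ 2)) fun w hw ↦ by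
      refine Real.le_sqrt_of_sq_le ?_
      rw [← Complex.normSq_eq_norm_sq, Complex.normSq_apply]
      have := hA w hw
      rw [Real.norm_eq_abs] at this
      have := sq_le_sq' (by linarith [abs_le.1 this]) (abs_le.1 this).2
      simp [hp w hw]
      nlinarith
    rw [Real.le_sqrt (norm_nonneg _) (by positivity), ← Complex.normSq_eq_norm_sq,
      Complex.normSq_apply] at h
    simp [← ha, ← hb] at h
    nlinarith
  by_contra hne
  have := key ((A ^ 2 + 1) / (2 * a))
  rw [mul_div_cancel₀ _ (by simpa using hne)] at this
  nlinarith [sq_nonneg a]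

theorem mem_boundHull_fiber {n : ℕ} {K : Set (Fin n → ℂ)} (hK : IsCompact K)
    {p : MvPolynomial (Fin n) ℂ} (hp : ∀ w ∈ K, (MvPolynomial.eval w p).re = 0)
    {z : Fin n → ℂ} (hz : z ∈ boundHull K) :
    z ∈ boundHull (K ∩ {w | MvPolynomial.eval w p = MvPolynomial.eval z p}) := by
  have hre := re_eval_eq_zero_of_mem_boundHull hK hp hz
  set c := MvPolynomial.eval z p with hc
  have hpc : ∀ w ∈ K, MvPolynomial.eval w p - c =
      ((MvPolynomial.eval w p - c).im : ℂ) * Complex.I := fun w hw ↦ by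
    apply Complex.ext <;> simp [hp w hw, hre]
  obtain ⟨B, hB⟩ := hK.exists_bound_of_continuousOn
    (f := fun w ↦ MvPolynomial.eval w p - c)
    ((MvPolynomial.continuous_eval p).sub continuous_const).continuousOn
  set B' : ℝ := B ^ 2 + 1
  have hB' : 0 < B' := by positivity
  let g : MvPolynomial (Fin n) ℂ :=
    1 + MvPolynomial.C ((B' : ℂ)⁻¹) * (p - MvPolynomial.C c) ^ 2
  have hg : ∀ w ∈ K, MvPolynomial.eval w g =
      ((1 - (MvPolynomial.eval w p - c).im ^ 2 / B' : ℝ) : ℂ) := fun w hw ↦ by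
    simp only [g, map_add, map_one, map_mul, MvPolynomial.eval_C, map_pow, map_sub]
    rw [hpc w hw, mul_pow, Complex.I_sq]
    push_cast
    simp
    ring
  have hsq : ∀ w ∈ K, (MvPolynomial.eval w p - c).im ^ 2 / B' ≤ 1 := fun w hw ↦ by
    rw [div_le_one hB']
    have h1 := (Complex.abs_im_le_norm _).trans (hB w hw)
    have := sq_le_sq' (by linarith [abs_le.1 h1]) (abs_le.1 h1).2
    linarith
  have hgn : ∀ w ∈ K, ‖MvPolynomial.eval w g‖ = 1 - (MvPolynomial.eval w p - c).im ^ 2 / B' :=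
    fun w hw ↦ by
      rw [hg w hw, Complex.norm_real, Real.norm_eq_abs, abs_of_nonneg]
      linarith [hsq w hw]
  have hg1 : ∀ w ∈ K, ‖MvPolynomial.eval w g‖ ≤ 1 := fun w hw ↦ by
    rw [hgn w hw]
    have : 0 ≤ (MvPolynomial.eval w p - c).im ^ 2 / B' := by positivity
    linarith
  have hgz : MvPolynomial.eval z g = 1 := by simp [g, ← hc]
  have main : ∀ (q : MvPolynomial (Fin n) ℂ) (C : ℝ), 0 ≤ C →
      (∀ w ∈ K ∩ {w | MvPolynomial.eval w p = c}, ‖MvPolynomial.eval w q‖ ≤ C) →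
      ‖MvPolynomial.eval z q‖ ≤ C := by
    intro q C hC0 hC
    refine le_of_forall_pos_le_add fun ε hε ↦ ?_
    have hK1 : IsCompact (K ∩ {w | C + ε ≤ ‖MvPolynomial.eval w q‖}) :=
      hK.inter_right (isClosed_le continuous_const (continuous_norm_eval q))
    obtain ⟨θ, hθ, hθK⟩ : ∃ θ > 0, ∀ w ∈ K ∩ {w | C + ε ≤ ‖MvPolynomial.eval w q‖},
        θ ≤ 1 - ‖MvPolynomial.eval w g‖ := by
      refine hK1.exists_forall_le' (f := fun w ↦ 1 - ‖MvPolynomial.eval w g‖)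
        (continuous_const.sub (continuous_norm_eval g)).continuousOn fun w hw ↦ ?_
      have hne : MvPolynomial.eval w p - c ≠ 0 := fun h ↦ by
        have h1 := hC w ⟨hw.1, sub_eq_zero.1 h⟩
        have h2 : C + ε ≤ _ := hw.2
        linarith
      have him : (MvPolynomial.eval w p - c).im ≠ 0 := fun h ↦ hne (by rw [hpc w hw.1, h]; simp)
      rw [hgn w hw.1]
      have : 0 < (MvPolynomial.eval w p - c).im ^ 2 / B' := by positivity
      linarith
    obtain ⟨D, hD⟩ := hK.exists_bound_of_continuousOn
      (f := fun w ↦ MvPolynomial.eval w q) (MvPolynomial.continuous_eval q).continuousOn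
    set θ' := max (1 - θ) 0
    have hθ'1 : θ' < 1 := max_lt (by linarith) one_pos
    have hθ'0 : 0 ≤ θ' := le_max_right _ _
    obtain ⟨N, hN⟩ := exists_pow_lt_of_lt_one (by positivity : 0 < (C + ε) / (|D| + 1)) hθ'1
    rw [lt_div_iff₀ (by positivity)] at hN
    have h := hz (q * g ^ N) (C + ε) fun w hw ↦ by
      rw [map_mul, map_pow, norm_mul, norm_pow]
      by_cases hw1 : C + ε ≤ ‖MvPolynomial.eval w q‖
      · have h1 : ‖MvPolynomial.eval w g‖ ≤ θ' :=
          le_trans (by linarith [hθK w ⟨hw, hw1⟩]) (le_max_left _ _)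
        have h2 : ‖MvPolynomial.eval w q‖ ≤ |D| + 1 := by
          linarith [hD w hw, le_abs_self D]
        calc _ ≤ (|D| + 1) * θ' ^ N := by gcongr
          _ ≤ C + ε := by linarith
      · calc _ ≤ (C + ε) * 1 ^ N := by
              gcongr
              · exact (not_le.1 hw1).le
              · exact hg1 w hw
          _ = C + ε := by simp
    simpa [hgz] using h
  intro q C hC
  rcases le_or_gt 0 C with h0 | h0
  · exact main q C h0 hC
  · have hemp : ∀ w, w ∉ K ∩ {w | MvPolynomial.eval w p = c} := fun w hw ↦
      absurd (hC w hw) (not_le.2 (h0.trans_le (norm_nonneg _)))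
    have := main 1 0 le_rfl fun w hw ↦ absurd hw (hemp w)
    norm_num at this

theorem exists_algHom_of_ne_top {A : Type*} [NormedCommRing A] [NormedAlgebra ℂ A]
    [CompleteSpace A] {I : Ideal A} (hI : I ≠ ⊤) :
    ∃ χ : A →ₐ[ℂ] ℂ, (∀ f ∈ I, χ f = 0) ∧ ∀ f, ‖χ f‖ ≤ ‖f‖ * ‖(1 : A)‖ := by
  obtain ⟨M, hM, hIM⟩ := Ideal.exists_le_maximal I hI
  exact ⟨WeakDual.CharacterSpace.equivAlgHom M.toCharacterSpace,
    fun f hf ↦ Ideal.toCharacterSpace_apply_eq_zero_of_mem M (hIM hf),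
    fun f ↦ AlgHom.norm_apply_le_self_mul_norm_one _ f⟩

theorem exists_approx_bezout_of_notMem_boundHull {n : ℕ} {X : Set (Fin n → ℂ)} (hX : IsCompact X)
    {ζ : Fin n → ℂ} (hζ : ζ ∉ boundHull X) {ε : ℝ} (hε : 0 < ε) :
    ∃ a : Fin n → MvPolynomial (Fin n) ℂ, ∀ w ∈ X,
      ‖∑ i, MvPolynomial.eval w (a i) * (w i - ζ i) - 1‖ ≤ ε := by
  rcases X.eq_empty_or_nonempty with rfl | hne
  · exact ⟨0, by simp⟩
  have : CompactSpace X := isCompact_iff_compactSpace.1 hX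
  have : Nonempty X := hne.to_subtype
  let Φ : MvPolynomial (Fin n) ℂ →ₐ[ℂ] C(X, ℂ) :=
    MvPolynomial.aeval fun i ↦ ⟨fun w : X ↦ w.1 i, (continuous_apply i).comp continuous_subtype_val⟩
  have hΦ : ∀ p (w : X), Φ p w = MvPolynomial.eval w.1 p := fun p w ↦ by
    have : ((ContinuousMap.evalAlgHom ℂ ℂ w).comp Φ) = MvPolynomial.aeval w.1 := by
      ext i; simp [Φ]
    exact DFunLike.congr_fun this p
  let A : Subalgebra ℂ C(X, ℂ) := Φ.range.topologicalClosure
  have hcl : IsClosed (A : Set C(X, ℂ)) := Subalgebra.isClosed_topologicalClosure _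
  have : CompleteSpace A := hcl.completeSpace_coe
  let Ψ : MvPolynomial (Fin n) ℂ →ₐ[ℂ] A :=
    Φ.codRestrict A fun p ↦ Subalgebra.le_topologicalClosure _ ⟨p, rfl⟩
  have hΨ : ∀ p, (Ψ p : C(X, ℂ)) = Φ p := fun p ↦ rfl
  let I : Ideal A := Ideal.span (range fun i ↦ Ψ (MvPolynomial.X i - MvPolynomial.C (ζ i)))
  have hI : I = ⊤ := by
    by_contra hI
    obtain ⟨χ, hχI, hχn⟩ := exists_algHom_of_ne_top hI
    refine hζ fun p C hC ↦ ?_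
    have hχX : ∀ i, χ (Ψ (MvPolynomial.X i)) = ζ i := fun i ↦ by
      have h : χ (Ψ (MvPolynomial.X i - MvPolynomial.C (ζ i))) = 0 :=
        hχI _ (Ideal.subset_span ⟨i, rfl⟩)
      rw [map_sub, map_sub, sub_eq_zero] at h
      rw [h]
      exact (χ.comp Ψ).commutes (ζ i)
    have hχp : χ (Ψ p) = MvPolynomial.eval ζ p := by
      have : χ.comp Ψ = MvPolynomial.aeval ζ := by
        ext i
        simpa using hχX i
      exact DFunLike.congr_fun this p
    have h1 : ‖χ (Ψ p)‖ ≤ ‖Ψ p‖ := by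
      have h := hχn (Ψ p)
      rwa [show ‖(1 : A)‖ = 1 from norm_one (α := C(X, ℂ)), mul_one] at h
    rw [hχp] at h1
    refine h1.trans ?_
    change ‖Φ p‖ ≤ C
    refine (ContinuousMap.norm_le_of_nonempty (Φ p)).2 fun w ↦ ?_
    rw [hΦ]
    exact hC w w.2
  obtain ⟨c, hc⟩ := Ideal.mem_span_range_iff_exists_fun.1 (hI ▸ Submodule.mem_top : (1 : A) ∈ I)
  obtain ⟨B, hB⟩ := (hX.exists_bound_of_continuousOn (f := fun w ↦ w - ζ)
    (continuous_id.sub continuous_const).continuousOn)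
  set δ := ε / ((n + 1) * (|B| + 1)) with hδ
  have hδ0 : 0 < δ := by positivity
  have happ : ∀ i, ∃ p, ‖(c i : C(X, ℂ)) - Φ p‖ < δ := fun i ↦ by
    obtain ⟨_, ⟨p, rfl⟩, hp⟩ := Metric.mem_closure_iff.1 (c i).2 δ hδ0
    exact ⟨p, by simpa [dist_eq_norm] using hp⟩
  choose a ha using happ
  refine ⟨a, fun w hw ↦ ?_⟩
  have hcw : ∑ i, (c i : C(X, ℂ)) ⟨w, hw⟩ * (w i - ζ i) = 1 := by
    have := congrArg (fun f : A ↦ (f : C(X, ℂ)) ⟨w, hw⟩) hc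
    have hev : ∀ i, MvPolynomial.eval w (MvPolynomial.X i - MvPolynomial.C (ζ i)) = w i - ζ i :=
      fun i ↦ by simp
    simpa [hΨ, hΦ, -map_sub, hev, ContinuousMap.sum_apply] using this
  rw [← hcw, ← Finset.sum_sub_distrib]
  have hterm : ∀ i, ‖MvPolynomial.eval w (a i) * (w i - ζ i) -
      (c i : C(X, ℂ)) ⟨w, hw⟩ * (w i - ζ i)‖ ≤ δ * (|B| + 1) := fun i ↦ by
    rw [← sub_mul, norm_mul]
    gcongr
    · rw [norm_sub_rev, ← hΦ (a i) ⟨w, hw⟩]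
      exact (ContinuousMap.norm_coe_le_norm ((c i : C(X, ℂ)) - Φ (a i)) ⟨w, hw⟩).trans (ha i).le
    · exact (norm_le_pi_norm (w - ζ) i).trans ((hB w hw).trans (by linarith [le_abs_self B]))
  calc _ ≤ ∑ i : Fin n, δ * (|B| + 1) := norm_sum_le_of_le _ fun i _ ↦ hterm i
    _ = n * (ε / (n + 1)) := by
      rw [Finset.sum_const, Finset.card_univ, Fintype.card_fin, nsmul_eq_mul, hδ]
      field_simp
    _ ≤ ε := by
      rw [mul_div_assoc', div_le_iff₀ (by positivity)]
      nlinarith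

theorem eventually_norm_le_of_notMem_boundHull {X : Set (Fin 2 → ℂ)} (hX : IsCompact X)
    {i j : Fin 2} (hij : i ≠ j) {a b : ℕ} {c : ℂ} (hXc : ∀ w ∈ X, w i ^ a + w j ^ b = c)
    {ζ : Fin 2 → ℂ} (hζX : ζ ∉ X) (hζ : ζ ∈ boundHull X) {δ : ℝ} (hδ : 0 < δ) :
    ∀ᶠ η in 𝓝 ζ, η i ^ a + η j ^ b = c → η ∉ boundHull X → ‖a * ζ i ^ (a - 1)‖ ≤ δ := by
  let Q : Fin 2 → ℕ → (Fin 2 → ℂ) → (Fin 2 → ℂ) → ℂ := fun k e η z ↦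
    ∑ s ∈ Finset.range e, z k ^ s * η k ^ (e - 1 - s)
  have hQ : ∀ k e η z, Q k e η z * (z k - η k) = z k ^ e - η k ^ e := fun k e η z ↦
    (Commute.all (z k) (η k)).geom_sum₂_mul e
  have hQc : ∀ k e, Continuous fun q : (Fin 2 → ℂ) × (Fin 2 → ℂ) ↦ Q k e q.1 q.2 := fun k e ↦ by
    simp only [Q]; fun_prop
  have hQu : ∀ k e ε, 0 < ε → ∀ᶠ η in 𝓝 ζ, ∀ z ∈ X, ‖Q k e η z - Q k e ζ z‖ < ε := by
    intro k e ε hε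
    refine hX.eventually_forall_of_forall_eventually fun z _ ↦ ?_
    have h1 : Continuous fun q : (Fin 2 → ℂ) × (Fin 2 → ℂ) ↦ ‖Q k e q.1 q.2 - Q k e ζ q.2‖ :=
      ((hQc k e).sub ((hQc k e).comp (continuous_const.prodMk continuous_snd))).norm
    exact h1.continuousAt.eventually_lt continuousAt_const (by simpa using hε)
  have hQb : ∀ k e, ∃ B, ∀ z ∈ X, ‖Q k e ζ z‖ ≤ B := fun k e ↦
    hX.exists_bound_of_continuousOn
      ((hQc k e).comp (continuous_const.prodMk continuous_id)).continuousOn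
  obtain ⟨B₁, hB₁⟩ := hQb i a
  obtain ⟨B₂, hB₂⟩ := hQb j b
  set M := |B₁| + |B₂| + 1
  have hM : 0 < M := by positivity
  obtain ⟨d, hd, hdX⟩ : ∃ d > 0, ball ζ d ⊆ Xᶜ :=
    Metric.isOpen_iff.1 hX.isClosed.isOpen_compl ζ hζX
  set ε := min 1 (δ / (4 * M / d + M + 1)) with hεdef
  have hε : 0 < ε := by positivity
  have hε1 : ε ≤ 1 := min_le_left _ _
  have hεδ : ε * (4 * M / d) + ε * M + ε ≤ δ := by
    have : ε ≤ δ / (4 * M / d + M + 1) := min_le_right _ _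
    rw [le_div_iff₀ (by positivity)] at this
    linarith
  filter_upwards [hQu i a ε hε, hQu i a 1 one_pos, hQu j b 1 one_pos,
    ball_mem_nhds ζ (half_pos hd), ball_mem_nhds ζ hε] with η h1 h2 h3 h4 h5 hηc hη
  obtain ⟨g, hg⟩ := exists_approx_bezout_of_notMem_boundHull hX hη hε
  let P : Fin 2 → ℕ → MvPolynomial (Fin 2) ℂ := fun k e ↦
    ∑ s ∈ Finset.range e, MvPolynomial.X k ^ s * MvPolynomial.C (η k ^ (e - 1 - s))
  let P' : MvPolynomial (Fin 2) ℂ :=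
    ∑ s ∈ Finset.range a, MvPolynomial.X i ^ s * MvPolynomial.C (ζ i ^ (a - 1 - s))
  have hP : ∀ k e z, MvPolynomial.eval z (P k e) = Q k e η z := fun k e z ↦ by simp [P, Q]
  have hP' : ∀ z, MvPolynomial.eval z P' = Q i a ζ z := fun z ↦ by simp [P', Q]
  let k : MvPolynomial (Fin 2) ℂ := g j * P i a - g i * P j b
  have hQM₁ : ∀ z ∈ X, ‖Q i a η z‖ ≤ M := fun z hz ↦ by
    have := norm_le_norm_add_norm_sub' (Q i a η z) (Q i a ζ z)
    linarith [h2 z hz, hB₁ z hz, le_abs_self B₁, abs_nonneg B₂]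
  have hQM₂ : ∀ z ∈ X, ‖Q j b η z‖ ≤ M := fun z hz ↦ by
    have := norm_le_norm_add_norm_sub' (Q j b η z) (Q j b ζ z)
    linarith [h3 z hz, hB₂ z hz, le_abs_self B₂, abs_nonneg B₁]
  have hsum : ∀ z : Fin 2 → ℂ, ∑ l, MvPolynomial.eval z (g l) * (z l - η l) =
      MvPolynomial.eval z (g i) * (z i - η i) + MvPolynomial.eval z (g j) * (z j - η j) := fun z ↦
    Fintype.sum_eq_add i j hij fun x hx ↦ by omega
  have hT : ∀ z ∈ X, ∃ e : ℂ, ‖e‖ ≤ ε ∧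
      (z j - η j) * MvPolynomial.eval z k = Q i a η z * (1 + e) ∧
      (z i - η i) * MvPolynomial.eval z k = -(Q j b η z * (1 + e)) := by
    intro z hz
    refine ⟨_, hg z hz, ?_, ?_⟩ <;>
    · rw [hsum]
      simp only [k, map_sub, map_mul, hP]
      have e1 := hQ i a η z
      have e2 := hQ j b η z
      have e3 := hXc z hz
      grind
  have hkb : ∀ z ∈ X, ‖MvPolynomial.eval z k‖ ≤ 4 * M / d := by
    intro z hz
    obtain ⟨e, he, hz1, hz2⟩ := hT z hz
    have he2 : ‖1 + e‖ ≤ 2 := (norm_add_le _ _).trans (by simp; linarith)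
    have hzη : d / 2 ≤ ‖z - η‖ := by
      by_contra! h
      refine hdX (mem_ball.2 ?_) hz
      calc dist z ζ ≤ dist z η + dist η ζ := dist_triangle _ _ _
        _ < d / 2 + d / 2 := add_lt_add (by rwa [dist_eq_norm]) h4
        _ = d := add_halves d
    have hbd : ∀ l, ‖z l - η l‖ * ‖MvPolynomial.eval z k‖ ≤ 2 * M := by
      intro l
      rw [← norm_mul]
      rcases (by omega : l = i ∨ l = j) with rfl | rfl
      · rw [hz2, norm_neg, norm_mul]
        calc _ ≤ M * 2 := by gcongr; exact hQM₂ z hz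
          _ = 2 * M := mul_comm _ _
      · rw [hz1, norm_mul]
        calc _ ≤ M * 2 := by gcongr; exact hQM₁ z hz
          _ = 2 * M := mul_comm _ _
    obtain ⟨l, hl⟩ : ∃ l, d / 2 ≤ ‖z l - η l‖ := by
      by_contra! h
      exact hzη.not_gt ((pi_norm_lt_iff (by positivity)).2 h)
    rw [le_div_iff₀ hd]
    nlinarith [hbd l, norm_nonneg (MvPolynomial.eval z k)]
  have hfin := hζ ((MvPolynomial.X j - MvPolynomial.C (ζ j)) * k - P') δ fun z hz ↦ by
    obtain ⟨e, he, hz1, -⟩ := hT z hz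
    have : MvPolynomial.eval z ((MvPolynomial.X j - MvPolynomial.C (ζ j)) * k - P') =
        (η j - ζ j) * MvPolynomial.eval z k + Q i a η z * e + (Q i a η z - Q i a ζ z) := by
      simp only [map_sub, map_mul, MvPolynomial.eval_X, MvPolynomial.eval_C, hP'] at hz1 ⊢
      linear_combination hz1
    rw [this]
    refine (norm_add₃_le).trans ?_
    rw [norm_mul, norm_mul]
    have hηζ : ‖η j - ζ j‖ ≤ ε :=
      (norm_le_pi_norm (η - ζ) j).trans (by rw [← dist_eq_norm]; exact h5.le)
    calc _ ≤ ε * (4 * M / d) + M * ε + ε := by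
          gcongr
          · exact hkb z hz
          · exact hQM₁ z hz
          · exact (h1 z hz).le
      _ ≤ δ := by linarith
  have hQζ : Q i a ζ ζ = a * ζ i ^ (a - 1) := by
    simp only [Q]
    exact geom_sum₂_self _ _
  simpa [hP', hQζ] using hfin

theorem eventually_mem_boundHull {X : Set (Fin 2 → ℂ)} (hX : IsCompact X)
    {a b : ℕ} (ha : a ≠ 0) (hb : b ≠ 0) {c : ℂ} (hXc : ∀ w ∈ X, w 0 ^ a + w 1 ^ b = c)
    {ζ : Fin 2 → ℂ} (hζ0 : ζ ≠ 0) (hζX : ζ ∉ X) (hζ : ζ ∈ boundHull X) :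
    ∀ᶠ η in 𝓝 ζ, η 0 ^ a + η 1 ^ b = c → η ∈ boundHull X := by
  have key : ∀ (i j : Fin 2) (a b : ℕ), i ≠ j → a ≠ 0 → (∀ w ∈ X, w i ^ a + w j ^ b = c) →
      ζ i ≠ 0 → ∀ᶠ η in 𝓝 ζ, η i ^ a + η j ^ b = c → η ∈ boundHull X := by
    intro i j a b hij ha hXc hi
    have hpos : 0 < ‖a * ζ i ^ (a - 1)‖ := norm_pos_iff.2 (by positivity)
    filter_upwards [eventually_norm_le_of_notMem_boundHull hX hij hXc hζX hζ (half_pos hpos)]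
      with η hη hc
    by_contra h
    linarith [hη hc h]
  by_cases h0 : ζ 0 = 0
  · have h1 : ζ 1 ≠ 0 := fun h1 ↦ hζ0 (by ext l; fin_cases l <;> simp [h0, h1])
    filter_upwards [key 1 0 b a (by decide) hb (fun w hw ↦ by rw [add_comm, hXc w hw]) h1]
      with η hη h
    exact hη (by rw [add_comm, h])
  · exact key 0 1 a b (by decide) ha hXc h0

theorem nonpos_of_hasFDerivAt_smul_of_eq_zero {E : Type*} [NormedAddCommGroup E] [NormedSpace ℝ E]
    [FiniteDimensional ℝ E] {τ f l : E → ℝ} {R : ℝ}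
    (hτ : ∀ x ∈ closedBall (0 : E) R, ContDiffAt ℝ 1 τ x)
    (hcrit : ∀ x ∈ closedBall (0 : E) R, fderiv ℝ τ x ≠ 0)
    (hl : ∀ x, 0 ≤ l x) (hf : ∀ x, HasFDerivAt f (l x • fderiv ℝ τ x) x)
    (hf0 : ∀ x, R < ‖x‖ → f x = 0) (x : E) : f x ≤ 0 := by
  by_contra! hx
  have hfc : Continuous f := continuous_iff_continuousAt.2 fun x ↦ (hf x).continuousAt
  have hxR : x ∈ closedBall (0 : E) R := by
    by_contra h
    exact hx.ne' (hf0 x (by simpa using h))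
  obtain ⟨x₁, hx₁, hmax⟩ := (isCompact_closedBall (0 : E) R).exists_isMaxOn ⟨x, hxR⟩
    hfc.continuousOn
  have hpos : 0 < f x₁ := hx.trans_le (hmax hxR)
  have hglob : ∀ y, f y ≤ f x₁ := fun y ↦ by
    by_cases hy : y ∈ closedBall (0 : E) R
    · exact hmax hy
    · rw [hf0 y (by simpa using hy)]; exact hpos.le
  have hZ : IsCompact (closedBall (0 : E) R ∩ f ⁻¹' {f x₁}) :=
    (isCompact_closedBall (0 : E) R).inter_right (isClosed_singleton.preimage hfc)
  have hτc : ContinuousOn τ (closedBall (0 : E) R) := fun y hy ↦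
    (hτ y hy).continuousAt.continuousWithinAt
  obtain ⟨q, ⟨hqR, hqf⟩, hq⟩ := hZ.exists_isMaxOn ⟨x₁, hx₁, rfl⟩ (hτc.mono inter_subset_left)
  obtain ⟨v, hv⟩ : ∃ v, 0 < fderiv ℝ τ q v := by
    obtain ⟨v, hv⟩ := DFunLike.ne_iff.1 (hcrit q hqR)
    rcases lt_or_gt_of_ne hv with h | h
    · exact ⟨-v, by simpa using h⟩
    · exact ⟨v, by simpa using h⟩
  have hcont : ContinuousAt (fun y ↦ fderiv ℝ τ y v) q :=
    ((hτ q hqR).continuousAt_fderiv (by norm_num)).clm_apply continuousAt_const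
  have hev : ∀ᶠ y in 𝓝 q, 0 < fderiv ℝ τ y v ∧ DifferentiableAt ℝ τ y :=
    (hcont.eventually (lt_mem_nhds hv)).and
      (((hτ q hqR).eventually (by simp)).mono fun y hy ↦ hy.differentiableAt (by norm_num))
  have hline : Tendsto (fun s : ℝ ↦ q + s • v) (𝓝 0) (𝓝 q) := by
    have : Continuous fun s : ℝ ↦ q + s • v := by fun_prop
    simpa using this.tendsto 0
  obtain ⟨δ, hδ, hball⟩ := Metric.eventually_nhds_iff_ball.1 (hline.eventually hev)
  have hder : ∀ s : ℝ, HasDerivAt (fun s : ℝ ↦ q + s • v) v s := fun s ↦ by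
    simpa using ((hasDerivAt_id s).smul_const v).const_add q
  have hs : ∀ s ∈ Icc (0 : ℝ) (δ / 2), s ∈ ball (0 : ℝ) δ := fun s hs ↦ by
    rw [mem_ball_zero_iff, Real.norm_eq_abs, abs_of_nonneg hs.1]; linarith [hs.2]
  have hfm : MonotoneOn (fun s : ℝ ↦ f (q + s • v)) (Icc 0 (δ / 2)) := by
    have hd : ∀ s : ℝ, HasDerivAt (fun s : ℝ ↦ f (q + s • v))
        ((l (q + s • v) • fderiv ℝ τ (q + s • v)) v) s := fun s ↦
      (hf _).comp_hasDerivAt s (hder s)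
    refine monotoneOn_of_deriv_nonneg (convex_Icc _ _)
      (fun s _ ↦ (hd s).continuousAt.continuousWithinAt)
      (fun s _ ↦ (hd s).differentiableAt.differentiableWithinAt) fun s hs' ↦ ?_
    rw [(hd s).deriv]
    exact mul_nonneg (hl _) (hball s (hs s (interior_subset hs'))).1.le
  have hτm : StrictMonoOn (fun s : ℝ ↦ τ (q + s • v)) (Icc 0 (δ / 2)) := by
    have hd : ∀ s ∈ Icc (0 : ℝ) (δ / 2), HasDerivAt (fun s : ℝ ↦ τ (q + s • v))
        (fderiv ℝ τ (q + s • v) v) s := fun s h ↦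
      (hball s (hs s h)).2.hasFDerivAt.comp_hasDerivAt s (hder s)
    refine strictMonoOn_of_deriv_pos (convex_Icc _ _)
      (fun s h ↦ (hd s h).continuousAt.continuousWithinAt) fun s h ↦ ?_
    rw [(hd s (interior_subset h)).deriv]
    exact (hball s (hs s (interior_subset h))).1
  have h0 : (0 : ℝ) ∈ Icc (0 : ℝ) (δ / 2) := ⟨le_rfl, by positivity⟩
  have h1 : δ / 2 ∈ Icc (0 : ℝ) (δ / 2) := ⟨by positivity, le_rfl⟩
  have hfq : f (q + (δ / 2) • v) = f x₁ :=
    le_antisymm (hglob _) (by simpa [show f q = f x₁ from hqf] using hfm h0 h1 h0.2)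
  have hR : q + (δ / 2) • v ∈ closedBall (0 : E) R := by
    by_contra h
    rw [hf0 _ (by simpa using h)] at hfq
    exact hpos.ne hfq
  have h2 : τ (q + (δ / 2) • v) ≤ τ q := hq ⟨hR, hfq⟩
  have h3 : τ q < τ (q + (δ / 2) • v) := by simpa using hτm h0 h1 (by positivity : 0 < δ / 2)
  linarith

theorem exists_eq_const_of_fderiv_eq_zero_off_closedBall {f : ℝ × ℝ → ℝ} {R : ℝ}
    (hf : Differentiable ℝ f) (h0 : ∀ x, R < ‖x‖ → fderiv ℝ f x = 0) :
    ∃ c, ∀ x, R < ‖x‖ → f x = c := by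
  have key : ∀ s : Set (ℝ × ℝ), IsOpen s → Convex ℝ s → (∀ x ∈ s, R < ‖x‖) →
      ∀ x ∈ s, ∀ y ∈ s, f x = f y := fun s hs hc hR x hx y hy ↦
    hs.is_const_of_fderiv_eq_zero hc.isPreconnected hf.differentiableOn
      (fun z hz ↦ h0 z (hR z hz)) hx hy
  set S : ℝ := |R| + 1
  have hS : R < S := lt_of_le_of_lt (le_abs_self R) (by simp [S])
  have hS0 : 0 < S := by positivity
  have hRx : ∀ x : ℝ × ℝ, (R < x.1 ∨ R < -x.1 ∨ R < x.2 ∨ R < -x.2) → R < ‖x‖ := by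
    intro x hx
    rw [Prod.norm_def, lt_max_iff, Real.norm_eq_abs, Real.norm_eq_abs, lt_abs, lt_abs]
    tauto
  have key1 := key {x | R < x.1} (isOpen_lt continuous_const continuous_fst)
    (convex_halfSpace_gt (LinearMap.fst ℝ ℝ ℝ).isLinear R) (fun x hx ↦ hRx x (Or.inl hx))
  have key2 := key {x | R < -x.1} (isOpen_lt continuous_const continuous_fst.neg)
    (convex_halfSpace_gt (-LinearMap.fst ℝ ℝ ℝ).isLinear R)
    (fun x hx ↦ hRx x (Or.inr (Or.inl hx)))
  have key3 := key {x | R < x.2} (isOpen_lt continuous_const continuous_snd)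
    (convex_halfSpace_gt (LinearMap.snd ℝ ℝ ℝ).isLinear R)
    (fun x hx ↦ hRx x (Or.inr (Or.inr (Or.inl hx))))
  have key4 := key {x | R < -x.2} (isOpen_lt continuous_const continuous_snd.neg)
    (convex_halfSpace_gt (-LinearMap.snd ℝ ℝ ℝ).isLinear R)
    (fun x hx ↦ hRx x (Or.inr (Or.inr (Or.inr hx))))
  have h13 : ∀ x : ℝ × ℝ, R < x.1 → f x = f (S, S) := fun x hx ↦ key1 x hx (S, S) hS
  have h3 : ∀ x : ℝ × ℝ, R < x.2 → f x = f (S, S) := fun x hx ↦ key3 x hx (S, S) hS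
  have h4 : ∀ x : ℝ × ℝ, R < -x.2 → f x = f (S, S) := fun x hx ↦
    (key4 x hx (S, -S) (by simpa using hS)).trans (h13 _ hS)
  have h2 : ∀ x : ℝ × ℝ, R < -x.1 → f x = f (S, S) := fun x hx ↦
    (key2 x hx (-S, S) (by simpa using hS)).trans (h3 _ hS)
  refine ⟨f (S, S), fun x hx ↦ ?_⟩
  rw [Prod.norm_def, lt_max_iff, Real.norm_eq_abs, Real.norm_eq_abs, lt_abs, lt_abs] at hx
  rcases hx with (h | h) | (h | h)
  exacts [h13 x h, h2 x h, h3 x h, h4 x h]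

theorem eq_empty_of_isCompact_of_eventually_mem_levelSet {U O : Set (ℝ × ℝ)} {τ : ℝ × ℝ → ℝ}
    {t r : ℝ} (hU : IsOpen U) (hτ : ContDiffOn ℝ 2 τ U) (hrU : closedBall 0 r ⊆ U)
    (hcrit : ∀ x ∈ closedBall (0 : ℝ × ℝ) r, fderiv ℝ τ x ≠ 0)
    (hO : IsCompact O) (hOr : O ⊆ closedBall 0 r) (hOt : ∀ x ∈ O, τ x = t)
    (hloc : ∀ x ∈ O, ∀ᶠ y in 𝓝 x, τ y = t → y ∈ O) : O = ∅ := by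
  by_contra hne
  obtain ⟨x₀, hx₀⟩ := nonempty_iff_ne_empty.2 hne
  have hr : 0 ≤ r := (norm_nonneg x₀).trans (by simpa using hOr hx₀)
  have hτat : ∀ x ∈ U, ContDiffAt ℝ 2 τ x := fun x hx ↦ hτ.contDiffAt (hU.mem_nhds hx)
  have hdc : ContinuousOn (fderiv ℝ τ) U := fun x hx ↦
    ((hτat x hx).continuousAt_fderiv (by norm_num)).continuousWithinAt
  have hWo : IsOpen (U ∩ fderiv ℝ τ ⁻¹' {0}ᶜ) :=
    hdc.isOpen_inter_preimage hU isOpen_compl_singleton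
  obtain ⟨δ, hδ, hδW⟩ := (isCompact_closedBall (0 : ℝ × ℝ) r).exists_cthickening_subset_open hWo
    (fun x hx ↦ ⟨hrU hx, hcrit x hx⟩)
  rw [cthickening_closedBall hδ.le hr] at hδW
  set R := δ + r
  have hV : {y | τ y = t → y ∈ O} ∈ 𝓝ˢ O := mem_nhdsSet_iff_forall.2 hloc
  obtain ⟨V, hVo, hOV, hVt⟩ := mem_nhdsSet_iff_exists.1 hV
  obtain ⟨L, hL, hOL, hLV⟩ := exists_compact_between hO (hVo.inter isOpen_ball)
    (subset_inter hOV (hOr.trans (closedBall_subset_ball (by simp [R, hδ] : r < R))))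
  have hLU : L ⊆ U := fun x hx ↦ (hδW (ball_subset_closedBall (hLV hx).2)).1
  have hτL : ContinuousOn τ L := hτ.continuousOn.mono hLU
  obtain ⟨ε, hε, hεL⟩ : ∃ ε > 0, ∀ y ∈ L \ interior L, ε ≤ |τ y - t| := by
    refine (hL.diff isOpen_interior).exists_forall_le' (f := fun y ↦ |τ y - t|) ?_ ?_
    · exact ((hτL.mono sdiff_subset).sub continuousOn_const).abs
    · intro y hy
      refine abs_pos.2 (sub_ne_zero.2 fun h ↦ hy.2 (hOL (hVt (hLV hy.1).1 h)))
  let ρ : ContDiffBump (0 : ℝ) := ⟨ε / 4, ε / 2, by positivity, by linarith⟩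
  have hρ0 : ∀ s : ℝ, ε / 2 ≤ |s| → ρ s = 0 := fun s hs ↦
    ρ.zero_of_le_dist (by simpa [Real.dist_eq] using hs)
  classical
  let l : ℝ × ℝ → ℝ := fun x ↦ if x ∈ interior L then ρ (τ x - t) else 0
  have hl : ∀ x, 0 ≤ l x := fun x ↦ by
    simp only [l]; split_ifs
    exacts [ρ.nonneg, le_rfl]
  have hlR : ∀ x, R < ‖x‖ → l x = 0 := fun x hx ↦ if_neg fun h ↦ by
    have := (hLV (interior_subset h)).2
    rw [mem_ball_zero_iff] at this
    linarith
  let C : Set (ℝ × ℝ) := L ∩ (fun x ↦ |τ x - t|) ⁻¹' Iic (ε / 2)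
  have hC : IsClosed C := (hτL.sub continuousOn_const).abs.preimage_isClosed_of_isClosed
    hL.isClosed isClosed_Iic
  have hCL : C ⊆ interior L := fun x hx ↦ by
    by_contra h
    have h1 := hεL x ⟨hx.1, h⟩
    have h2 : |τ x - t| ≤ ε / 2 := hx.2
    linarith
  let ω : ℝ × ℝ → (ℝ × ℝ →L[ℝ] ℝ) := fun x ↦ l x • fderiv ℝ τ x
  have hωin : ∀ x ∈ interior L, ω =ᶠ[𝓝 x] fun y ↦ ρ (τ y - t) • fderiv ℝ τ y := fun x hx ↦ by
    filter_upwards [isOpen_interior.mem_nhds hx] with y hy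
    simp [ω, l, hy]
  have hωout : ∀ x ∉ C, ω =ᶠ[𝓝 x] fun _ ↦ 0 := fun x hx ↦ by
    filter_upwards [hC.isOpen_compl.mem_nhds hx] with y hy
    simp only [ω, l]
    split_ifs with h
    · have : ρ (τ y - t) = 0 := hρ0 _ <| by
        by_contra! h'
        exact hy ⟨interior_subset h, h'.le⟩
      simp [this]
    · simp
  have hω : ∀ x, DifferentiableAt ℝ ω x ∧ ∀ u v, fderiv ℝ ω x u v = fderiv ℝ ω x v u := by
    intro x
    by_cases hx : x ∈ C
    · have hxU := hLU hx.1
      have h1 : HasFDerivAt τ (fderiv ℝ τ x) x :=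
        ((hτat x hxU).differentiableAt (by norm_num)).hasFDerivAt
      have h2 : HasFDerivAt (fderiv ℝ τ) (fderiv ℝ (fderiv ℝ τ) x) x :=
        (((hτat x hxU).fderiv_right (m := 1) (by norm_num)).differentiableAt
          (by norm_num)).hasFDerivAt
      have h3 : HasDerivAt ρ (deriv ρ (τ x - t)) (τ x - t) :=
        ((ρ.contDiff (n := 1)).differentiable (by norm_num)).differentiableAt.hasDerivAt
      have h4 := (h3.comp_hasFDerivAt x (h1.sub_const t)).smul h2
      have h5 := h4.congr_of_eventuallyEq (hωin x (hCL hx))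
      refine ⟨h5.differentiableAt, fun u v ↦ ?_⟩
      have hsymm := ((hτat x hxU).isSymmSndFDerivAt (by simp)) u v
      rw [h5.fderiv]
      simp [hsymm]
      ring
    · have h5 := (hasFDerivAt_const (𝕜 := ℝ) (0 : ℝ × ℝ →L[ℝ] ℝ) x).congr_of_eventuallyEq
        (hωout x hx)
      exact ⟨h5.differentiableAt, fun u v ↦ by simp [h5.fderiv]⟩
  obtain ⟨f, hf⟩ := convex_univ.exists_forall_hasFDerivAt_of_fderiv_symmetric isOpen_univ
    (ω := ω) (fun x _ ↦ (hω x).1.differentiableWithinAt) (fun x _ ↦ (hω x).2)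
  replace hf : ∀ x, HasFDerivAt f (l x • fderiv ℝ τ x) x := fun x ↦ hf x (mem_univ x)
  obtain ⟨c, hc⟩ := exists_eq_const_of_fderiv_eq_zero_off_closedBall
    (fun x ↦ (hf x).differentiableAt) (R := R)
    (fun x hx ↦ by rw [(hf x).fderiv, hlR x hx, zero_smul])
  have hτ1 : ∀ x ∈ closedBall (0 : ℝ × ℝ) R, ContDiffAt ℝ 1 τ x := fun x hx ↦
    (hτat x (hδW hx).1).of_le (by norm_num)
  have hle : ∀ x, f x - c ≤ 0 := nonpos_of_hasFDerivAt_smul_of_eq_zero hτ1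
    (fun x hx ↦ (hδW hx).2) hl (fun x ↦ (hf x).sub_const c) (fun x hx ↦ by simp [hc x hx])
  have hge : ∀ x, c - f x ≤ 0 := by
    refine nonpos_of_hasFDerivAt_smul_of_eq_zero (τ := -τ) (R := R) (l := l)
      (fun x hx ↦ (hτ1 x hx).neg)
      (fun x hx ↦ by rw [fderiv_neg]; exact neg_ne_zero.2 (hδW hx).2) hl (fun x ↦ ?_)
      (fun x hx ↦ by simp [hc x hx])
    rw [fderiv_neg, smul_neg]
    exact (hf x).const_sub c
  have hfc : f = fun _ ↦ c := funext fun x ↦ by linarith [hle x, hge x]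
  have h0 := (hf x₀).unique (hfc ▸ hasFDerivAt_const c x₀)
  have hl0 : l x₀ = 1 := by
    simp only [l, if_pos (hOL hx₀), hOt x₀ hx₀, sub_self]
    exact ρ.one_of_mem_closedBall (by simp [ρ]; positivity)
  rw [hl0, one_smul] at h0
  exact hcrit x₀ (hOr hx₀) h0

theorem exists_continuous_section_power_sum {i j : Fin 2} (hij : i ≠ j) {a b : ℕ} (ha : a ≠ 0)
    {c : ℂ} {p : Fin 2 → ℂ} (hp : p i ^ a + p j ^ b = c) (hpi : p i ≠ 0) :
    ∃ s : ℂ → Fin 2 → ℂ, (∀ᶠ w in 𝓝 (p j), ContinuousAt s w) ∧ (∀ w, s w j = w) ∧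
      (∀ w, s w i ^ a + w ^ b = c) ∧
      ∀ᶠ z in 𝓝 p, z i ^ a + z j ^ b = c → s (z j) = z := by
  have hpa : p i ^ a ≠ 0 := pow_ne_zero _ hpi
  have hcp : (c - p j ^ b) / p i ^ a = 1 := by rw [← hp, add_sub_cancel_right, div_self hpa]
  let h : ℂ → ℂ := fun w ↦ (c - w ^ b) / p i ^ a
  have hh : Continuous h := by fun_prop
  refine ⟨fun w ↦ Function.update (fun _ ↦ w) i (p i * h w ^ ((a : ℂ)⁻¹)), ?_, fun w ↦ ?_,
    fun w ↦ ?_, ?_⟩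
  · have : ∀ᶠ w in 𝓝 (p j), h w ∈ Complex.slitPlane :=
      hh.continuousAt.eventually_mem (Complex.isOpen_slitPlane.mem_nhds (by
        simp only [h, hcp]; exact Complex.one_mem_slitPlane))
    filter_upwards [this] with w hw
    refine ContinuousAt.update (continuousAt_pi.2 fun _ ↦ continuousAt_id) i ?_
    exact continuousAt_const.mul (hh.continuousAt.cpow continuousAt_const hw)
  · simp [hij.symm]
  · simp only [Function.update_self, mul_pow, Complex.cpow_nat_inv_pow _ ha, h]
    field_simp
    ring
  · have hd : ContinuousAt (fun z : Fin 2 → ℂ ↦ (z i / p i).arg) p := by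
      refine ContinuousAt.comp (f := fun z : Fin 2 → ℂ ↦ z i / p i) (g := Complex.arg)
        (Complex.continuousAt_arg ?_)
        ((continuous_apply i).div_const _).continuousAt
      rw [div_self hpi]
      exact Complex.one_mem_slitPlane
    have hpos : 0 < Real.pi / a := by positivity
    have h0 : (p i / p i).arg = 0 := by rw [div_self hpi, Complex.arg_one]
    filter_upwards [hd.eventually_mem (Ioo_mem_nhds (a := -(Real.pi / a)) (b := Real.pi / a)
      (by rw [h0]; linarith) (by rw [h0]; exact hpos))] with z hz hzc
    have hhz : h (z j) = (z i / p i) ^ a := by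
      simp only [h]
      rw [← hzc, add_sub_cancel_right, div_pow]
    ext l
    rcases (by omega : l = i ∨ l = j) with rfl | rfl
    · rw [Function.update_self, hhz, Complex.pow_cpow_nat_inv ha hz.1 hz.2.le,
        mul_div_cancel₀ _ hpi]
    · simp [hij.symm]

theorem ContinuousLinearMap.exists_equiv_of_injective {E F : Type*} [NormedAddCommGroup E]
    [NormedSpace ℝ E] [FiniteDimensional ℝ E] [NormedAddCommGroup F] [NormedSpace ℝ F]
    [FiniteDimensional ℝ F] (f : E →L[ℝ] F) (hf : Function.Injective f)
    (hd : Module.finrank ℝ E = Module.finrank ℝ F) : ∃ e : E ≃L[ℝ] F, (e : E →L[ℝ] F) = f :=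
  ⟨(LinearMap.linearEquivOfInjective (f : E →ₗ[ℝ] F) hf hd).toContinuousLinearEquiv, by
    ext x; simp⟩

theorem exists_equiv_eq_prod {τ' : ℝ × ℝ →L[ℝ] ℝ} (h : τ' ≠ 0) :
    ∃ (l : ℝ × ℝ →L[ℝ] ℝ) (e : (ℝ × ℝ) ≃L[ℝ] ℝ × ℝ),
      (e : ℝ × ℝ →L[ℝ] ℝ × ℝ) = τ'.prod l := by
  set α := τ' (1, 0)
  set β := τ' (0, 1)
  have hτ : ∀ x, τ' x = x.1 * α + x.2 * β := fun x ↦ by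
    have : x = x.1 • ((1, 0) : ℝ × ℝ) + x.2 • ((0, 1) : ℝ × ℝ) := by ext <;> simp
    conv_lhs => rw [this]
    rw [map_add, map_smul, map_smul, smul_eq_mul, smul_eq_mul]
  have hne : 0 < α ^ 2 + β ^ 2 := by
    by_contra! h0
    have hα : α = 0 := by nlinarith [sq_nonneg α, sq_nonneg β]
    have hβ : β = 0 := by nlinarith [sq_nonneg α, sq_nonneg β]
    exact h (by ext <;> simp [hτ, hα, hβ])
  refine ⟨α • ContinuousLinearMap.snd ℝ ℝ ℝ - β • ContinuousLinearMap.fst ℝ ℝ ℝ,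
    ContinuousLinearMap.exists_equiv_of_injective _ ?_ rfl⟩
  refine (injective_iff_map_eq_zero _).2 fun x hx ↦ ?_
  simp only [ContinuousLinearMap.prod_apply, Prod.mk_eq_zero, hτ] at hx
  obtain ⟨h1, h2⟩ := hx
  simp at h2
  have e1 : x.1 * (α ^ 2 + β ^ 2) = 0 := by linear_combination α * h1 - β * h2
  have e2 : x.2 * (α ^ 2 + β ^ 2) = 0 := by linear_combination β * h1 + α * h2
  ext
  · simpa [hne.ne'] using e1
  · simpa [hne.ne'] using e2

/-- A chart of the curve `z i ^ a + z j ^ b = c` around `φ x₀` which straightens the trace of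
`φ '' Q` on that curve: the trace is contained in the axis `y.2 = 0`, and it is parametrized by
the level set of `τ` through `x₀`. -/
theorem exists_straightening_chart {i j : Fin 2} (hij : i ≠ j) {a b : ℕ} (ha : a ≠ 0)
    {c : ℂ} {Q : Set (ℝ × ℝ)} (hQ : IsCompact Q) {φ : ℝ × ℝ → Fin 2 → ℂ} (hφQ : ContinuousOn φ Q)
    (hinj : InjOn φ Q) {x₀ : ℝ × ℝ} (hx₀ : x₀ ∈ Q) {τ : ℝ × ℝ → ℝ} {t : ℝ}
    {φ' : ℝ × ℝ →L[ℝ] (Fin 2 → ℂ)} {τ' : ℝ × ℝ →L[ℝ] ℝ} (hφ : HasStrictFDerivAt φ φ' x₀)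
    (hτ : HasStrictFDerivAt τ τ' x₀) (hτ' : τ' ≠ 0) (hφ' : Function.Injective φ')
    (htan : ∀ v, τ' v = 0 →
      a * φ x₀ i ^ (a - 1) * φ' v i + b * φ x₀ j ^ (b - 1) * φ' v j = 0)
    (hlev : ∀ x ∈ Q, φ x i ^ a + φ x j ^ b = c ↔ τ x = t) (hx₀t : τ x₀ = t)
    (hpi : φ x₀ i ≠ 0) :
    ∃ δ > 0, ∃ (g : ℝ × ℝ → Fin 2 → ℂ) (γ : ℝ → ℝ × ℝ), ContinuousOn g (ball 0 δ) ∧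
      (∀ y, g y i ^ a + g y j ^ b = c) ∧ g 0 = φ x₀ ∧
      (∀ᶠ z in 𝓝 (φ x₀), z i ^ a + z j ^ b = c → z ∈ g '' ball 0 δ) ∧
      (∀ y ∈ ball (0 : ℝ × ℝ) δ, g y ∈ φ '' Q → y.2 = 0 ∧ γ y.1 ∈ Q) ∧
      (∀ u, (u, 0) ∈ ball (0 : ℝ × ℝ) δ → γ u ∈ Q → g (u, 0) = φ (γ u)) ∧
      ∀ᶠ x in 𝓝 x₀, τ x = t → ∃ u, (u, 0) ∈ ball (0 : ℝ × ℝ) δ ∧ x = γ u := by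
  set p := φ x₀ with hp
  have hpc : p i ^ a + p j ^ b = c := (hlev x₀ hx₀).2 hx₀t
  obtain ⟨s, hsc, hsj, hsS, hsp⟩ := exists_continuous_section_power_sum hij ha hpc hpi
  obtain ⟨l, H', hH'⟩ := exists_equiv_eq_prod hτ'
  have hH : HasStrictFDerivAt (fun x ↦ (τ x, l x - l x₀)) (H' : ℝ × ℝ →L[ℝ] ℝ × ℝ) x₀ := by
    rw [hH']
    exact hτ.prodMk (l.hasStrictFDerivAt.sub_const _)
  have hHx₀ : (τ x₀, l x₀ - l x₀) = (t, 0) := by rw [hx₀t, sub_self]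
  let γ : ℝ → ℝ × ℝ := fun u ↦ hH.localInverse _ _ _ (t, u)
  have hγ0 : γ 0 = x₀ := by
    have := hH.localInverse_apply_image
    rwa [hHx₀] at this
  have hγ' : HasStrictFDerivAt γ
      ((H'.symm : ℝ × ℝ →L[ℝ] ℝ × ℝ).comp (ContinuousLinearMap.inr ℝ ℝ ℝ)) 0 := by
    have h1 := hH.to_localInverse
    rw [hHx₀] at h1
    have h2 : HasStrictFDerivAt (fun u : ℝ ↦ (t, u)) (ContinuousLinearMap.inr ℝ ℝ ℝ) 0 :=
      (hasStrictFDerivAt_const t (0 : ℝ)).prodMk (hasStrictFDerivAt_id (0 : ℝ))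
    exact HasStrictFDerivAt.comp (f := fun u : ℝ ↦ (t, u)) (0 : ℝ) h1 h2
  have hγr : ∀ᶠ u in 𝓝 (0 : ℝ), τ (γ u) = t := by
    have h1 := hH.eventually_right_inverse
    rw [hHx₀] at h1
    have h2 : Tendsto (fun u : ℝ ↦ (t, u)) (𝓝 0) (𝓝 (t, 0)) := by
      have : Continuous fun u : ℝ ↦ (t, u) := by fun_prop
      exact this.tendsto 0
    filter_upwards [h2.eventually h1] with u hu
    exact congrArg Prod.fst hu
  have hγl : ∀ᶠ x in 𝓝 x₀, τ x = t → γ (l x - l x₀) = x := by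
    filter_upwards [hH.eventually_left_inverse] with x hx hxt
    rwa [hxt] at hx
  set k := H'.symm (0, 1) with hk
  have hHk : H' k = (0, 1) := H'.apply_symm_apply _
  have hτk : τ' k = 0 := by
    have : (H' : ℝ × ℝ →L[ℝ] ℝ × ℝ) k = (0, 1) := hHk
    rw [hH'] at this
    exact congrArg Prod.fst this
  set e := φ' k j with he
  have he0 : e ≠ 0 := by
    intro h0
    have h1 := htan k hτk
    rw [← he, h0, mul_zero, add_zero] at h1
    have h2 : φ' k i = 0 := by
      refine (mul_eq_zero.1 h1).resolve_left ?_
      have : (a : ℂ) ≠ 0 := by exact_mod_cast ha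
      exact mul_ne_zero this (pow_ne_zero _ hpi)
    have h3 : φ' k = 0 := by
      ext m
      rcases (by omega : m = i ∨ m = j) with rfl | rfl
      exacts [h2, h0]
    have h4 : k = 0 := hφ' (by rw [h3, map_zero])
    rw [h4, map_zero] at hHk
    simp [Prod.ext_iff] at hHk
  let E : ℝ × ℝ → ℂ := fun y ↦ φ (γ y.1) j + y.2 • (Complex.I * e)
  obtain ⟨E', hE'⟩ := ContinuousLinearMap.exists_equiv_of_injective
    ((ContinuousLinearMap.fst ℝ ℝ ℝ).smulRight e +
      (ContinuousLinearMap.snd ℝ ℝ ℝ).smulRight (Complex.I * e)) (by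
      refine (injective_iff_map_eq_zero _).2 fun x hx ↦ ?_
      have h1 : ((x.1 : ℂ) + x.2 * Complex.I) * e = 0 := by
        simp at hx
        linear_combination hx
      have h2 := (mul_eq_zero.1 h1).resolve_right he0
      have hr := congrArg Complex.re h2
      have hi := congrArg Complex.im h2
      simp at hr hi
      exact Prod.ext hr hi) (by simp)
  have hE : HasStrictFDerivAt E (E' : ℝ × ℝ →L[ℝ] ℂ) 0 := by
    rw [hE']
    have h1 : HasStrictFDerivAt (fun y : ℝ × ℝ ↦ φ (γ y.1) j)
        (((ContinuousLinearMap.proj j : (Fin 2 → ℂ) →L[ℝ] ℂ).comp φ').comp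
          (((H'.symm : ℝ × ℝ →L[ℝ] ℝ × ℝ).comp (ContinuousLinearMap.inr ℝ ℝ ℝ)).comp
          (ContinuousLinearMap.fst ℝ ℝ ℝ))) 0 := by
      have h2 : HasStrictFDerivAt (fun y : ℝ × ℝ ↦ γ y.1)
          (((H'.symm : ℝ × ℝ →L[ℝ] ℝ × ℝ).comp (ContinuousLinearMap.inr ℝ ℝ ℝ)).comp
          (ContinuousLinearMap.fst ℝ ℝ ℝ)) 0 :=
        HasStrictFDerivAt.comp (g := γ) (f := Prod.fst) (0 : ℝ × ℝ) hγ' hasStrictFDerivAt_fst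
      have h3 : HasStrictFDerivAt (fun x ↦ φ x j)
          ((ContinuousLinearMap.proj j : (Fin 2 → ℂ) →L[ℝ] ℂ).comp φ') (γ (0 : ℝ × ℝ).1) := by
        rw [Prod.fst_zero, hγ0]
        exact (ContinuousLinearMap.proj (R := ℝ) (φ := fun _ : Fin 2 ↦ ℂ) j).hasStrictFDerivAt.comp
          x₀ hφ
      exact HasStrictFDerivAt.comp (0 : ℝ × ℝ) h3 h2
    have h4 : HasStrictFDerivAt (fun y : ℝ × ℝ ↦ y.2 • (Complex.I * e))
        ((ContinuousLinearMap.snd ℝ ℝ ℝ).smulRight (Complex.I * e)) 0 :=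
      ((ContinuousLinearMap.snd ℝ ℝ ℝ).smulRight (Complex.I * e)).hasStrictFDerivAt
    have hder : (ContinuousLinearMap.fst ℝ ℝ ℝ).smulRight e =
        ((ContinuousLinearMap.proj j : (Fin 2 → ℂ) →L[ℝ] ℂ).comp φ').comp
          (((H'.symm : ℝ × ℝ →L[ℝ] ℝ × ℝ).comp (ContinuousLinearMap.inr ℝ ℝ ℝ)).comp
          (ContinuousLinearMap.fst ℝ ℝ ℝ)) := by
      ext
      · simp [he, hk]
      · have h0 : H'.symm ((0 : ℝ), (0 : ℝ)) = 0 := map_zero H'.symm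
        simp [h0]
    rw [hder]
    exact h1.add h4
  have hE0 : E 0 = p j := by simp [E, hγ0, hp]
  let Ep := hE.toOpenPartialHomeomorph
  have hEp : ∀ y, Ep y = E y := fun _ ↦ rfl
  have hE0s : (0 : ℝ × ℝ) ∈ Ep.source := hE.mem_toOpenPartialHomeomorph_source
  obtain ⟨δ₁, hδ₁, hδ₁s⟩ := Metric.isOpen_iff.1 Ep.open_source 0 hE0s
  have hlu : ∀ ε > 0, ∀ᶠ x in 𝓝 x₀, (l x - l x₀, (0 : ℝ)) ∈ ball (0 : ℝ × ℝ) ε := fun ε hε ↦ by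
    have h1 : Continuous fun x ↦ (l x - l x₀, (0 : ℝ)) := by fun_prop
    exact h1.continuousAt.eventually_mem (by
      rw [sub_self]
      exact ball_mem_nhds (0 : ℝ × ℝ) hε)
  have hnear : ∀ G ∈ 𝓝 x₀, ∀ᶠ z in 𝓝 p, ∀ x ∈ Q, φ x = z → x ∈ G := by
    intro G hG
    have hcpt : IsCompact (φ '' (Q \ interior G)) :=
      (hQ.diff isOpen_interior).image_of_continuousOn (hφQ.mono sdiff_subset)
    have hpn : p ∉ φ '' (Q \ interior G) := by
      rintro ⟨x, hx, hxp⟩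
      rw [hinj hx.1 hx₀ hxp] at hx
      exact hx.2 (mem_interior_iff_mem_nhds.2 hG)
    filter_upwards [hcpt.isClosed.isOpen_compl.mem_nhds hpn] with z hz x hx hxz
    by_contra hxG
    exact hz ⟨x, ⟨hx, fun h ↦ hxG (interior_subset h)⟩, hxz⟩
  have hEc : ContinuousAt E 0 := hE.continuousAt
  have hgc0 : ContinuousAt (fun y ↦ s (E y)) 0 :=
    ContinuousAt.comp (f := E) (g := s) (by rw [hE0]; exact hsc.self_of_nhds) hEc
  have hg0 : s (E 0) = p := by rw [hE0]; exact hsp.self_of_nhds hpc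
  have hev1 : ∀ᶠ y in 𝓝 (0 : ℝ × ℝ), ContinuousAt s (E y) :=
    hEc.eventually (hE0 ▸ hsc)
  have hev2 : ∀ᶠ y in 𝓝 (0 : ℝ × ℝ), ∀ x ∈ Q, φ x = s (E y) →
      (τ x = t → γ (l x - l x₀) = x) ∧ (l x - l x₀, (0 : ℝ)) ∈ ball (0 : ℝ × ℝ) δ₁ :=
    hgc0.eventually (by simpa only [hg0] using hnear _ (hγl.and (hlu δ₁ hδ₁)))
  have hev3 : ∀ᶠ y in 𝓝 (0 : ℝ × ℝ), τ (γ y.1) = t :=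
    (continuous_fst.tendsto (0 : ℝ × ℝ)).eventually hγr
  have hev4 : ∀ᶠ y in 𝓝 (0 : ℝ × ℝ),
      φ (γ y.1) i ^ a + φ (γ y.1) j ^ b = c → s (φ (γ y.1) j) = φ (γ y.1) := by
    have h1 : Tendsto (fun y : ℝ × ℝ ↦ φ (γ y.1)) (𝓝 0) (𝓝 p) := by
      have h2 : Tendsto γ (𝓝 0) (𝓝 x₀) := by simpa [hγ0] using hγ'.continuousAt.tendsto
      exact (hφ.continuousAt.tendsto.comp h2).comp (continuous_fst.tendsto (0 : ℝ × ℝ))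
    exact h1.eventually hsp
  obtain ⟨δ, hδ, hδs⟩ := Metric.eventually_nhds_iff_ball.1
    ((((hev1.and hev2).and hev3).and hev4).and (ball_mem_nhds (0 : ℝ × ℝ) hδ₁))
  have hδsrc : ball (0 : ℝ × ℝ) δ ⊆ Ep.source := fun y hy ↦ hδ₁s (hδs y hy).2
  refine ⟨δ, hδ, fun y ↦ s (E y), γ, ?_, fun y ↦ ?_, hg0, ?_, ?_, ?_, ?_⟩
  · intro y hy
    exact (ContinuousAt.comp (f := E) (g := s) (hδs y hy).1.1.1.1
      (Ep.continuousAt (hδsrc hy))).continuousWithinAt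
  · change s (E y) i ^ a + s (E y) j ^ b = c
    rw [hsj]
    exact hsS _
  · have hop : IsOpen (Ep '' ball 0 δ) := Ep.isOpen_image_of_subset_source isOpen_ball hδsrc
    have hmem : p j ∈ Ep '' ball 0 δ := ⟨0, mem_ball_self hδ, hE0⟩
    filter_upwards [hsp, (continuous_apply j).continuousAt.eventually_mem (hop.mem_nhds hmem)]
      with z hz hz2 hzc
    obtain ⟨y, hy, hyz⟩ := hz2
    refine ⟨y, hy, ?_⟩
    rw [← hz hzc, ← hyz, hEp]
  · rintro y hy ⟨x, hx, hxy⟩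
    replace hxy : φ x = s (E y) := hxy
    obtain ⟨h1, h2⟩ := (hδs y hy).1.1.1.2 x hx hxy
    have hxt : τ x = t := (hlev x hx).1 (by rw [hxy, hsj]; exact hsS _)
    have h3 : Ep y = Ep (l x - l x₀, 0) := by
      rw [hEp, hEp, ← hsj (E y), ← hxy]
      simp [E, h1 hxt]
    have h4 := Ep.injOn (hδsrc hy) (hδ₁s h2) h3
    rw [h4]
    exact ⟨rfl, by rwa [h1 hxt]⟩
  · intro u hu huQ
    have h1 := (hδs _ hu).1.2 ((hlev _ huQ).2 (hδs _ hu).1.1.2)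
    simpa [E] using h1
  · filter_upwards [hγl, hlu δ hδ] with x hx hx2 hxt
    exact ⟨_, hx2, (hx hxt).symm⟩

theorem IsPreconnected.subset_of_eventually_mem {α : Type*} [TopologicalSpace α]
    {S H X T : Set α} (hH : IsClosed H)
    (hopen : ∀ ζ ∈ H, ζ ∉ X → ∀ᶠ η in 𝓝 ζ, η ∈ S → η ∈ H) (hT : IsPreconnected T) (hTS : T ⊆ S)
    (hTX : Disjoint T X) (hTH : (T ∩ H).Nonempty) : T ⊆ H := by
  by_contra hne
  obtain ⟨η, hηT, hηH⟩ := not_subset.1 hne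
  have hV : IsClosed (interior (H ∪ Sᶜ))ᶜ := isOpen_interior.isClosed_compl
  have hout : ∀ z ∈ T, z ∉ H → z ∈ (interior (H ∪ Sᶜ))ᶜ := fun z hz hzH h ↦
    (interior_subset h).elim hzH fun h ↦ h (hTS hz)
  obtain ⟨z, hzT, hzH, hzV⟩ := isPreconnected_closed_iff.1 hT H _ hH hV
    (fun z hz ↦ (em (z ∈ H)).imp_right (hout z hz)) hTH ⟨η, hηT, hout η hηT hηH⟩
  refine hzV (mem_interior_iff_mem_nhds.2 ?_)
  filter_upwards [hopen z hzH (disjoint_left.1 hTX hzT)] with w hw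
  exact or_iff_not_imp_right.2 fun h ↦ hw (not_not.1 h)

theorem mem_closure_ball_inter_pos {δ : ℝ} {y : ℝ × ℝ} (hy : y ∈ ball (0 : ℝ × ℝ) δ)
    (h : 0 ≤ y.2) : y ∈ closure {x ∈ ball (0 : ℝ × ℝ) δ | 0 < x.2} := by
  have hc : Continuous fun s : ℝ ↦ (y.1, y.2 + s) := by fun_prop
  have h0 : Tendsto (fun s : ℝ ↦ (y.1, y.2 + s)) (𝓝[>] 0) (𝓝 y) := by
    have := hc.tendsto 0
    simp only [add_zero, Prod.mk.eta] at this
    exact this.mono_left nhdsWithin_le_nhds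
  refine mem_closure_of_tendsto h0 ?_
  filter_upwards [h0.eventually_mem (isOpen_ball.mem_nhds hy), self_mem_nhdsWithin] with s hs hs0
  exact ⟨hs, add_pos_of_nonneg_of_pos h hs0⟩

theorem mem_closure_ball_inter_neg {δ : ℝ} {y : ℝ × ℝ} (hy : y ∈ ball (0 : ℝ × ℝ) δ)
    (h : y.2 ≤ 0) : y ∈ closure {x ∈ ball (0 : ℝ × ℝ) δ | x.2 < 0} := by
  have hc : Continuous fun s : ℝ ↦ (y.1, y.2 + s) := by fun_prop
  have h0 : Tendsto (fun s : ℝ ↦ (y.1, y.2 + s)) (𝓝[<] 0) (𝓝 y) := by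
    have := hc.tendsto 0
    simp only [add_zero, Prod.mk.eta] at this
    exact this.mono_left nhdsWithin_le_nhds
  refine mem_closure_of_tendsto h0 ?_
  filter_upwards [h0.eventually_mem (isOpen_ball.mem_nhds hy), self_mem_nhdsWithin] with s hs hs0
  exact ⟨hs, add_neg_of_nonpos_of_neg h hs0⟩

theorem isPreconnected_halfBalls_union {δ u : ℝ} (hu : (u, 0) ∈ ball (0 : ℝ × ℝ) δ) :
    IsPreconnected (({x ∈ ball (0 : ℝ × ℝ) δ | 0 < x.2} ∪ {(u, 0)}) ∪
      ({x ∈ ball (0 : ℝ × ℝ) δ | x.2 < 0} ∪ {(u, 0)})) := by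
  have hp : IsPreconnected {x ∈ ball (0 : ℝ × ℝ) δ | 0 < x.2} :=
    ((convex_ball _ _).inter (convex_halfSpace_gt (f := Prod.snd) (IsLinearMap.mk (fun _ _ ↦ rfl)
      fun _ _ ↦ rfl) (0 : ℝ))).isPreconnected
  have hn : IsPreconnected {x ∈ ball (0 : ℝ × ℝ) δ | x.2 < 0} :=
    ((convex_ball _ _).inter (convex_halfSpace_lt (f := Prod.snd) (IsLinearMap.mk (fun _ _ ↦ rfl)
      fun _ _ ↦ rfl) (0 : ℝ))).isPreconnected
  refine IsPreconnected.union (u, 0) (Or.inr rfl) (Or.inr rfl)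
    (hp.subset_closure subset_union_left ?_) (hn.subset_closure subset_union_left ?_)
  · exact union_subset subset_closure
      (singleton_subset_iff.2 (mem_closure_ball_inter_pos hu le_rfl))
  · exact union_subset subset_closure
      (singleton_subset_iff.2 (mem_closure_ball_inter_neg hu le_rfl))

theorem mem_closure_image_halfBalls {α : Type*} [TopologicalSpace α] {δ : ℝ} {g : ℝ × ℝ → α}
    (hg : ContinuousOn g (ball 0 δ)) {y : ℝ × ℝ} (hy : y ∈ ball (0 : ℝ × ℝ) δ) :
    (0 ≤ y.2 → g y ∈ closure (g '' {x ∈ ball (0 : ℝ × ℝ) δ | 0 < x.2})) ∧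
      (y.2 ≤ 0 → g y ∈ closure (g '' {x ∈ ball (0 : ℝ × ℝ) δ | x.2 < 0})) :=
  ⟨fun h ↦ ((hg y hy).mono (sep_subset _ _)).mem_closure_image (mem_closure_ball_inter_pos hy h),
    fun h ↦ ((hg y hy).mono (sep_subset _ _)).mem_closure_image (mem_closure_ball_inter_neg hy h)⟩

theorem mem_closures_of_straightening {α : Type*} [TopologicalSpace α]
    {S H X : Set α} (hH : IsClosed H) (hHS : H ⊆ S)
    (hopen : ∀ ζ ∈ H, ζ ∉ X → ∀ᶠ η in 𝓝 ζ, η ∈ S → η ∈ H) {δ : ℝ}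
    {g : ℝ × ℝ → α} {G : Set ℝ} {p : α} (hg : ContinuousOn g (ball 0 δ))
    (hgS : ∀ y, g y ∈ S) (hcov : ∀ᶠ z in 𝓝 p, z ∈ S → z ∈ g '' ball 0 δ)
    (hgX : ∀ y ∈ ball (0 : ℝ × ℝ) δ, g y ∈ X → y.2 = 0 ∧ y.1 ∈ G)
    (hp₁ : p ∈ closure (H \ X)) (hp₂ : p ∈ closure (S \ H)) {u : ℝ}
    (hu : (u, 0) ∈ ball (0 : ℝ × ℝ) δ) :
    u ∈ G ∧ g (u, 0) ∈ closure (H \ X) ∧ g (u, 0) ∈ closure (S \ H) := by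
  set P := {x ∈ ball (0 : ℝ × ℝ) δ | 0 < x.2}
  set N := {x ∈ ball (0 : ℝ × ℝ) δ | x.2 < 0}
  have hcl := fun y hy ↦ mem_closure_image_halfBalls hg (y := y) hy
  have hPX : Disjoint (g '' P) X := by
    rw [disjoint_left]
    rintro _ ⟨y, hy, rfl⟩ h
    exact hy.2.ne' (hgX y hy.1 h).1
  have hNX : Disjoint (g '' N) X := by
    rw [disjoint_left]
    rintro _ ⟨y, hy, rfl⟩ h
    exact hy.2.ne (hgX y hy.1 h).1
  have hPH : g '' P ⊆ H ∨ Disjoint (g '' P) H := by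
    rw [or_iff_not_imp_right, not_disjoint_iff_nonempty_inter]
    refine IsPreconnected.subset_of_eventually_mem hH hopen
      (IsPreconnected.image ?_ _ (hg.mono (sep_subset _ _))) (by rintro _ ⟨y, -, rfl⟩; exact hgS y)
      hPX
    exact ((convex_ball _ _).inter (convex_halfSpace_gt (f := Prod.snd)
      (IsLinearMap.mk (fun _ _ ↦ rfl) fun _ _ ↦ rfl) (0 : ℝ))).isPreconnected
  have hNH : g '' N ⊆ H ∨ Disjoint (g '' N) H := by
    rw [or_iff_not_imp_right, not_disjoint_iff_nonempty_inter]
    refine IsPreconnected.subset_of_eventually_mem hH hopen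
      (IsPreconnected.image ?_ _ (hg.mono (sep_subset _ _))) (by rintro _ ⟨y, -, rfl⟩; exact hgS y)
      hNX
    exact ((convex_ball _ _).inter (convex_halfSpace_lt (f := Prod.snd)
      (IsLinearMap.mk (fun _ _ ↦ rfl) fun _ _ ↦ rfl) (0 : ℝ))).isPreconnected
  have hinH : ∀ V, g '' V ⊆ H → Disjoint (g '' V) X → closure (g '' V) ⊆ closure (H \ X) :=
    fun V h1 h2 ↦ closure_mono fun z hz ↦ ⟨h1 hz, disjoint_left.1 h2 hz⟩
  have houtH : ∀ V, Disjoint (g '' V) H → closure (g '' V) ⊆ closure (S \ H) :=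
    fun V h ↦ closure_mono fun z hz ↦
      ⟨by obtain ⟨y, -, rfl⟩ := hz; exact hgS y, disjoint_left.1 h hz⟩
  have hG : ¬ (g '' P ⊆ H ↔ g '' N ⊆ H) → u ∈ G := by
    intro h
    by_contra huG
    set T := (P ∪ {(u, 0)}) ∪ (N ∪ {(u, 0)})
    have hTb : T ⊆ ball 0 δ :=
      union_subset (union_subset (sep_subset _ _) (singleton_subset_iff.2 hu))
        (union_subset (sep_subset _ _) (singleton_subset_iff.2 hu))
    have hTX : Disjoint (g '' T) X := by
      rw [disjoint_left]
      rintro _ ⟨y, (hy | rfl) | (hy | rfl), rfl⟩ hX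
      · exact disjoint_left.1 hPX ⟨y, hy, rfl⟩ hX
      · exact huG (hgX _ hu hX).2
      · exact disjoint_left.1 hNX ⟨y, hy, rfl⟩ hX
      · exact huG (hgX _ hu hX).2
    have hT := IsPreconnected.subset_of_eventually_mem hH hopen
      ((isPreconnected_halfBalls_union hu).image g (hg.mono hTb))
      (by rintro _ ⟨y, -, rfl⟩; exact hgS y) hTX
    have hPn : P.Nonempty := closure_nonempty_iff.1 ⟨_, mem_closure_ball_inter_pos hu le_rfl⟩
    have hNn : N.Nonempty := closure_nonempty_iff.1 ⟨_, mem_closure_ball_inter_neg hu le_rfl⟩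
    have hPT : P ⊆ T := fun x hx ↦ Or.inl (Or.inl hx)
    have hNT : N ⊆ T := fun x hx ↦ Or.inr (Or.inl hx)
    refine h ⟨fun hP ↦ ?_, fun hN ↦ ?_⟩
    · obtain ⟨x, hx⟩ := hPn
      exact (image_mono hNT).trans
        (hT ⟨g x, mem_image_of_mem g (hPT hx), hP (mem_image_of_mem g hx)⟩)
    · obtain ⟨x, hx⟩ := hNn
      exact (image_mono hPT).trans
        (hT ⟨g x, mem_image_of_mem g (hNT hx), hN (mem_image_of_mem g hx)⟩)
  rcases hPH with hP | hP <;> rcases hNH with hN | hN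
  · obtain ⟨z, hz, hzSH⟩ := mem_closure_iff_frequently.1 hp₂ |>.and_eventually hcov |>.exists
    obtain ⟨y, hy, rfl⟩ := hzSH hz.1
    refine (hz.2 ?_).elim
    rcases le_total 0 y.2 with h | h
    · exact closure_minimal hP hH ((hcl y hy).1 h)
    · exact closure_minimal hN hH ((hcl y hy).2 h)
  · refine ⟨hG fun h ↦ ?_, hinH P hP hPX ((hcl _ hu).1 le_rfl), houtH N hN ((hcl _ hu).2 le_rfl)⟩
    obtain ⟨x, hx⟩ : N.Nonempty := closure_nonempty_iff.1 ⟨_, mem_closure_ball_inter_neg hu le_rfl⟩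
    exact disjoint_left.1 hN (mem_image_of_mem g hx) (h.1 hP (mem_image_of_mem g hx))
  · refine ⟨hG fun h ↦ ?_, hinH N hN hNX ((hcl _ hu).2 le_rfl), houtH P hP ((hcl _ hu).1 le_rfl)⟩
    obtain ⟨x, hx⟩ : P.Nonempty := closure_nonempty_iff.1 ⟨_, mem_closure_ball_inter_pos hu le_rfl⟩
    exact disjoint_left.1 hP (mem_image_of_mem g hx) (h.2 hN (mem_image_of_mem g hx))
  · obtain ⟨z, hz, hzSH⟩ := mem_closure_iff_frequently.1 hp₁ |>.and_eventually hcov |>.exists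
    obtain ⟨y, hy, rfl⟩ := hzSH (hHS hz.1)
    have hev := hopen _ hz.1 hz.2
    exfalso
    rcases le_total 0 y.2 with h | h
    · obtain ⟨_, ⟨x, hx, rfl⟩, hxH⟩ :=
        mem_closure_iff_frequently.1 ((hcl y hy).1 h) |>.and_eventually hev |>.exists
      exact disjoint_left.1 hP (mem_image_of_mem g hx) (hxH (hgS x))
    · obtain ⟨_, ⟨x, hx, rfl⟩, hxH⟩ :=
        mem_closure_iff_frequently.1 ((hcl y hy).2 h) |>.and_eventually hev |>.exists
      exact disjoint_left.1 hN (mem_image_of_mem g hx) (hxH (hgS x))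

theorem eventually_mem_closure_of_straightening {α : Type*} [TopologicalSpace α]
    {S H X : Set α} {δ : ℝ} {g : ℝ × ℝ → α} {p : α} (hg : ContinuousOn g (ball 0 δ))
    (hgS : ∀ y, g y ∈ S) (hcov : ∀ᶠ z in 𝓝 p, z ∈ S → z ∈ g '' ball 0 δ)
    (hgX : ∀ y ∈ ball (0 : ℝ × ℝ) δ, g y ∈ X → y.2 = 0) (hp : p ∉ closure (S \ H)) :
    ∀ᶠ z in 𝓝 p, z ∈ S → z ∈ closure (H \ X) := by
  have hev : ∀ᶠ z in 𝓝 p, z ∈ S → z ∈ H := by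
    filter_upwards [isClosed_closure.isOpen_compl.mem_nhds hp] with z hz hzS
    by_contra hzH
    exact hz (subset_closure ⟨hzS, hzH⟩)
  filter_upwards [hcov, hev.eventually_nhds] with z hz hzev hzS
  obtain ⟨y, hy, rfl⟩ := hz hzS
  rw [mem_closure_iff_frequently]
  rcases le_total 0 y.2 with h | h
  · refine ((mem_closure_iff_frequently.1
      ((mem_closure_image_halfBalls hg hy).1 h)).and_eventually hzev).mono ?_
    rintro _ ⟨⟨x, hx, rfl⟩, hxH⟩
    exact ⟨hxH (hgS x), fun hX ↦ hx.2.ne' (hgX x hx.1 hX)⟩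
  · refine ((mem_closure_iff_frequently.1
      ((mem_closure_image_halfBalls hg hy).2 h)).and_eventually hzev).mono ?_
    rintro _ ⟨⟨x, hx, rfl⟩, hxH⟩
    exact ⟨hxH (hgS x), fun hX ↦ hx.2.ne (hgX x hx.1 hX)⟩

theorem frequently_norm_lt_norm {w : ℂ} : ∃ᶠ v in 𝓝 w, ‖w‖ < ‖v‖ := by
  have hc : ∀ d : ℂ, Tendsto (fun s : ℝ ↦ w + s • d) (𝓝[>] 0) (𝓝 w) := fun d ↦ by
    have h : Continuous fun s : ℝ ↦ w + s • d := by fun_prop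
    have := h.tendsto 0
    simp only [zero_smul, add_zero] at this
    exact this.mono_left nhdsWithin_le_nhds
  by_cases hw : w = 0
  · refine (hc 1).frequently (Eventually.frequently ?_)
    filter_upwards [self_mem_nhdsWithin] with s hs
    simpa [hw] using (ne_of_gt hs)
  · refine (hc w).frequently (Eventually.frequently ?_)
    filter_upwards [self_mem_nhdsWithin] with s hs
    have h1 : w + s • w = ((1 + s : ℝ) : ℂ) * w := by
      rw [Complex.real_smul]; push_cast; ring
    have hs' : 0 < s := hs
    rw [h1, norm_mul, Complex.norm_real, Real.norm_of_nonneg (by linarith)]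
    have := norm_pos_iff.2 hw
    nlinarith

/-- The curve `z 0 ^ a + z 1 ^ b = c` has no nonempty compact relatively open subset avoiding the
origin. -/
theorem eq_empty_of_isCompact_of_eventually_mem_curve {a b : ℕ} (ha : a ≠ 0) (hb : b ≠ 0) {c : ℂ}
    {Y : Set (Fin 2 → ℂ)} (hY : IsCompact Y) (hYc : ∀ z ∈ Y, z 0 ^ a + z 1 ^ b = c)
    (hY0 : (0 : Fin 2 → ℂ) ∉ Y)
    (hloc : ∀ y ∈ Y, ∀ᶠ z in 𝓝 y, z 0 ^ a + z 1 ^ b = c → z ∈ Y) : Y = ∅ := by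
  by_contra hne
  obtain ⟨y, hyY, hmax⟩ := hY.exists_isMaxOn (nonempty_iff_ne_empty.2 hne)
    (f := fun z ↦ ‖z 0‖) (continuous_apply 0).norm.continuousOn
  have hmax' : ∀ z ∈ Y, ‖z 0‖ ≤ ‖y 0‖ := fun z hz ↦ hmax hz
  have hyc := hYc y hyY
  by_cases hy1 : y 1 = 0
  · have hy0 : y 0 ≠ 0 := fun h ↦ hY0 (by
      convert hyY; ext i; fin_cases i <;> simp [h, hy1])
    obtain ⟨s, hsc, hs1, hsS, hsp⟩ :=
      exists_continuous_section_power_sum (i := 0) (j := 1) (by decide) ha hyc hy0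
    have hsy : s (y 1) = y := hsp.self_of_nhds hyc
    obtain ⟨η, hη⟩ := IsAlgClosed.exists_pow_nat_eq (-c) (Nat.pos_of_ne_zero hb)
    have hc : y 0 ^ a = c := by rw [← hyc, hy1, zero_pow hb, add_zero]
    have hlim : Tendsto (fun r : ℝ ↦ s (r * η)) (𝓝[>] 0) (𝓝 y) := by
      have h1 : Continuous fun r : ℝ ↦ (r : ℂ) * η := by fun_prop
      have h2 := h1.tendsto 0
      have h3 := hsc.self_of_nhds.tendsto
      rw [hsy, hy1] at h3
      simp only [Complex.ofReal_zero, zero_mul] at h2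
      exact h3.comp (h2.mono_left nhdsWithin_le_nhds)
    obtain ⟨r, hr, hr0⟩ := ((hlim.eventually (hloc y hyY)).and self_mem_nhdsWithin).exists
    have hr0 : 0 < r := hr0
    have hle := hmax' _ (hr (by rw [hs1]; exact hsS _))
    have heq : s (r * η) 0 ^ a = ((1 + r ^ b : ℝ) : ℂ) * y 0 ^ a := by
      push_cast
      linear_combination hsS (r * η) - (r : ℂ) ^ b * hη - (1 + (r : ℂ) ^ b) * hc
    have hnorm := congrArg norm heq
    rw [norm_mul, Complex.norm_real, Real.norm_of_nonneg (by positivity), norm_pow, norm_pow]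
      at hnorm
    have h4 := pow_le_pow_left₀ (norm_nonneg _) hle a
    have h5 : 0 < ‖y 0‖ ^ a := pow_pos (norm_pos_iff.2 hy0) a
    have h6 : 0 < r ^ b := pow_pos hr0 b
    nlinarith
  · obtain ⟨s, hsc, hs0, hsS, hsp⟩ := exists_continuous_section_power_sum (i := 1) (j := 0)
      (a := b) (b := a) (c := c) (p := y) (by decide) hb (by rw [← hyc, add_comm]) hy1
    have hsy : s (y 0) = y := hsp.self_of_nhds (by rw [← hyc, add_comm])
    have hev : ∀ᶠ w in 𝓝 (y 0), s w ∈ Y := by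
      have := hsc.self_of_nhds.tendsto
      rw [hsy] at this
      filter_upwards [this.eventually (hloc y hyY)] with w hw
      exact hw (by rw [hs0, add_comm]; exact hsS w)
    obtain ⟨w, hw, hwY⟩ := (frequently_norm_lt_norm.and_eventually hev).exists
    have := hmax' _ hwY
    rw [hs0] at this
    exact this.not_gt hw

/-- Let `φ` parametrize a compact surface `φ '' Q` avoiding the origin and meeting the curve
`z 0 ^ a + z 1 ^ b = c` along a regular level set of `τ`. If the origin is not in the hull of the
intersection of the surface with the curve, then this intersection is polynomially convex. -/
theorem boundHull_subset_of_zero_notMem {a b : ℕ} (ha : a ≠ 0) (hb : b ≠ 0) {c : ℂ}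
    {U : Set (ℝ × ℝ)} {r : ℝ} {φ : ℝ × ℝ → Fin 2 → ℂ} {τ : ℝ × ℝ → ℝ} {t : ℝ} (hU : IsOpen U)
    (hrU : closedBall 0 r ⊆ U) (hφ : ContDiffOn ℝ 2 φ U) (hτ : ContDiffOn ℝ 2 τ U)
    (hinj : InjOn φ U) (hφ' : ∀ x ∈ closedBall 0 r, Function.Injective (fderiv ℝ φ x))
    (hτ' : ∀ x ∈ closedBall 0 r, fderiv ℝ τ x ≠ 0)
    (htan : ∀ x ∈ closedBall 0 r, ∀ v, fderiv ℝ τ x v = 0 →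
      a * φ x 0 ^ (a - 1) * fderiv ℝ φ x v 0 + b * φ x 1 ^ (b - 1) * fderiv ℝ φ x v 1 = 0)
    (hlev : ∀ x ∈ closedBall 0 r, φ x 0 ^ a + φ x 1 ^ b = c ↔ τ x = t)
    (hφ0 : ∀ x ∈ closedBall 0 r, φ x ≠ 0)
    (h0 : (0 : Fin 2 → ℂ) ∉
      boundHull (φ '' closedBall 0 r ∩ {z | z 0 ^ a + z 1 ^ b = c})) :
    boundHull (φ '' closedBall 0 r ∩ {z | z 0 ^ a + z 1 ^ b = c}) ⊆ φ '' closedBall 0 r := by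
  set Q := closedBall (0 : ℝ × ℝ) r
  set S := {z : Fin 2 → ℂ | z 0 ^ a + z 1 ^ b = c} with hS
  set X := φ '' Q ∩ S
  set H := boundHull X
  have hQ : IsCompact Q := isCompact_closedBall 0 r
  have hφQ : ContinuousOn φ Q := hφ.continuousOn.mono hrU
  have hτQ : ContinuousOn τ Q := hτ.continuousOn.mono hrU
  have hSc : IsClosed S := isClosed_eq (by fun_prop) continuous_const
  have hX : IsCompact X := (hQ.image_of_continuousOn hφQ).inter_right hSc
  have hH : IsClosed H := isClosed_boundHull X
  have hHS : H ⊆ S := fun z hz ↦ by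
    have := eval_eq_of_mem_boundHull (p := MvPolynomial.X 0 ^ a + MvPolynomial.X 1 ^ b) (c := c)
      (fun w hw ↦ by simpa [hS] using hw.2) hz
    simpa [hS] using this
  have hopen : ∀ ζ ∈ H, ζ ∉ X → ∀ᶠ η in 𝓝 ζ, η ∈ S → η ∈ H := fun ζ hζ hζX ↦
    eventually_mem_boundHull hX ha hb (fun w hw ↦ hw.2) (fun h ↦ h0 (h ▸ hζ)) hζX hζ
  have hchart : ∀ x₀ ∈ Q, τ x₀ = t → ∃ (δ : ℝ) (g : ℝ × ℝ → Fin 2 → ℂ) (γ : ℝ → ℝ × ℝ),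
      ContinuousOn g (ball 0 δ) ∧ (∀ y, g y ∈ S) ∧
      (∀ᶠ z in 𝓝 (φ x₀), z ∈ S → z ∈ g '' ball 0 δ) ∧
      (∀ y ∈ ball (0 : ℝ × ℝ) δ, g y ∈ φ '' Q → y.2 = 0 ∧ γ y.1 ∈ Q) ∧
      (∀ u, (u, 0) ∈ ball (0 : ℝ × ℝ) δ → γ u ∈ Q → g (u, 0) = φ (γ u)) ∧
      ∀ᶠ x in 𝓝 x₀, τ x = t → ∃ u, (u, 0) ∈ ball (0 : ℝ × ℝ) δ ∧ x = γ u := by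
    intro x₀ hx₀ hx₀t
    have hUn := hU.mem_nhds (hrU hx₀)
    have hφs := (hφ.contDiffAt hUn).hasStrictFDerivAt (by norm_num)
    have hτs := (hτ.contDiffAt hUn).hasStrictFDerivAt (by norm_num)
    by_cases hz : φ x₀ 0 = 0
    · have hz1 : φ x₀ 1 ≠ 0 := fun h ↦ hφ0 x₀ hx₀ (by ext i; fin_cases i <;> simp [hz, h])
      obtain ⟨δ, -, g, γ, h1, h2, -, h3, h4⟩ := exists_straightening_chart (i := 1) (j := 0)
        (a := b) (b := a) (c := c) (by decide) hb hQ hφQ (hinj.mono hrU) hx₀ hφs hτs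
        (hτ' x₀ hx₀) (hφ' x₀ hx₀) (fun v hv ↦ by rw [add_comm]; exact htan x₀ hx₀ v hv)
        (fun x hx ↦ by rw [add_comm]; exact hlev x hx) hx₀t hz1
      refine ⟨δ, g, γ, h1, fun y ↦ (add_comm _ _).trans (h2 y), ?_, h4⟩
      filter_upwards [h3] with z hz hzS
      exact hz ((add_comm _ _).trans hzS)
    · obtain ⟨δ, -, g, γ, h1, h2, -, h3, h4⟩ := exists_straightening_chart (i := 0) (j := 1)
        (by decide) ha hQ hφQ (hinj.mono hrU) hx₀ hφs hτs (hτ' x₀ hx₀) (hφ' x₀ hx₀)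
        (htan x₀ hx₀) (hlev) hx₀t hz
      exact ⟨δ, g, γ, h1, h2, h3, h4⟩
  set O := {x ∈ Q | τ x = t} ∩ (Q ∩ φ ⁻¹' (closure (H \ X) ∩ closure (S \ H)))
  have hO : IsCompact O := by
    refine hQ.of_isClosed_subset (IsClosed.inter ?_ ?_) fun x hx ↦ hx.2.1
    · exact hτQ.preimage_isClosed_of_isClosed hQ.isClosed isClosed_singleton
    · exact hφQ.preimage_isClosed_of_isClosed hQ.isClosed (isClosed_closure.inter isClosed_closure)
  have hOe : O = ∅ := by
    refine eq_empty_of_isCompact_of_eventually_mem_levelSet hU hτ hrU hτ' hO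
      (fun x hx ↦ hx.2.1) (fun x hx ↦ hx.1.2) fun x hx ↦ ?_
    obtain ⟨δ, g, γ, hg, hgS, hcov, hgQ, hgγ, hγ⟩ := hchart x hx.2.1 hx.1.2
    filter_upwards [hγ] with y hy hyt
    obtain ⟨u, hu, rfl⟩ := hy hyt
    obtain ⟨huQ, h1, h2⟩ := mem_closures_of_straightening (G := γ ⁻¹' Q) hH hHS hopen hg hgS hcov
      (fun y hy hyX ↦ hgQ y hy hyX.1) hx.2.2.1 hx.2.2.2 hu
    rw [hgγ u hu huQ] at h1 h2
    exact ⟨⟨huQ, hyt⟩, huQ, h1, h2⟩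
  have hYH : closure (H \ X) ⊆ H := closure_minimal sdiff_subset hH
  have hY : closure (H \ X) = ∅ := by
    refine eq_empty_of_isCompact_of_eventually_mem_curve ha hb (c := c)
      ((isCompact_boundHull hX).of_isClosed_subset isClosed_closure hYH)
      (fun z hz ↦ hHS (hYH hz)) (fun h ↦ h0 (hYH h)) fun y hy ↦ ?_
    by_cases hyX : y ∈ X
    · obtain ⟨⟨x, hx, rfl⟩, hxS⟩ := hyX
      have hxt : τ x = t := (hlev x hx).1 hxS
      obtain ⟨δ, g, γ, hg, hgS, hcov, hgQ, -⟩ := hchart x hx hxt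
      refine eventually_mem_closure_of_straightening hg hgS hcov
        (fun y hy hyX ↦ (hgQ y hy hyX.1).1) fun hcl ↦ ?_
      have : x ∈ O := ⟨⟨hx, hxt⟩, hx, hy, hcl⟩
      rw [hOe] at this
      exact this
    · filter_upwards [(hopen y (hYH hy) hyX).and (hX.isClosed.isOpen_compl.mem_nhds hyX)]
        with z hz hzS
      exact subset_closure ⟨hz.1 hzS, hz.2⟩
  rw [closure_empty_iff, sdiff_eq_empty] at hY
  exact hY.trans inter_subset_left

theorem fderiv_eq_zero_of_eq_zero_on_closedBall {E F : Type*} [NormedAddCommGroup E]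
    [NormedSpace ℝ E] [NormedAddCommGroup F] [NormedSpace ℝ F] {f : E → F} {U : Set E} {x : E}
    {r : ℝ} (hr : r ≠ 0) (hU : IsOpen U) (hrU : closedBall x r ⊆ U) (hf : ContDiffOn ℝ 1 f U)
    (h : ∀ y ∈ closedBall x r, f y = 0) : ∀ y ∈ closedBall x r, fderiv ℝ f y = 0 := by
  have hc : ContinuousOn (fderiv ℝ f) (closedBall x r) :=
    (hf.continuousOn_fderiv_of_isOpen hU le_rfl).mono hrU
  have hb : EqOn (fderiv ℝ f) 0 (ball x r) := fun y hy ↦ by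
    have : f =ᶠ[𝓝 y] fun _ ↦ 0 := by
      filter_upwards [isOpen_ball.mem_nhds hy] with z hz
      exact h z (ball_subset_closedBall hz)
    rw [this.fderiv_eq]
    simp
  exact hb.of_subset_closure hc continuousOn_const ball_subset_closedBall (closure_ball x hr).ge

/-- A totally real plane in `ℂ²` is not contained in a complex line. -/
theorem exists_ne_zero_of_totallyReal {φ' : ℝ × ℝ →L[ℝ] (Fin 2 → ℂ)}
    (hφ' : Function.Injective φ') (htr : ∀ v w, φ' v = Complex.I • φ' w → φ' v = 0) {i j : Fin 2}
    (hij : i ≠ j) {A B : ℂ} (hA : A ≠ 0) : ∃ v, A * φ' v i + B * φ' v j ≠ 0 := by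
  by_contra! h
  have hz : ∀ u : Fin 2 → ℂ, A * u i + B * u j = 0 → u j = 0 → u = 0 := fun u hu huj ↦ by
    rw [huj, mul_zero, add_zero] at hu
    ext l
    rcases (by omega : l = i ∨ l = j) with rfl | rfl
    exacts [(mul_eq_zero.1 hu).resolve_left hA, huj]
  obtain ⟨e, he⟩ := ContinuousLinearMap.exists_equiv_of_injective
    ((ContinuousLinearMap.proj j : (Fin 2 → ℂ) →L[ℝ] ℂ).comp φ')
    ((injective_iff_map_eq_zero _).2 fun v hv ↦ hφ' (by rw [hz _ (h v) hv, map_zero])) (by simp)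
  have hej : ∀ v, φ' v j = e v := fun v ↦ (congrArg (fun f ↦ f v) he).symm
  have hv : φ' (e.symm Complex.I) j = Complex.I := by rw [hej, e.apply_symm_apply]
  have hw : φ' (e.symm 1) j = 1 := by rw [hej, e.apply_symm_apply]
  have h1 := hz (φ' (e.symm Complex.I) - Complex.I • φ' (e.symm 1)) (by
    simp only [Pi.sub_apply, Pi.smul_apply, smul_eq_mul]
    linear_combination h (e.symm Complex.I) - Complex.I * h (e.symm 1)) (by simp [hv, hw])
  rw [htr _ _ (sub_eq_zero.1 h1)] at hv
  simp [eq_comm] at hv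

theorem hasFDerivAt_power_sum {φ : ℝ × ℝ → Fin 2 → ℂ} {φ' : ℝ × ℝ →L[ℝ] (Fin 2 → ℂ)} {x : ℝ × ℝ}
    (hφ : HasFDerivAt φ φ' x) (a b : ℕ) :
    HasFDerivAt (fun y ↦ φ y 0 ^ a + φ y 1 ^ b)
      ((a * φ x 0 ^ (a - 1)) • (ContinuousLinearMap.proj 0 : (Fin 2 → ℂ) →L[ℝ] ℂ).comp φ' +
        (b * φ x 1 ^ (b - 1)) • (ContinuousLinearMap.proj 1 : (Fin 2 → ℂ) →L[ℝ] ℂ).comp φ') x := by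
  have h := hasFDerivAt_pi'.1 hφ
  have h2 : HasFDerivAt (fun y ↦ φ y 0 ^ a + φ y 1 ^ b) _ x := ((h 0).pow a).add ((h 1).pow b)
  simpa [nsmul_eq_mul] using h2

end

/-- For integers `m, n ≥ 2`, a totally real `C²`-smooth disc
`K` contained in `{(z₁,z₂) : Re (z₁^m + z₂^n) = 0} ∖ {(0,0)}` is polynomially
convex iff `(0,0) ∉ K̂`. -/
theorem totallyRealDisc_in_re_power_sum_polyConvex_iff
    (m n : ℕ) (hm : 2 ≤ m) (hn : 2 ≤ n)
    (M : Set (Fin 2 → ℂ))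
    (hM : M = {z : Fin 2 → ℂ | ((z 0) ^ m + (z 1) ^ n).re = 0})
    (K : Set (Fin 2 → ℂ)) (hK : TotallyRealDisc 2 K)
    (hKM : K ⊆ M \ {0}) :
    PolyConvex 2 K ↔ (0 : Fin 2 → ℂ) ∉ polyHull 2 K := by
  obtain ⟨U, φ, hU, hQU, hφ, hinj, hφ', htr, rfl⟩ := hK
  subst hM
  have hm0 : m ≠ 0 := by omega
  have hn0 : n ≠ 0 := by omega
  set Q := Metric.closedBall (0 : ℝ × ℝ) 1
  have hK : IsCompact (φ '' Q) :=
    (isCompact_closedBall 0 1).image_of_continuousOn (hφ.continuousOn.mono hQU)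
  have hφ0 : ∀ x ∈ Q, φ x ≠ 0 := fun x hx ↦ (hKM (Set.mem_image_of_mem φ hx)).2
  have hre : ∀ x ∈ Q, (φ x 0 ^ m + φ x 1 ^ n).re = 0 := fun x hx ↦
    (hKM (Set.mem_image_of_mem φ hx)).1
  rw [PolyConvex, polyHull_eq_boundHull hK
    ((Metric.nonempty_closedBall.2 zero_le_one).image φ)]
  refine ⟨fun h h0 ↦ (hKM (h ▸ h0)).2 rfl, fun h0 ↦
    Set.Subset.antisymm (fun z hz ↦ ?_) (subset_boundHull _)⟩
  have hF : ContDiffOn ℝ 2 (fun x ↦ φ x 0 ^ m + φ x 1 ^ n) U :=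
    ((contDiffOn_pi.1 hφ 0).pow m).add ((contDiffOn_pi.1 hφ 1).pow n)
  have hdF : ∀ x ∈ Q, HasFDerivAt (fun x ↦ φ x 0 ^ m + φ x 1 ^ n) _ x := fun x hx ↦
    hasFDerivAt_power_sum ((hφ.contDiffAt (hU.mem_nhds (hQU hx))).differentiableAt
      (by norm_num)).hasFDerivAt m n
  have hdre : ∀ x ∈ Q, ∀ v, (m * φ x 0 ^ (m - 1) * fderiv ℝ φ x v 0 +
      n * φ x 1 ^ (n - 1) * fderiv ℝ φ x v 1).re = 0 := fun x hx v ↦ by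
    have h1 := fderiv_eq_zero_of_eq_zero_on_closedBall one_ne_zero hU hQU
      (Complex.reCLM.contDiff.comp_contDiffOn (hF.of_le one_le_two)) hre x hx
    rw [(Complex.reCLM.hasFDerivAt.comp x (hdF x hx)).fderiv] at h1
    simpa using congrArg (fun f ↦ f v) h1
  have hdim : ∀ x ∈ Q, ∀ v, fderiv ℝ (fun x ↦ (φ x 0 ^ m + φ x 1 ^ n).im) x v =
      (m * φ x 0 ^ (m - 1) * fderiv ℝ φ x v 0 +
      n * φ x 1 ^ (n - 1) * fderiv ℝ φ x v 1).im := fun x hx v ↦ by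
    have h1 := (Complex.imCLM.hasFDerivAt.comp x (hdF x hx)).fderiv
    refine (congrArg (fun f ↦ f v) h1).trans ?_
    simp
  have htan : ∀ x ∈ Q, ∀ v, fderiv ℝ (fun x ↦ (φ x 0 ^ m + φ x 1 ^ n).im) x v = 0 →
      m * φ x 0 ^ (m - 1) * fderiv ℝ φ x v 0 + n * φ x 1 ^ (n - 1) * fderiv ℝ φ x v 1 = 0 :=
    fun x hx v hv ↦ Complex.ext (hdre x hx v) ((hdim x hx v).symm.trans hv)
  have hz' := mem_boundHull_fiber (p := MvPolynomial.X 0 ^ m + MvPolynomial.X 1 ^ n) hK (by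
    rintro _ ⟨x, hx, rfl⟩
    simpa using hre x hx) hz
  have hzre := re_eval_eq_zero_of_mem_boundHull
    (p := MvPolynomial.X 0 ^ m + MvPolynomial.X 1 ^ n) hK (by
    rintro _ ⟨x, hx, rfl⟩
    simpa using hre x hx) hz
  simp only [map_add, map_pow, MvPolynomial.eval_X] at hz' hzre
  refine boundHull_subset_of_zero_notMem (τ := fun x ↦ (φ x 0 ^ m + φ x 1 ^ n).im)
    (t := (z 0 ^ m + z 1 ^ n).im) hm0 hn0 hU hQU hφ (Complex.imCLM.contDiff.comp_contDiffOn hF)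
    hinj (fun x hx ↦ hφ' x (hQU hx)) (fun x hx h ↦ ?_) htan
    (fun x hx ↦ ⟨fun h ↦ by rw [h], fun h ↦ Complex.ext ((hre x hx).trans hzre.symm) h⟩) hφ0
    (fun h ↦ h0 (boundHull_mono Set.inter_subset_left h)) hz'
  have hker : ∀ v, m * φ x 0 ^ (m - 1) * fderiv ℝ φ x v 0 +
      n * φ x 1 ^ (n - 1) * fderiv ℝ φ x v 1 = 0 := fun v ↦ htan x hx v (by rw [h]; rfl)
  by_cases h00 : φ x 0 = 0
  · have h1 : φ x 1 ≠ 0 := fun h1 ↦ hφ0 x hx (by ext i; fin_cases i <;> simp [h00, h1])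
    obtain ⟨v, hv⟩ := exists_ne_zero_of_totallyReal (hφ' x (hQU hx)) (htr x (hQU hx))
      (i := 1) (j := 0) (B := m * φ x 0 ^ (m - 1)) (by decide)
      (mul_ne_zero (Nat.cast_ne_zero.2 hn0) (pow_ne_zero (n - 1) h1))
    exact hv ((add_comm _ _).trans (hker v))
  · obtain ⟨v, hv⟩ := exists_ne_zero_of_totallyReal (hφ' x (hQU hx)) (htr x (hQU hx))
      (i := 0) (j := 1) (B := n * φ x 1 ^ (n - 1)) (by decide)
      (mul_ne_zero (Nat.cast_ne_zero.2 hm0) (pow_ne_zero (m - 1) h00))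
    exact hv (hker v)
end
end
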